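/- arXiv:math/0411107 — 3 statements merged into one kernel-verified Lean document; each statement's English description precedes it below -/
import Mathlib

section
/- Let n ≥ 2 and let f(x) = Σ_{j=1}^m c_j x^{a_j} be an n-variate m-nomial with nonzero real coefficients and distinct exponent vectors a_1, …, a_m ∈ ℤ^n, satisfying m ≤ 2 + dim Supp(f). Then the zero set Z_+(f) of f in the open positive orthant ℝ^n_+ has at most one compact connected component. -/
open Finset

/-- A function is continuous if it locates the sign change of a family of functions, each of
which is continuous in the parameter. -/
lemma continuousOn_of_sign_change {X : Type*} [TopologicalSpace X] {S : Set X} {F : X → ℝ → ℝ}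
    {h : X → ℝ} (hF : ∀ r, ContinuousOn (fun x => F x r) S)
    (hneg : ∀ x ∈ S, ∀ r < h x, F x r < 0) (hpos : ∀ x ∈ S, ∀ r > h x, 0 < F x r) :
    ContinuousOn h S := by
  intro x hx
  refine tendsto_order.2 ⟨fun r hr => ?_, fun r hr => ?_⟩
  · obtain ⟨r', h1, h2⟩ := exists_between hr
    filter_upwards [(hF r' x hx).eventually (gt_mem_nhds (hneg x hx r' h2)),
      self_mem_nhdsWithin] with z hz hzS
    by_contra hcon
    exact lt_asymm hz (hpos z hzS r' (by linarith))
  · obtain ⟨r', h1, h2⟩ := exists_between hr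
    filter_upwards [(hF r' x hx).eventually (lt_mem_nhds (hpos x hx r' h1)),
      self_mem_nhdsWithin] with z hz hzS
    by_contra hcon
    exact lt_asymm hz (hneg z hzS r' (by linarith))

lemma isPreconnected_of_sign_change {X Y : Type*} [TopologicalSpace X] [TopologicalSpace Y]
    {S : Set X} (hS : IsPreconnected S) {F : X → ℝ → ℝ} {G : X → ℝ → Y}
    (hF : ∀ r, ContinuousOn (fun x => F x r) S)
    (hzero : ∀ x ∈ S, ∃ h, F x h = 0 ∧ (∀ r < h, F x r < 0) ∧ ∀ r > h, 0 < F x r)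
    (hG : ContinuousOn (fun z : X × ℝ => G z.1 z.2) (S ×ˢ Set.univ)) :
    IsPreconnected {z | ∃ x ∈ S, ∃ r, F x r = 0 ∧ G x r = z} := by
  classical
  choose! h h0 hneg hpos using hzero
  have hc : ContinuousOn h S := continuousOn_of_sign_change hF hneg hpos
  have hGc : ContinuousOn (fun x => G x (h x)) S :=
    hG.comp (continuousOn_id.prodMk hc) fun x hx => ⟨hx, trivial⟩
  convert hS.image _ hGc using 1
  ext z
  constructor
  · rintro ⟨x, hx, r, hr, rfl⟩
    rcases lt_trichotomy r (h x) with hlt | heq | hgt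
    · exact absurd hr (hneg x hx r hlt).ne
    · exact ⟨x, hx, by simp [heq]⟩
    · exact absurd hr (hpos x hx r hgt).ne'
  · rintro ⟨x, hx, rfl⟩
    exact ⟨x, hx, h x, h0 x hx, rfl⟩

/-- The logarithmic form of the zero set of a polynomial with coefficients `c`, whose exponents
satisfy the affine relation `b`. -/
def expZeros {ι : Type*} [Fintype ι] (b c : ι → ℝ) : Set (ι → ℝ) :=
  {y | ∑ j, b j * y j = 0 ∧ ∑ j, c j * Real.exp (y j) = 0}

lemma expZeros_neg_left {ι : Type*} [Fintype ι] (b c : ι → ℝ) :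
    expZeros (-b) c = expZeros b c := by
  simp [expZeros, Finset.sum_neg_distrib]

lemma expZeros_neg_right {ι : Type*} [Fintype ι] (b c : ι → ℝ) :
    expZeros b (-c) = expZeros b c := by
  simp [expZeros, Finset.sum_neg_distrib]

/-- Replace the coordinates of `y` at `i` and `j` by `u` and `v`. -/
def setPair {ι : Type*} [DecidableEq ι] (i j : ι) (y : ι → ℝ) (u v : ℝ) : ι → ℝ :=
  fun k => if k = i then u else if k = j then v else y k

section setPair

variable {ι : Type*} [DecidableEq ι] {i j : ι}

lemma setPair_left (y : ι → ℝ) (u v : ℝ) : setPair i j y u v i = u := by simp [setPair]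

lemma setPair_right (hij : i ≠ j) (y : ι → ℝ) (u v : ℝ) : setPair i j y u v j = v := by
  simp [setPair, hij.symm]

lemma setPair_of_ne {k : ι} (hi : k ≠ i) (hj : k ≠ j) (y : ι → ℝ) (u v : ℝ) :
    setPair i j y u v k = y k := by simp [setPair, hi, hj]

lemma setPair_self (y : ι → ℝ) : setPair i j y (y i) (y j) = y := by
  funext k
  unfold setPair
  split_ifs with h1 h2 <;> simp_all

lemma continuousOn_setPair {X : Type*} [TopologicalSpace X] {S : Set X} {y : X → ι → ℝ}
    {u v : X → ℝ} (hy : ContinuousOn y S) (hu : ContinuousOn u S) (hv : ContinuousOn v S) :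
    ContinuousOn (fun x => setPair i j (y x) (u x) (v x)) S := by
  refine continuousOn_pi.2 fun k => ?_
  unfold setPair
  split_ifs
  · exact hu
  · exact hv
  · exact (continuousOn_pi.1 hy) k

lemma sum_setPair [Fintype ι] (hij : i ≠ j) (φ : ι → ℝ → ℝ) (y : ι → ℝ) (u v : ℝ) :
    ∑ k, φ k (setPair i j y u v k)
      = ∑ k, φ k (y k) + (φ i u - φ i (y i)) + (φ j v - φ j (y j)) := by
  have h : ∑ k, (φ k (setPair i j y u v k) - φ k (y k))
      = ∑ k ∈ {i, j}, (φ k (setPair i j y u v k) - φ k (y k)) := by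
    symm
    refine Finset.sum_subset (Finset.subset_univ _) fun k _ hk => ?_
    simp only [Finset.mem_insert, Finset.mem_singleton, not_or] at hk
    simp [setPair_of_ne hk.1 hk.2]
  rw [Finset.sum_pair hij, setPair_left, setPair_right hij, Finset.sum_sub_distrib] at h
  linarith

end setPair

lemma log_one_add_exp_bounds {r : ℝ} (hr : 0 ≤ r) :
    r ≤ Real.log (1 + Real.exp r) ∧ Real.log (1 + Real.exp (-r)) ≤ Real.log 2 ∧
      0 ≤ Real.log (1 + Real.exp (-r)) := by
  refine ⟨?_, ?_, Real.log_nonneg (by linarith [Real.exp_pos (-r)])⟩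
  · rw [Real.le_log_iff_exp_le (by positivity)]; linarith
  · refine Real.log_le_log (by positivity) ?_
    have : Real.exp (-r) ≤ 1 := Real.exp_le_one_iff.2 (by linarith)
    linarith

lemma exists_log_one_add_exp_eq {β γ : ℝ} (hβ : 0 < β) (hγ : 0 < γ) (C : ℝ) :
    ∃ r, C - β * Real.log (1 + Real.exp (-r)) + γ * Real.log (1 + Real.exp r) = 0 := by
  set f : ℝ → ℝ :=
    fun r => C - β * Real.log (1 + Real.exp (-r)) + γ * Real.log (1 + Real.exp r) with hf
  have hfc : Continuous f := by
    have h1 : Continuous fun r : ℝ => Real.log (1 + Real.exp (-r)) :=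
      Continuous.log (by fun_prop) fun r => by positivity
    have h2 : Continuous fun r : ℝ => Real.log (1 + Real.exp r) :=
      Continuous.log (by fun_prop) fun r => by positivity
    fun_prop
  have hlim : Filter.Tendsto f Filter.atTop Filter.atTop := by
    have : Filter.Tendsto (fun r : ℝ => (C - β * Real.log 2) + γ * r)
        Filter.atTop Filter.atTop :=
      Filter.tendsto_atTop_add_const_left _ _ (Filter.tendsto_id.const_mul_atTop hγ)
    refine Filter.tendsto_atTop_mono' _ ?_ this
    filter_upwards [Filter.eventually_ge_atTop 0] with r hr
    obtain ⟨h1, h2, h3⟩ := log_one_add_exp_bounds hr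
    simp only [hf]; nlinarith
  have hlim' : Filter.Tendsto f Filter.atBot Filter.atBot := by
    have : Filter.Tendsto (fun r : ℝ => (C + γ * Real.log 2) + β * r)
        Filter.atBot Filter.atBot :=
      Filter.tendsto_atBot_add_const_left _ _ (Filter.tendsto_id.const_mul_atBot hβ)
    refine Filter.tendsto_atBot_mono' _ ?_ this
    filter_upwards [Filter.eventually_le_atBot 0] with r hr
    obtain ⟨h1, h2, h3⟩ := log_one_add_exp_bounds (neg_nonneg.2 hr)
    rw [neg_neg] at h2
    simp only [hf]; nlinarith
  exact hfc.surjective hlim hlim' 0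

section dichotomy

variable {ι : Type*} [Fintype ι] {b c : ι → ℝ}

lemma isPreconnected_expSum_zeros (c : ι → ℝ) :
    IsPreconnected {y : ι → ℝ | ∑ j, c j * Real.exp (y j) = 0} := by
  have hconv : Convex ℝ {t : ι → ℝ | (∀ j, 0 < t j) ∧ ∑ j, c j * t j = 0} := by
    intro t ht s hs p q hp hq hpq
    refine ⟨fun j => ?_, ?_⟩
    · have := ht.1 j
      have := hs.1 j
      simp only [Pi.add_apply, Pi.smul_apply, smul_eq_mul]
      rcases hp.lt_or_eq with h | h
      · positivity
      · have : q = 1 := by linarith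
        subst h; subst this; simpa using hs.1 j
    · have : ∑ j, c j * (p • t + q • s) j = p * ∑ j, c j * t j + q * ∑ j, c j * s j := by
        rw [Finset.mul_sum, Finset.mul_sum, ← Finset.sum_add_distrib]
        refine Finset.sum_congr rfl fun j _ => ?_
        simp; ring
      rw [this, ht.2, hs.2]; simp
  have hcont : ContinuousOn (fun (t : ι → ℝ) j => Real.log (t j))
      {t : ι → ℝ | (∀ j, 0 < t j) ∧ ∑ j, c j * t j = 0} := by
    refine continuousOn_pi.2 fun j => ContinuousOn.log (by fun_prop) fun t ht => (ht.1 j).ne'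
  convert hconv.isPreconnected.image _ hcont using 1
  ext y
  constructor
  · intro hy
    exact ⟨fun j => Real.exp (y j), ⟨fun j => Real.exp_pos _, hy⟩, by simp⟩
  · rintro ⟨t, ht, rfl⟩
    simpa [Real.exp_log (ht.1 _)] using ht.2

variable [DecidableEq ι]

/-- Two coefficients of equal sign at which the affine relation has opposite signs. -/
lemma isPreconnected_expZeros_of_coeff_pos {i j : ι} (hci : 0 < c i) (hcj : 0 < c j)
    (hbi : 0 < b i) (hbj : b j < 0) : IsPreconnected (expZeros b c) := by
  have hij : i ≠ j := by rintro rfl; linarith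
  set R : (ι → ℝ) → ℝ := fun y => c i * Real.exp (y i) + c j * Real.exp (y j) with hR
  have hRpos : ∀ y, 0 < R y := fun y => by positivity
  have hRc : Continuous R := by fun_prop
  set u : (ι → ℝ) → ℝ → ℝ := fun y r => Real.log (R y / c i) - Real.log (1 + Real.exp (-r)) with hu
  set v : (ι → ℝ) → ℝ → ℝ := fun y r => Real.log (R y / c j) - Real.log (1 + Real.exp r) with hv
  have huc : Continuous (fun z : (ι → ℝ) × ℝ => u z.1 z.2) := by
    refine Continuous.sub (Continuous.log (by fun_prop) fun z => ?_)
      (Continuous.log (by fun_prop) fun z => by positivity)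
    exact (div_pos (hRpos _) hci).ne'
  have hvc : Continuous (fun z : (ι → ℝ) × ℝ => v z.1 z.2) := by
    refine Continuous.sub (Continuous.log (by fun_prop) fun z => ?_)
      (Continuous.log (by fun_prop) fun z => by positivity)
    exact (div_pos (hRpos _) hcj).ne'
  have hGc : Continuous (fun z : (ι → ℝ) × ℝ => setPair i j z.1 (u z.1 z.2) (v z.1 z.2)) := by
    rw [← continuousOn_univ]
    exact continuousOn_setPair continuousOn_fst huc.continuousOn hvc.continuousOn
  set F : (ι → ℝ) → ℝ → ℝ := fun y r => ∑ k, b k * setPair i j y (u y r) (v y r) k with hF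
  have hFc : Continuous (fun z : (ι → ℝ) × ℝ => F z.1 z.2) :=
    continuous_finsetSum _ fun k _ => continuous_const.mul ((continuous_apply k).comp hGc)
  have hmono : ∀ y, StrictMono (F y) := by
    intro y r s hrs
    simp only [hF]
    rw [sum_setPair hij (fun k x => b k * x), sum_setPair hij (fun k x => b k * x)]
    have h1 : u y r < u y s := by
      have : Real.log (1 + Real.exp (-s)) < Real.log (1 + Real.exp (-r)) :=
        Real.log_lt_log (by positivity) (by gcongr)
      simp only [hu]; linarith
    have h2 : v y s < v y r := by
      have : Real.log (1 + Real.exp r) < Real.log (1 + Real.exp s) :=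
        Real.log_lt_log (by positivity) (by gcongr)
      simp only [hv]; linarith
    nlinarith
  have hsurj : ∀ y, ∃ r, F y r = 0 := by
    intro y
    obtain ⟨r, hr⟩ := exists_log_one_add_exp_eq hbi (neg_pos.2 hbj) (∑ k, b k * y k
      + b i * (Real.log (R y / c i) - y i) + b j * (Real.log (R y / c j) - y j))
    refine ⟨r, ?_⟩
    simp only [hF]
    rw [sum_setPair hij (fun k x => b k * x), ← hr]
    simp only [hu, hv]
    ring
  convert isPreconnected_of_sign_change (isPreconnected_expSum_zeros c) (F := F)
    (G := fun y r => setPair i j y (u y r) (v y r))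
    (fun r => (hFc.comp (by fun_prop : Continuous fun y : ι → ℝ => (y, r))).continuousOn)
    (fun y _ => ?_) hGc.continuousOn using 1
  · ext y
    have hexp : ∀ z r, ∑ k, c k * Real.exp (setPair i j z (u z r) (v z r) k)
        = ∑ k, c k * Real.exp (z k) := by
      intro z r
      rw [sum_setPair hij (fun k x => c k * Real.exp x)]
      simp only [hu, hv]
      rw [Real.exp_sub, Real.exp_sub, Real.exp_log (div_pos (hRpos _) hci),
        Real.exp_log (div_pos (hRpos _) hcj), Real.exp_log (by positivity),
        Real.exp_log (by positivity), Real.exp_neg]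
      have h0 : R z = c i * Real.exp (z i) + c j * Real.exp (z j) := rfl
      have := Real.exp_pos r
      generalize Real.exp r = e at *
      have h1 : c i * (R z / c i / (1 + e⁻¹)) + c j * (R z / c j / (1 + e)) = R z := by
        field_simp
        ring
      linarith
    constructor
    · rintro ⟨hb, hc⟩
      have h1 : 0 < c i * Real.exp (y i) := by positivity
      have h2 : 0 < c j * Real.exp (y j) := by positivity
      set r := Real.log (c i * Real.exp (y i) / (c j * Real.exp (y j))) with hr
      have her : Real.exp r = c i * Real.exp (y i) / (c j * Real.exp (y j)) :=
        Real.exp_log (by positivity)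
      have hui : u y r = y i := by
        simp only [hu]
        rw [← Real.log_div (div_pos (hRpos _) hci).ne' (by positivity), Real.exp_neg, her]
        rw [← Real.log_exp (y i)]
        congr 1
        simp only [hR, Real.log_exp]
        field_simp
      have hvj : v y r = y j := by
        simp only [hv]
        rw [← Real.log_div (div_pos (hRpos _) hcj).ne' (by positivity), her]
        rw [← Real.log_exp (y j)]
        congr 1
        simp only [hR, Real.log_exp]
        field_simp
        ring
      have hG : setPair i j y (u y r) (v y r) = y := by rw [hui, hvj, setPair_self]
      exact ⟨y, hc, r, by simpa only [hF, hG] using hb, hG⟩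
    · rintro ⟨z, hz, r, hr, rfl⟩
      exact ⟨hr, (hexp z r).trans hz⟩
  · obtain ⟨r, hr⟩ := hsurj y
    exact ⟨r, hr, fun s hs => hr ▸ hmono y hs, fun s hs => hr ▸ hmono y hs⟩

/-- Two coefficients of opposite signs at which the affine relation has equal signs. -/
lemma isPreconnected_expZeros_of_relation_pos {i j : ι} (hci : 0 < c i) (hcj : c j < 0)
    (hbi : 0 < b i) (hbj : 0 < b j) : IsPreconnected (expZeros b c) := by
  have hij : i ≠ j := by rintro rfl; linarith
  set F : (ι → ℝ) → ℝ → ℝ :=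
    fun y r => ∑ k, c k * Real.exp (setPair i j y (y i + r / b i) (y j - r / b j) k) with hF
  have hGc : Continuous
      (fun z : (ι → ℝ) × ℝ => setPair i j z.1 (z.1 i + z.2 / b i) (z.1 j - z.2 / b j)) := by
    rw [← continuousOn_univ]
    exact continuousOn_setPair continuousOn_fst (by fun_prop) (by fun_prop)
  have hFc : Continuous (fun z : (ι → ℝ) × ℝ => F z.1 z.2) :=
    continuous_finsetSum _ fun k _ =>
      continuous_const.mul (Real.continuous_exp.comp ((continuous_apply k).comp hGc))
  have hval : ∀ y r, F y r = (∑ k, c k * Real.exp (y k) - c i * Real.exp (y i)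
      - c j * Real.exp (y j)) + c i * Real.exp (y i + r / b i)
      + c j * Real.exp (y j - r / b j) := by
    intro y r
    simp only [hF]
    rw [sum_setPair hij (fun k x => c k * Real.exp x)]
    ring
  have hmono : ∀ y, StrictMono (F y) := by
    intro y r s hrs
    rw [hval, hval]
    have h1 : Real.exp (y i + r / b i) < Real.exp (y i + s / b i) := by gcongr
    have h2 : Real.exp (y j - s / b j) < Real.exp (y j - r / b j) := by gcongr
    nlinarith
  have hsurj : ∀ y, ∃ r, F y r = 0 := by
    intro y
    have hFy : Continuous (F y) := hFc.comp (by fun_prop : Continuous fun r : ℝ => (y, r))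
    set C := (∑ k, c k * Real.exp (y k) - c i * Real.exp (y i) - c j * Real.exp (y j)) with hC
    have hlim : Filter.Tendsto (F y) Filter.atTop Filter.atTop := by
      have : Filter.Tendsto (fun r : ℝ => (C + c j * Real.exp (y j)) + c i * (y i + r / b i + 1))
          Filter.atTop Filter.atTop := by
        refine Filter.tendsto_atTop_add_const_left _ _ (Filter.Tendsto.const_mul_atTop hci ?_)
        refine Filter.tendsto_atTop_add_const_right _ _
          (Filter.tendsto_atTop_add_const_left _ _ (Filter.tendsto_id.atTop_div_const hbi))
      refine Filter.tendsto_atTop_mono' _ ?_ this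
      filter_upwards [Filter.eventually_ge_atTop 0] with r hr
      have h1 := Real.add_one_le_exp (y i + r / b i)
      have h2 : Real.exp (y j - r / b j) ≤ Real.exp (y j) :=
        Real.exp_le_exp.2 (by linarith [div_nonneg hr hbj.le])
      rw [hval]; nlinarith
    have hlim' : Filter.Tendsto (F y) Filter.atBot Filter.atBot := by
      have : Filter.Tendsto (fun r : ℝ => (C + c i * Real.exp (y i) + c j * (y j + 1))
          + (-c j / b j) * r) Filter.atBot Filter.atBot :=
        Filter.tendsto_atBot_add_const_left _ _
          (Filter.tendsto_id.const_mul_atBot (div_pos (by linarith) hbj))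
      refine Filter.tendsto_atBot_mono' _ ?_ this
      filter_upwards [Filter.eventually_le_atBot 0] with r hr
      have h1 := Real.add_one_le_exp (y j - r / b j)
      have h2 : Real.exp (y i + r / b i) ≤ Real.exp (y i) :=
        Real.exp_le_exp.2 (by linarith [div_nonpos_of_nonpos_of_nonneg hr hbi.le])
      have h3 : -c j / b j * r = c j * (- r / b j) := by ring
      have h4 : - r / b j = - (r / b j) := by ring
      rw [hval, h3, h4]; nlinarith
    exact hFy.surjective hlim hlim' 0
  have hconv : Convex ℝ {y : ι → ℝ | ∑ k, b k * y k = 0} := by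
    intro t ht s hs p q _ _ _
    have : ∑ j, b j * (p • t + q • s) j = p * ∑ j, b j * t j + q * ∑ j, b j * s j := by
      rw [Finset.mul_sum, Finset.mul_sum, ← Finset.sum_add_distrib]
      refine Finset.sum_congr rfl fun j _ => ?_
      simp; ring
    simp only [Set.mem_ofPred_eq] at ht hs ⊢
    rw [this, ht, hs]; simp
  convert isPreconnected_of_sign_change hconv.isPreconnected (F := F)
    (G := fun y r => setPair i j y (y i + r / b i) (y j - r / b j))
    (fun r => (hFc.comp (by fun_prop : Continuous fun y : ι → ℝ => (y, r))).continuousOn)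
    (fun y _ => ?_) hGc.continuousOn using 1
  · ext y
    constructor
    · rintro ⟨hb, hc⟩
      have hG : setPair i j y (y i + 0 / b i) (y j - 0 / b j) = y := by simp [setPair_self]
      exact ⟨y, hb, 0, by simpa only [hF, hG] using hc, hG⟩
    · rintro ⟨z, hz, r, hr, rfl⟩
      refine ⟨?_, hr⟩
      rw [sum_setPair hij (fun k x => b k * x)]
      simp only [Set.mem_ofPred_eq] at hz
      rw [hz]; field_simp; ring
  · obtain ⟨r, hr⟩ := hsurj y
    exact ⟨r, hr, fun s hs => hr ▸ hmono y hs, fun s hs => hr ▸ hmono y hs⟩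

lemma exists_unbounded_of_relation_eq_zero {k p q : ι} (hbk : b k = 0) (hck : c k ≠ 0)
    {v : ι → ℝ} (hv : ∑ j, b j * v j = 0) (hvpq : v q < v p) (hpk : p ≠ k) (hqk : q ≠ k)
    {y : ι → ℝ} (hy : y ∈ expZeros b c) :
    ∃ T ⊆ expZeros b c, y ∈ T ∧ IsPreconnected T ∧
      ¬ ∃ B, ∀ z ∈ T, ∀ i j, z i - z j ≤ B := by
  set φ : ℝ → ℝ := fun s => -(∑ j ∈ univ.erase k, c j * Real.exp (y j + s * v j)) / c k with hφ
  have hφc : Continuous φ := by fun_prop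
  set G : ℝ → ι → ℝ := fun s j => if j = k then Real.log (φ s) else y j + s * v j with hG
  have hφ0 : φ 0 = Real.exp (y k) := by
    have := hy.2
    rw [← Finset.add_sum_erase _ _ (mem_univ k)] at this
    simp only [hφ, zero_mul, add_zero]
    rw [div_eq_iff hck]; linarith
  have hG0 : G 0 = y := by
    funext j
    simp only [hG]
    split_ifs with h
    · rw [hφ0, h, Real.log_exp]
    · simp
  have hGmem : ∀ s, 0 < φ s → G s ∈ expZeros b c := by
    intro s hs
    constructor
    · have : ∀ j, b j * G s j = b j * y j + s * (b j * v j) := by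
        intro j
        simp only [hG]
        split_ifs with h
        · rw [h, hbk]; ring
        · ring
      simp_rw [this, Finset.sum_add_distrib, ← Finset.mul_sum, hv, hy.1]
      simp
    · rw [← Finset.add_sum_erase _ _ (mem_univ k)]
      have : ∑ j ∈ univ.erase k, c j * Real.exp (G s j)
          = ∑ j ∈ univ.erase k, c j * Real.exp (y j + s * v j) := by
        refine Finset.sum_congr rfl fun j hj => ?_
        simp only [hG, if_neg (Finset.ne_of_mem_erase hj)]
      rw [this]
      simp only [hG, if_true]
      rw [Real.exp_log hs]
      simp only [hφ]
      field_simp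
      ring
  have hGc : ContinuousOn G {s | 0 < φ s} := by
    refine continuousOn_pi.2 fun j => ?_
    simp only [hG]
    split_ifs
    · exact ContinuousOn.log hφc.continuousOn fun s hs => hs.ne'
    · fun_prop
  have key : ∀ J : Set ℝ, 0 ∈ J → IsPreconnected J → (∀ s ∈ J, 0 < φ s) →
      (¬ ∃ B, ∀ s ∈ J, ∀ i j, G s i - G s j ≤ B) →
      ∃ T ⊆ expZeros b c, y ∈ T ∧ IsPreconnected T ∧
      ¬ ∃ B, ∀ z ∈ T, ∀ i j, z i - z j ≤ B := by
    intro J h0 hJ hpos hB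
    refine ⟨G '' J, ?_, ⟨0, h0, hG0⟩, hJ.image _ (hGc.mono hpos), ?_⟩
    · rintro _ ⟨s, hs, rfl⟩
      exact hGmem s (hpos s hs)
    · rintro ⟨B, h⟩
      exact hB ⟨B, fun s hs => h _ ⟨s, hs, rfl⟩⟩
  by_cases hall : ∀ s, 0 ≤ s → 0 < φ s
  · refine key (Set.Ici 0) (by simp) isPreconnected_Ici hall ?_
    rintro ⟨B, hB⟩
    have hd : 0 < v p - v q := sub_pos.2 hvpq
    set s := (|B - (y p - y q)| + 1) / (v p - v q) with hs
    have h1 := hB s (by simp only [Set.mem_Ici]; positivity) p q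
    simp only [hG, if_neg hpk, if_neg hqk] at h1
    have h2 : s * (v p - v q) = |B - (y p - y q)| + 1 := div_mul_cancel₀ _ hd.ne'
    have := le_abs_self (B - (y p - y q))
    linarith
  · push Not at hall
    set N : Set ℝ := {s | 0 ≤ s ∧ φ s ≤ 0} with hN
    have hNc : IsClosed N :=
      (isClosed_le continuous_const continuous_id).inter (isClosed_le hφc continuous_const)
    have hNbdd : BddBelow N := ⟨0, fun s hs => hs.1⟩
    obtain ⟨h1, h2⟩ : sInf N ∈ N := hNc.csInf_mem hall hNbdd
    have hlt : ∀ s ∈ Set.Ico 0 (sInf N), 0 < φ s := by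
      intro s hs
      by_contra hcon
      exact absurd (csInf_le hNbdd (show s ∈ N from ⟨hs.1, not_lt.1 hcon⟩)) (not_le.2 hs.2)
    have hpos : 0 < sInf N := by
      rcases h1.lt_or_eq with h | h
      · exact h
      · rw [← h, hφ0] at h2
        exact absurd h2 (not_le.2 (Real.exp_pos _))
    refine key (Set.Ico 0 (sInf N)) ⟨le_rfl, hpos⟩ isPreconnected_Ico hlt ?_
    rintro ⟨B, hB⟩
    have hle : ∀ s ∈ Set.Ico 0 (sInf N), Real.exp (y p + s * v p - B) ≤ φ s := by
      intro s hs
      have := hB s hs p k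
      simp only [hG, if_neg hpk, if_true] at this
      rw [← Real.exp_log (hlt s hs)]
      exact Real.exp_le_exp.2 (by linarith)
    have hcl : sInf N ∈ closure (Set.Ico 0 (sInf N)) := by
      rw [closure_Ico hpos.ne]; exact ⟨h1, le_rfl⟩
    have := (isClosed_le (by fun_prop) hφc).closure_subset_iff.2 hle hcl
    exact absurd (lt_of_lt_of_le (Real.exp_pos _) this) (not_lt.2 h2)

/-- Moving mass between two coordinates in the direction that does not increase the concave
function `β log + γ log` makes it strictly decrease. -/
lemma strictAntiOn_log_sub {α β γ : ℝ} (hα : 0 < α) (hβ : 0 < β) (h : β * α ≤ γ) :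
    StrictAntiOn (fun s => β * Real.log (1 + α * (1 - Real.exp (-s))) - γ * s) (Set.Ici 0) := by
  intro s hs t ht hst
  simp only [Set.mem_Ici] at hs ht
  have hes : Real.exp (-s) ≤ 1 := Real.exp_le_one_iff.2 (by linarith)
  have het : Real.exp (-t) ≤ 1 := Real.exp_le_one_iff.2 (by linarith)
  have h1 : 0 < 1 + α * (1 - Real.exp (-s)) := by nlinarith
  have h2 : 0 < 1 + α * (1 - Real.exp (-t)) := by nlinarith
  have h3 : Real.log (1 + α * (1 - Real.exp (-t))) - Real.log (1 + α * (1 - Real.exp (-s)))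
      ≤ α * (Real.exp (-s) - Real.exp (-t)) := by
    rw [← Real.log_div h2.ne' h1.ne']
    refine (Real.log_le_sub_one_of_pos (by positivity)).trans ?_
    have het' : Real.exp (-t) ≤ Real.exp (-s) := Real.exp_le_exp.2 (by linarith)
    rw [div_sub_one h1.ne', div_le_iff₀ h1]
    nlinarith [mul_nonneg (mul_nonneg hα.le (sub_nonneg.2 het'))
      (mul_nonneg hα.le (sub_nonneg.2 hes))]
  have h4 : Real.exp (-s) - Real.exp (-t) < t - s := by
    have h5 : Real.exp (-t) = Real.exp (-s) * Real.exp (-(t - s)) := by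
      rw [← Real.exp_add]; congr 1; ring
    have h6 := Real.add_one_lt_exp (x := -(t - s)) (by linarith)
    have h7 : Real.exp (-(t - s)) ≤ 1 := Real.exp_le_one_iff.2 (by linarith)
    have := Real.exp_pos (-s)
    rw [h5]; nlinarith
  have h8 : β * (α * (Real.exp (-s) - Real.exp (-t))) < β * (α * (t - s)) := by gcongr
  have h9 : β * α * (t - s) ≤ γ * (t - s) := by gcongr
  have h10 := mul_le_mul_of_nonneg_left h3 hβ.le
  show _ < _
  nlinarith

lemma exists_log_sub_eq {α β γ : ℝ} (hα : 0 < α) (hβ : 0 < β) (hγ : 0 < γ) {C : ℝ}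
    (hC : C ≤ 0) : ∃ r, 0 ≤ r ∧ β * Real.log (1 + α * (1 - Real.exp (-r))) - γ * r = C := by
  set f : ℝ → ℝ := fun r => β * Real.log (1 + α * (1 - Real.exp (-r))) - γ * r with hf
  have hpos : ∀ r : ℝ, 0 ≤ r → 0 < 1 + α * (1 - Real.exp (-r)) := by
    intro r hr
    have : Real.exp (-r) ≤ 1 := Real.exp_le_one_iff.2 (by linarith)
    nlinarith
  set R := (β * α - C) / γ with hR
  have hR0 : 0 ≤ R := div_nonneg (by nlinarith [mul_pos hβ hα]) hγ.le
  have hfc : ContinuousOn f (Set.Icc 0 R) := by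
    refine ContinuousOn.sub (continuousOn_const.mul
      (ContinuousOn.log (by fun_prop) fun r hr => (hpos r hr.1).ne')) (by fun_prop)
  have h0 : f 0 = 0 := by simp [hf]
  have h1 : f R ≤ C := by
    have h2 := Real.log_le_sub_one_of_pos (hpos R hR0)
    have h3 : γ * R = β * α - C := mul_div_cancel₀ _ hγ.ne'
    have h4 : Real.log (1 + α * (1 - Real.exp (-R))) ≤ α := by
      nlinarith [mul_pos hα (Real.exp_pos (-R))]
    simp only [hf]
    nlinarith
  obtain ⟨r, hr, hr'⟩ := intermediate_value_Icc' hR0 hfc ⟨h1, by rw [h0]; exact hC⟩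
  exact ⟨r, hr.1, hr'⟩

lemma setPair_log_mem {i j : ι} {y : ι → ℝ} {α s : ℝ} (hij : i ≠ j)
    (hpos : 0 < 1 + α * (1 - Real.exp (-s)))
    (hα : c i * Real.exp (y i) * α = c j * Real.exp (y j)) :
    ∑ k, c k * Real.exp (setPair i j y (y i + Real.log (1 + α * (1 - Real.exp (-s)))) (y j - s) k)
      = ∑ k, c k * Real.exp (y k) := by
  rw [sum_setPair hij (fun k x => c k * Real.exp x), Real.exp_add, Real.exp_log hpos,
    sub_eq_add_neg (y j) s, Real.exp_add]
  linear_combination (1 - Real.exp (-s)) * hα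

lemma exists_unbounded_of_mul_pos_aux {i j k l : ι} (hij : i ≠ j) (hkl : k ≠ l)
    (hci : 0 < c i) (hcj : 0 < c j) (hck : c k < 0) (hcl : c l < 0)
    (hbi : 0 < b i) (hbj : 0 < b j) (hbk : b k < 0) (hbl : b l < 0)
    {y : ι → ℝ} (hy : y ∈ expZeros b c)
    (h1 : b i * (c j * Real.exp (y j)) ≤ b j * (c i * Real.exp (y i)))
    (h2 : b k * (c l * Real.exp (y l)) ≤ b l * (c k * Real.exp (y k))) :
    ∃ T ⊆ expZeros b c, y ∈ T ∧ IsPreconnected T ∧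
      ¬ ∃ B, ∀ z ∈ T, ∀ i j, z i - z j ≤ B := by
  have hki : k ≠ i := by rintro rfl; linarith
  have hkj : k ≠ j := by rintro rfl; linarith
  have hli : l ≠ i := by rintro rfl; linarith
  have hlj : l ≠ j := by rintro rfl; linarith
  have hci' : 0 < c i * Real.exp (y i) := by positivity
  have hck' : c k * Real.exp (y k) < 0 := mul_neg_of_neg_of_pos hck (Real.exp_pos _)
  set α := c j * Real.exp (y j) / (c i * Real.exp (y i)) with hα
  set α' := c l * Real.exp (y l) / (c k * Real.exp (y k)) with hα'
  have hαpos : 0 < α := by positivity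
  have hαpos' : 0 < α' :=
    div_pos_of_neg_of_neg (mul_neg_of_neg_of_pos hcl (Real.exp_pos _)) hck'
  have hαi : c i * Real.exp (y i) * α = c j * Real.exp (y j) := mul_div_cancel₀ _ hci'.ne'
  have hαk : c k * Real.exp (y k) * α' = c l * Real.exp (y l) := mul_div_cancel₀ _ hck'.ne
  have hα1 : b i * α ≤ b j := by
    rw [← hαi] at h1
    nlinarith
  have hα2 : -b k * α' ≤ -b l := by
    rw [← hαk] at h2
    nlinarith
  set L : ℝ → ℝ → ℝ := fun a s => Real.log (1 + a * (1 - Real.exp (-s))) with hL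
  have hLpos : ∀ {a s : ℝ}, 0 < a → 0 ≤ s → 0 < 1 + a * (1 - Real.exp (-s)) := by
    intro a s ha hs
    have : Real.exp (-s) ≤ 1 := Real.exp_le_one_iff.2 (by linarith)
    nlinarith
  have hLc : ∀ {a}, 0 < a → ContinuousOn (L a) (Set.Ici 0) := fun ha =>
    ContinuousOn.log (by fun_prop) fun s hs => (hLpos ha hs).ne'
  set P : ℝ → ℝ := fun s => b i * L α s - b j * s with hP
  set Q : ℝ → ℝ := fun s => -b k * L α' s - -b l * s with hQ
  have hPanti : StrictAntiOn P (Set.Ici 0) := strictAntiOn_log_sub hαpos hbi hα1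
  have hQanti : StrictAntiOn Q (Set.Ici 0) := strictAntiOn_log_sub hαpos' (by linarith) hα2
  have hP0 : P 0 = 0 := by simp [hP, hL]
  have hPc : ContinuousOn P (Set.Ici 0) :=
    (continuousOn_const.mul (hLc hαpos)).sub (by fun_prop)
  set F : ℝ → ℝ → ℝ := fun s r => if r < 0 then -1 else P s - Q r with hF
  set G : ℝ → ℝ → ι → ℝ := fun s r => setPair k l
    (setPair i j y (y i + L α s) (y j - s)) (y k + L α' (max r 0)) (y l - r) with hG
  have hGc : ContinuousOn (fun z : ℝ × ℝ => G z.1 z.2) (Set.Ici 0 ×ˢ Set.univ) := by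
    refine continuousOn_setPair (continuousOn_setPair continuousOn_const ?_ (by fun_prop)) ?_
      (by fun_prop)
    · exact continuousOn_const.add ((hLc hαpos).comp continuousOn_fst fun z hz => hz.1)
    · exact continuousOn_const.add ((hLc hαpos').comp (by fun_prop) fun z hz => by simp)
  have hzero : ∀ s ∈ Set.Ici (0 : ℝ),
      ∃ h, F s h = 0 ∧ (∀ r < h, F s r < 0) ∧ ∀ r > h, 0 < F s r := by
    intro s hs
    have hPs : P s ≤ 0 := hP0 ▸ hPanti.antitoneOn (by simp) hs hs
    obtain ⟨h, h0, hh⟩ := exists_log_sub_eq hαpos' (neg_pos.2 hbk) (neg_pos.2 hbl) hPs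
    have hh' : Q h = P s := hh
    refine ⟨h, ?_, fun r hr => ?_, fun r hr => ?_⟩
    · simp [hF, not_lt.2 h0, hh']
    · simp only [hF]
      split_ifs with hr0
      · norm_num
      · have := hQanti (show r ∈ Set.Ici 0 from not_lt.1 hr0) h0 hr
        linarith
    · have hr0 : 0 ≤ r := h0.trans hr.le
      have := hQanti h0 (show r ∈ Set.Ici 0 from hr0) hr
      simp only [hF, if_neg (not_lt.2 hr0)]
      linarith
  refine ⟨_, ?_, ?_, isPreconnected_of_sign_change isPreconnected_Ici (F := F) (G := G)
    (fun r => ?_) hzero hGc, ?_⟩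
  · rintro _ ⟨s, hs, r, hr, rfl⟩
    simp only [hF] at hr
    split_ifs at hr with hr0
    · norm_num at hr
    rw [not_lt] at hr0
    have hyk : setPair i j y (y i + L α s) (y j - s) k = y k := setPair_of_ne hki hkj _ _ _
    have hyl : setPair i j y (y i + L α s) (y j - s) l = y l := setPair_of_ne hli hlj _ _ _
    simp only [hG, max_eq_left hr0]
    constructor
    · rw [sum_setPair hkl (fun k x => b k * x), sum_setPair hij (fun k x => b k * x), hy.1,
        hyk, hyl]
      simp only [hP, hQ] at hr
      linarith
    · rw [← hyk, ← hyl, setPair_log_mem hkl (hLpos hαpos' hr0) (by rw [hyk, hyl, hαk]),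
        setPair_log_mem hij (hLpos hαpos hs) hαi, hy.2]
  · refine ⟨0, by simp, 0, by simp [hF, hP, hQ, hL], ?_⟩
    simp [hG, hL, setPair_self]
  · simp only [hF]
    split_ifs
    · exact continuousOn_const
    · exact hPc.sub continuousOn_const
  · rintro ⟨B, hB⟩
    set s := |B - (y i - y j)| + 1 with hs
    have hs0 : 0 ≤ s := by positivity
    obtain ⟨h, hh, -⟩ := hzero s hs0
    have := hB _ ⟨s, hs0, h, hh, rfl⟩ i j
    simp only [hG, setPair_of_ne hki.symm hli.symm, setPair_of_ne hkj.symm hlj.symm,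
      setPair_left, setPair_right hij] at this
    have hL0 : 0 ≤ L α s := by
      refine Real.log_nonneg ?_
      have : Real.exp (-s) ≤ 1 := Real.exp_le_one_iff.2 (by linarith)
      nlinarith
    have := le_abs_self (B - (y i - y j))
    linarith

/-- If the affine relation and the coefficients have the same signs, with at least two of each
sign, then every point of the zero set can be moved to infinity. -/
lemma exists_unbounded_of_mul_pos {i j k l : ι} (hij : i ≠ j) (hkl : k ≠ l)
    (hci : 0 < c i) (hcj : 0 < c j) (hck : c k < 0) (hcl : c l < 0) (hbc : ∀ j, 0 < b j * c j)
    {y : ι → ℝ} (hy : y ∈ expZeros b c) :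
    ∃ T ⊆ expZeros b c, y ∈ T ∧ IsPreconnected T ∧
      ¬ ∃ B, ∀ z ∈ T, ∀ i j, z i - z j ≤ B := by
  have hbi := pos_of_mul_pos_left (hbc i) hci.le
  have hbj := pos_of_mul_pos_left (hbc j) hcj.le
  have hbk := neg_of_mul_pos_left (hbc k) hck.le
  have hbl := neg_of_mul_pos_left (hbc l) hcl.le
  rcases le_total (b i * (c j * Real.exp (y j))) (b j * (c i * Real.exp (y i))) with h1 | h1 <;>
  rcases le_total (b k * (c l * Real.exp (y l))) (b l * (c k * Real.exp (y k))) with h2 | h2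
  · exact exists_unbounded_of_mul_pos_aux hij hkl hci hcj hck hcl hbi hbj hbk hbl hy h1 h2
  · exact exists_unbounded_of_mul_pos_aux hij hkl.symm hci hcj hcl hck hbi hbj hbl hbk hy h1 h2
  · exact exists_unbounded_of_mul_pos_aux hij.symm hkl hcj hci hck hcl hbj hbi hbk hbl hy h1 h2
  · exact exists_unbounded_of_mul_pos_aux hij.symm hkl.symm hcj hci hcl hck hbj hbi hbl hbk hy
      h1 h2

end dichotomy

section linear

variable {n m : ℕ} {A : (Fin n → ℝ) →ₗ[ℝ] (Fin m → ℝ)} {b c : Fin m → ℝ}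

/-- If exactly one coefficient is negative, then dividing by its monomial presents the zero set as
a level set of a convex function. -/
lemma isPreconnected_of_unique_neg (hn : 2 ≤ n)
    (hA : ∀ w, (∀ j k, A w j = A w k) → w = 0) {d : Fin m}
    (hcd : c d < 0) (hc : ∀ j ≠ d, 0 < c j) (hb : ∀ j ≠ d, 0 < b j)
    (hb1 : ∑ j, b j = 0) (hbA : ∀ x, ∑ j, b j * A x j = 0) :
    IsPreconnected {x | ∑ j, c j * Real.exp (A x j) = 0} := by
  set Φ : (Fin n → ℝ) → ℝ := fun x => ∑ j, c j * Real.exp (A x j - A x d) with hΦ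
  have hAc : Continuous A := A.continuous_of_finiteDimensional
  have hΦc : Continuous Φ := by
    refine continuous_finsetSum _ fun j _ => ?_
    have h1 := (continuous_apply j).comp hAc
    have h2 := (continuous_apply d).comp hAc
    simp only [Function.comp_def] at h1 h2
    fun_prop
  have hZ : {x | ∑ j, c j * Real.exp (A x j) = 0} = {x | Φ x = 0} := by
    ext x
    have : Φ x = (∑ j, c j * Real.exp (A x j)) * Real.exp (-A x d) := by
      rw [Finset.sum_mul]
      refine Finset.sum_congr rfl fun j _ => ?_
      rw [sub_eq_add_neg, Real.exp_add]; ring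
    simp only [Set.mem_ofPred_eq]
    rw [this, mul_eq_zero, or_iff_left (Real.exp_ne_zero _)]
  have hΦd : ∀ x, Φ x = c d + ∑ j ∈ univ.erase d, c j * Real.exp (A x j - A x d) := by
    intro x
    simp only [hΦ]
    rw [← Finset.add_sum_erase _ _ (mem_univ d)]
    simp
  have hconv : ConvexOn ℝ Set.univ Φ := by
    refine ⟨convex_univ, fun x _ y _ p q hp hq hpq => ?_⟩
    rw [hΦd, hΦd, hΦd]
    have : ∀ j ∈ univ.erase d, c j * Real.exp (A (p • x + q • y) j - A (p • x + q • y) d)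
        ≤ p * (c j * Real.exp (A x j - A x d)) + q * (c j * Real.exp (A y j - A y d)) := by
      intro j hj
      have h1 := convexOn_exp.2 (Set.mem_univ (A x j - A x d)) (Set.mem_univ (A y j - A y d))
        hp hq hpq
      have h2 : A (p • x + q • y) j - A (p • x + q • y) d
          = p • (A x j - A x d) + q • (A y j - A y d) := by
        simp; ring
      rw [h2]
      have := mul_le_mul_of_nonneg_left h1 (hc j (Finset.ne_of_mem_erase hj)).le
      simp only [smul_eq_mul] at this ⊢
      linarith
    have h3 := Finset.sum_le_sum this
    rw [Finset.sum_add_distrib, ← Finset.mul_sum, ← Finset.mul_sum] at h3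
    have h4 : c d = p * c d + q * c d := by rw [← add_mul, hpq, one_mul]
    simp only [smul_eq_mul]
    linarith
  rw [hZ]
  by_cases hx0 : ∃ x₀, Φ x₀ < 0
  swap
  · push Not at hx0
    have : {x | Φ x = 0} = {x ∈ Set.univ | Φ x ≤ 0} := by
      ext x
      simp only [Set.mem_ofPred_eq, Set.mem_univ, true_and]
      exact ⟨fun h => h.le, fun h => le_antisymm h (hx0 x)⟩
    rw [this]
    exact (hconv.convex_le 0).isPreconnected
  obtain ⟨x₀, hx₀⟩ := hx0
  have hgrow : ∀ w, w ≠ 0 → ∃ R : ℝ, 0 ≤ R ∧ 0 ≤ Φ (x₀ + R • w) := by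
    intro w hw
    obtain ⟨j, hj⟩ : ∃ j, A w d < A w j := by
      by_contra hcon
      push Not at hcon
      apply hw
      apply hA
      have hsum : ∑ j, b j * (A w d - A w j) = 0 := by
        simp_rw [mul_sub, Finset.sum_sub_distrib, ← Finset.sum_mul, hb1, hbA w]
        simp
      have hnonneg : ∀ j ∈ univ, 0 ≤ b j * (A w d - A w j) := by
        intro j _
        by_cases h : j = d
        · simp [h]
        · exact mul_nonneg (hb j h).le (sub_nonneg.2 (hcon j))
      have hz := (Finset.sum_eq_zero_iff_of_nonneg hnonneg).1 hsum
      have heq : ∀ j, A w j = A w d := by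
        intro j
        by_cases h : j = d
        · rw [h]
        · have := (mul_eq_zero.1 (hz j (mem_univ j))).resolve_left (hb j h).ne'
          linarith
      intro j k
      rw [heq j, heq k]
    have hjd : j ≠ d := by rintro rfl; exact lt_irrefl _ hj
    set δ := A w j - A w d with hδ
    have hδ0 : 0 < δ := sub_pos.2 hj
    set R := (|-c d / c j - (A x₀ j - A x₀ d)|) / δ with hR
    refine ⟨R, by positivity, ?_⟩
    have h1 : A (x₀ + R • w) j - A (x₀ + R • w) d = (A x₀ j - A x₀ d) + R * δ := by
      simp [hδ]; ring
    have h2 : R * δ = |-c d / c j - (A x₀ j - A x₀ d)| := div_mul_cancel₀ _ hδ0.ne'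
    have h3 := le_abs_self (-c d / c j - (A x₀ j - A x₀ d))
    have h4 := Real.add_one_le_exp ((A x₀ j - A x₀ d) + R * δ)
    have h5 : -c d / c j ≤ Real.exp ((A x₀ j - A x₀ d) + R * δ) := by linarith
    rw [div_le_iff₀ (hc j hjd)] at h5
    have h6 := Finset.single_le_sum
      (f := fun j => c j * Real.exp (A (x₀ + R • w) j - A (x₀ + R • w) d))
      (s := univ.erase d) (fun k hk => mul_nonneg (hc k (Finset.ne_of_mem_erase hk)).le
        (Real.exp_pos _).le) (Finset.mem_erase.2 ⟨hjd, mem_univ j⟩)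
    simp only [h1] at h6
    rw [hΦd]
    linarith
  set F : (Fin n → ℝ) → ℝ → ℝ := fun w r => if r ≤ 0 then -1 else Φ (x₀ + r • w) with hF
  have hS : IsPreconnected ({0}ᶜ : Set (Fin n → ℝ)) := by
    refine (isConnected_compl_singleton_of_one_lt_rank ?_ 0).isPreconnected
    rw [rank_fin_fun]
    exact_mod_cast hn
  convert isPreconnected_of_sign_change hS (F := F) (G := fun w r => x₀ + r • w)
    (fun r => ?_) (fun w hw => ?_) (by fun_prop) using 1
  · ext x
    constructor
    · intro hx
      have hne : x - x₀ ≠ 0 := by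
        intro h
        rw [sub_eq_zero.1 h] at hx
        exact hx₀.ne hx
      refine ⟨x - x₀, hne, 1, ?_, by simp⟩
      simpa [hF, not_le.2 (one_pos (α := ℝ))] using hx
    · rintro ⟨w, -, r, hr, rfl⟩
      simp only [hF] at hr
      split_ifs at hr with h
      · norm_num at hr
      · exact hr
  · simp only [hF]
    split_ifs
    · exact continuousOn_const
    · exact (hΦc.comp (by fun_prop)).continuousOn
  · obtain ⟨R, hR0, hR⟩ := hgrow w hw
    have hray : ∀ r s : ℝ, 0 ≤ r → r < s → Φ (x₀ + s • w) ≤ 0 → Φ (x₀ + r • w) < 0 := by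
      intro r s hr hrs hs
      have hspos : 0 < s := hr.trans_lt hrs
      have h1 := hconv.2 (Set.mem_univ x₀) (Set.mem_univ (x₀ + s • w))
        (sub_nonneg.2 (div_le_one_of_le₀ hrs.le hspos.le)) (div_nonneg hr hspos.le)
        (sub_add_cancel 1 (r / s))
      have h2 : (1 - r / s) • x₀ + (r / s) • (x₀ + s • w) = x₀ + r • w := by
        rw [smul_add, smul_smul, div_mul_cancel₀ _ hspos.ne']
        module
      rw [h2] at h1
      refine h1.trans_lt ?_
      have h3 : 0 < 1 - r / s := sub_pos.2 ((div_lt_one hspos).2 hrs)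
      have h4 : 0 ≤ r / s := div_nonneg hr hspos.le
      simp only [smul_eq_mul]
      nlinarith
    have hg0 : Φ (x₀ + (0 : ℝ) • w) < 0 := by simpa using hx₀
    obtain ⟨h, hh, hh0⟩ := intermediate_value_Icc hR0
      (f := fun r : ℝ => Φ (x₀ + r • w)) (hΦc.comp (by fun_prop)).continuousOn
      (show (0 : ℝ) ∈ Set.Icc _ _ from ⟨hg0.le, hR⟩)
    simp only at hh0
    have hpos : 0 < h := by
      rcases hh.1.lt_or_eq with h' | h'
      · exact h'
      · rw [← h'] at hh0; linarith
    refine ⟨h, by simp [hF, not_le.2 hpos, hh0], fun r hr => ?_, fun r hr => ?_⟩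
    · simp only [hF]
      split_ifs with h0
      · norm_num
      · exact hray r h (not_le.1 h0).le hr hh0.le
    · simp only [hF, if_neg (not_le.2 (hpos.trans hr))]
      by_contra hcon
      exact absurd (hray h r hpos.le hr (not_lt.1 hcon)) (by rw [hh0]; exact lt_irrefl 0)

/-- A linear map that separates points modulo constants, into a space of dimension at most two
more, has its range modulo constants cut out by one affine relation. -/
lemma exists_affine_relation (hnm : m ≤ n + 2) (hm : 0 < m)
    (hA : ∀ w, (∀ j k, A w j = A w k) → w = 0) :
    ∃ b : Fin m → ℝ, ∃ π : (Fin m → ℝ) →ₗ[ℝ] (Fin n → ℝ),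
      ∑ j, b j = 0 ∧ (∀ x, ∑ j, b j * A x j = 0) ∧
      (∀ x s, π (fun j => A x j + s) = x) ∧
      ∀ y, ∑ j, b j * y j = 0 → ∃ s, ∀ j, y j = A (π y) j + s := by
  set L : ((Fin n → ℝ) × ℝ) →ₗ[ℝ] (Fin m → ℝ) :=
    A.coprod (LinearMap.toSpanSingleton ℝ _ (fun _ => 1)) with hL
  have hLval : ∀ x s, L (x, s) = fun j => A x j + s := by
    intro x s
    ext j
    simp [hL]
  have hinj : LinearMap.ker L = ⊥ := by
    rw [LinearMap.ker_eq_bot']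
    rintro ⟨x, s⟩ h
    rw [hLval] at h
    have h' : ∀ j, A x j + s = 0 := fun j => congrFun h j
    have hx : x = 0 := hA x fun j k => by linarith [h' j, h' k]
    have := h' ⟨0, hm⟩
    simp [hx] at this
    simp [hx, this]
  obtain ⟨g, hg⟩ := L.exists_leftInverse_of_injective hinj
  have hgL : ∀ z, g (L z) = z := fun z => LinearMap.congr_fun hg z
  have hfin : Module.finrank ℝ (LinearMap.range L) = n + 1 := by
    rw [LinearMap.finrank_range_of_inj (LinearMap.ker_eq_bot.1 hinj)]
    simp
  obtain ⟨f, hf⟩ : ∃ f : (Fin m → ℝ) →ₗ[ℝ] ℝ, LinearMap.ker f = LinearMap.range L := by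
    by_cases htop : LinearMap.range L = ⊤
    · exact ⟨0, by rw [htop, LinearMap.ker_zero]⟩
    · obtain ⟨f, hf0, hf⟩ := Submodule.exists_le_ker_of_lt_top _ (lt_top_iff_ne_top.2 htop)
      refine ⟨f, (Submodule.eq_of_le_of_finrank_le hf ?_).symm⟩
      have h1 := LinearMap.finrank_range_add_finrank_ker f
      have h2 : 0 < Module.finrank ℝ (LinearMap.range f) := by
        rw [Module.finrank_pos_iff, Submodule.nontrivial_iff_ne_bot]
        exact fun h => hf0 (LinearMap.range_eq_bot.1 h)
      rw [Module.finrank_fin_fun] at h1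
      omega
  have hfval : ∀ y, ∑ j, f (Pi.single j 1) * y j = f y := by
    intro y
    conv_rhs => rw [pi_eq_sum_univ' y, map_sum]
    refine Finset.sum_congr rfl fun j _ => ?_
    rw [map_smul, smul_eq_mul, mul_comm]
  have hfL : ∀ z, f (L z) = 0 := fun z => by
    rw [← LinearMap.mem_ker, hf]; exact ⟨z, rfl⟩
  refine ⟨fun j => f (Pi.single j 1), LinearMap.fst ℝ _ _ ∘ₗ g, ?_, fun x => ?_,
    fun x s => ?_, fun y hy => ?_⟩
  · have := hfL (0, 1)
    rw [← hfval, hLval] at this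
    simpa using this
  · have := hfL (x, 0)
    rw [← hfval, hLval] at this
    simpa using this
  · rw [← hLval, LinearMap.comp_apply, hgL]; rfl
  · rw [hfval, ← LinearMap.mem_ker, hf] at hy
    obtain ⟨⟨x, s⟩, rfl⟩ := hy
    refine ⟨s, fun j => ?_⟩
    rw [LinearMap.comp_apply, hgL, hLval]; rfl

end linear

/-- The logarithmic form of the dichotomy: the zero set is preconnected, or each of its points can
be moved to infinity. -/
lemma isPreconnected_or_exists_unbounded {n m : ℕ} {A : (Fin n → ℝ) →ₗ[ℝ] (Fin m → ℝ)}
    {c : Fin m → ℝ} (hn : 2 ≤ n) (hnm : m ≤ n + 2) (hm : 0 < m)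
    (hA : ∀ w, (∀ j k, A w j = A w k) → w = 0)
    (hsep : ∀ p q : Fin m, p ≠ q → ∃ x, A x q < A x p) (hc : ∀ j, c j ≠ 0) :
    IsPreconnected {x | ∑ j, c j * Real.exp (A x j) = 0} ∨
      ∀ x ∈ {x | ∑ j, c j * Real.exp (A x j) = 0},
        ∃ T ⊆ {x | ∑ j, c j * Real.exp (A x j) = 0},
          x ∈ T ∧ IsPreconnected T ∧ ¬ Bornology.IsBounded T := by
  obtain ⟨b, π, hb1, hbA, hπ, hπ'⟩ := exists_affine_relation hnm hm hA
  have hAc : Continuous A := A.continuous_of_finiteDimensional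
  have hπc : Continuous π := π.continuous_of_finiteDimensional
  set Z := {x | ∑ j, c j * Real.exp (A x j) = 0} with hZ
  have hmaps : ∀ y ∈ expZeros b c, π y ∈ Z := by
    intro y hy
    obtain ⟨s, hs⟩ := hπ' y hy.1
    have h := hy.2
    simp_rw [hs, Real.exp_add, ← mul_assoc, ← Finset.sum_mul] at h
    exact (mul_eq_zero.1 h).resolve_right (Real.exp_ne_zero _)
  have hlift : ∀ x ∈ Z, A x ∈ expZeros b c := fun x hx => ⟨hbA x, hx⟩
  have hπA : ∀ x, π (A x) = x := fun x => by simpa using hπ x 0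
  have hpre : IsPreconnected (expZeros b c) → IsPreconnected Z := by
    intro h
    convert h.image π hπc.continuousOn using 1
    ext x
    exact ⟨fun hx => ⟨A x, hlift x hx, hπA x⟩, by rintro ⟨y, hy, rfl⟩; exact hmaps y hy⟩
  have hunb : (∀ y ∈ expZeros b c, ∃ T ⊆ expZeros b c, y ∈ T ∧ IsPreconnected T ∧
      ¬ ∃ B, ∀ z ∈ T, ∀ i j, z i - z j ≤ B) →
      ∀ x ∈ Z, ∃ T ⊆ Z, x ∈ T ∧ IsPreconnected T ∧ ¬ Bornology.IsBounded T := by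
    intro h x hx
    obtain ⟨T, hT, hxT, hTc, hTb⟩ := h (A x) (hlift x hx)
    refine ⟨π '' T, ?_, ⟨A x, hxT, hπA x⟩, hTc.image π hπc.continuousOn, fun hbd => hTb ?_⟩
    · rintro _ ⟨y, hy, rfl⟩
      exact hmaps y (hT hy)
    · have hbd' : Bornology.IsBounded (A '' (π '' T)) :=
        (hbd.isCompact_closure.image hAc).isBounded.subset (Set.image_mono subset_closure)
      obtain ⟨B, hB⟩ := hbd'.exists_norm_le
      refine ⟨B + B, fun z hz i j => ?_⟩
      have hz' := hB _ ⟨π z, ⟨z, hz, rfl⟩, rfl⟩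
      obtain ⟨s, hs⟩ := hπ' z (hT hz).1
      have h1 := (norm_le_pi_norm (A (π z)) i).trans hz'
      have h2 := (norm_le_pi_norm (A (π z)) j).trans hz'
      rw [Real.norm_eq_abs, abs_le] at h1 h2
      rw [hs i, hs j]
      linarith
  have hm3 : 3 ≤ m := by
    have hinj : Function.Injective (A.coprod (LinearMap.toSpanSingleton ℝ _ fun _ => 1)) := by
      rw [← LinearMap.ker_eq_bot, LinearMap.ker_eq_bot']
      rintro ⟨x, s⟩ h
      have h' : ∀ j, A x j + s = 0 := fun j => by simpa using congrFun h j
      have hx : x = 0 := hA x fun j k => by linarith [h' j, h' k]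
      have := h' ⟨0, hm⟩
      simp [hx] at this
      simp [hx, this]
    have := LinearMap.finrank_le_finrank_of_injective hinj
    simp at this
    omega
  by_cases hzero : ∃ k, b k = 0
  · obtain ⟨k, hk⟩ := hzero
    right
    apply hunb
    intro y hy
    obtain ⟨p, hp⟩ : ∃ p, p ∉ ({k} : Finset (Fin m)) := by
      by_contra! hcon
      have := Finset.card_le_card (fun x _ => hcon x : (univ : Finset (Fin m)) ⊆ {k})
      simp at this
      omega
    obtain ⟨q, hq⟩ : ∃ q, q ∉ ({k, p} : Finset (Fin m)) := by
      by_contra! hcon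
      have := Finset.card_le_card (fun x _ => hcon x : (univ : Finset (Fin m)) ⊆ {k, p})
      have := this.trans Finset.card_le_two
      simp at this
      omega
    simp only [Finset.mem_insert, Finset.mem_singleton, not_or] at hp hq
    obtain ⟨x, hx⟩ := hsep p q (Ne.symm hq.2)
    exact exists_unbounded_of_relation_eq_zero hk (hc k) (hbA x) hx hp hq.1 hy
  push Not at hzero
  by_cases hcoeff : ∃ i j, 0 < c i * c j ∧ b i * b j < 0
  · left
    apply hpre
    obtain ⟨i, j, h1, h2⟩ := hcoeff
    rcases pos_and_pos_or_neg_and_neg_of_mul_pos h1 with ⟨hi, hj⟩ | ⟨hi, hj⟩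
    · rcases mul_neg_iff.1 h2 with ⟨hbi, hbj⟩ | ⟨hbi, hbj⟩
      · exact isPreconnected_expZeros_of_coeff_pos hi hj hbi hbj
      · exact isPreconnected_expZeros_of_coeff_pos hj hi hbj hbi
    · rw [← expZeros_neg_right]
      rcases mul_neg_iff.1 h2 with ⟨hbi, hbj⟩ | ⟨hbi, hbj⟩
      · exact isPreconnected_expZeros_of_coeff_pos (neg_pos.2 hi) (neg_pos.2 hj) hbi hbj
      · exact isPreconnected_expZeros_of_coeff_pos (neg_pos.2 hj) (neg_pos.2 hi) hbj hbi
  by_cases hrel : ∃ i j, c i * c j < 0 ∧ 0 < b i * b j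
  · left
    apply hpre
    obtain ⟨i, j, h1, h2⟩ := hrel
    rcases pos_and_pos_or_neg_and_neg_of_mul_pos h2 with ⟨hi, hj⟩ | ⟨hi, hj⟩
    · rcases mul_neg_iff.1 h1 with ⟨hci, hcj⟩ | ⟨hci, hcj⟩
      · exact isPreconnected_expZeros_of_relation_pos hci hcj hi hj
      · exact isPreconnected_expZeros_of_relation_pos hcj hci hj hi
    · rw [← expZeros_neg_left]
      rcases mul_neg_iff.1 h1 with ⟨hci, hcj⟩ | ⟨hci, hcj⟩
      · exact isPreconnected_expZeros_of_relation_pos hci hcj (neg_pos.2 hi) (neg_pos.2 hj)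
      · exact isPreconnected_expZeros_of_relation_pos hcj hci (neg_pos.2 hj) (neg_pos.2 hi)
  push Not at hcoeff hrel
  -- now all products `b j * c j` have the same sign
  have hprod : ∀ i j, 0 < (b i * c i) * (b j * c j) := by
    intro i j
    have hci := hc i
    have hcj := hc j
    have hbi := hzero i
    have hbj := hzero j
    have hcc : c i * c j ≠ 0 := mul_ne_zero hci hcj
    have hbb : b i * b j ≠ 0 := mul_ne_zero hbi hbj
    have : (b i * c i) * (b j * c j) = (c i * c j) * (b i * b j) := by ring
    rw [this]
    rcases hcc.lt_or_gt with h | h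
    · exact mul_pos_of_neg_of_neg h (lt_of_le_of_ne (hrel i j h) hbb)
    · exact mul_pos h (lt_of_le_of_ne (hcoeff i j h) hbb.symm)
  obtain ⟨b', hb'1, hb'A, hb'c, hb'Z⟩ : ∃ b' : Fin m → ℝ, ∑ j, b' j = 0 ∧
      (∀ x, ∑ j, b' j * A x j = 0) ∧ (∀ j, 0 < b' j * c j) ∧
      expZeros b' c = expZeros b c := by
    have h0 := hprod ⟨0, hm⟩
    rcases (mul_ne_zero (hzero ⟨0, hm⟩) (hc ⟨0, hm⟩)).lt_or_gt with h | h
    · refine ⟨-b, by simp [hb1], fun x => by simp [hbA x], fun j => ?_, expZeros_neg_left b c⟩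
      have := neg_of_mul_pos_right (h0 j) h.le
      simp only [Pi.neg_apply]; linarith
    · exact ⟨b, hb1, hbA, fun j => pos_of_mul_pos_right (h0 j) h.le, rfl⟩
  by_cases hpp : ∃ i j, i ≠ j ∧ 0 < c i ∧ 0 < c j
  · by_cases hnn : ∃ i j, i ≠ j ∧ c i < 0 ∧ c j < 0
    · obtain ⟨i, j, hij, hi, hj⟩ := hpp
      obtain ⟨k, l, hkl, hk, hl⟩ := hnn
      right
      apply hunb
      rw [← hb'Z]
      exact fun y hy => exists_unbounded_of_mul_pos hij hkl hi hj hk hl hb'c hy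
    · left
      push Not at hnn
      by_cases hd : ∃ d, c d < 0
      · obtain ⟨d, hd⟩ := hd
        have hpos : ∀ j ≠ d, 0 < c j := fun j hj =>
          lt_of_le_of_ne (hnn d j hj.symm hd) (hc j).symm
        exact isPreconnected_of_unique_neg hn hA hd hpos
          (fun j hj => pos_of_mul_pos_left (hb'c j) (hpos j hj).le) hb'1 hb'A
      · push Not at hd
        have hbpos : 0 < ∑ j, b' j := Finset.sum_pos
          (fun j _ => pos_of_mul_pos_left (hb'c j) (hd j)) ⟨⟨0, hm⟩, mem_univ _⟩
        exact absurd hb'1 hbpos.ne'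
  · left
    push Not at hpp
    by_cases hd : ∃ d, 0 < c d
    · obtain ⟨d, hd⟩ := hd
      have hneg : ∀ j ≠ d, c j < 0 := fun j hj =>
        lt_of_le_of_ne (hpp d j hj.symm hd) (hc j)
      have := isPreconnected_of_unique_neg (c := -c) (b := -b') hn hA (neg_neg_iff_pos.2 hd)
        (fun j hj => neg_pos.2 (hneg j hj))
        (fun j hj => neg_pos.2 (neg_of_mul_pos_left (hb'c j) (hneg j hj).le))
        (by simp [hb'1]) (fun x => by simp [hb'A x])
      simpa [Finset.sum_neg_distrib] using this
    · push Not at hd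
      have hbneg : ∑ j, b' j < 0 := Finset.sum_neg
        (fun j _ => neg_of_mul_pos_left (hb'c j) (hd j)) ⟨⟨0, hm⟩, mem_univ _⟩
      exact absurd hb'1 hbneg.ne

/-- Along a direction that pairs equally with all exponents, the zero set is invariant under
translation. -/
lemma exists_unbounded_of_translation {n m : ℕ} {A : (Fin n → ℝ) →ₗ[ℝ] (Fin m → ℝ)}
    {c : Fin m → ℝ} {w : Fin n → ℝ} (hw : w ≠ 0) (hA : ∀ j k, A w j = A w k)
    {x : Fin n → ℝ} (hx : ∑ j, c j * Real.exp (A x j) = 0) :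
    ∃ T ⊆ {x | ∑ j, c j * Real.exp (A x j) = 0},
      x ∈ T ∧ IsPreconnected T ∧ ¬ Bornology.IsBounded T := by
  refine ⟨Set.range fun s : ℝ => x + s • w, ?_, ⟨0, by simp⟩,
    isPreconnected_range (by fun_prop), fun hbd => ?_⟩
  · rintro _ ⟨s, rfl⟩
    rcases isEmpty_or_nonempty (Fin m) with h | ⟨⟨k⟩⟩
    · simp
    have : ∀ j, c j * Real.exp (A (x + s • w) j)
        = c j * Real.exp (A x j) * Real.exp (s * A w k) := by
      intro j
      rw [mul_assoc, ← Real.exp_add, ← hA j k]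
      simp
    simp only [Set.mem_ofPred_eq]
    simp_rw [this, ← Finset.sum_mul, hx, zero_mul]
  · obtain ⟨B, hB⟩ := hbd.exists_norm_le
    have hw' : 0 < ‖w‖ := norm_pos_iff.2 hw
    have hB0 : 0 ≤ B := (norm_nonneg _).trans (hB _ ⟨0, rfl⟩)
    set s := (B + ‖x‖ + 1) / ‖w‖ with hs
    have h1 := hB _ ⟨s, rfl⟩
    have h2 : ‖s • w‖ ≤ ‖x + s • w‖ + ‖x‖ := by
      simpa using norm_sub_le (x + s • w) x
    rw [norm_smul, Real.norm_of_nonneg (by positivity), hs, div_mul_cancel₀ _ hw'.ne'] at h2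
    simp only at h1
    linarith

/-- An n-variate m-nomial (n ≥ 2) with m ≤ 2 + dim Supp(f) has at
most one compact connected component in its positive zero set. -/
theorem at_most_one_compact_component
    (n m : ℕ) (hn : 2 ≤ n) (hm : 1 ≤ m)
    (a : Fin m → Fin n → ℤ) (hinj : Function.Injective a)
    (c : Fin m → ℝ) (hc : ∀ j, c j ≠ 0)
    (hdim : m ≤ 2 + Module.finrank ℝ (Submodule.span ℝ
      {v : Fin n → ℝ | ∃ j k : Fin m,
        v = (fun i => (a j i : ℝ)) - fun i => (a k i : ℝ)})) :
    ∀ Z : Set (Fin n → ℝ),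
      Z = {x | (∀ i, 0 < x i) ∧ ∑ j, c j * ∏ i, (x i) ^ (a j i) = 0} →
      {C : Set (Fin n → ℝ) |
        (∃ x ∈ Z, C = connectedComponentIn Z x) ∧ IsCompact C}.Subsingleton := by
  intro Z hZ
  have hnm : m ≤ n + 2 := by
    have := Submodule.finrank_le (Submodule.span ℝ
      {v : Fin n → ℝ | ∃ j k : Fin m, v = (fun i => (a j i : ℝ)) - fun i => (a k i : ℝ)})
    rw [Module.finrank_fin_fun] at this
    omega
  set A : (Fin n → ℝ) →ₗ[ℝ] (Fin m → ℝ) := Matrix.mulVecLin fun j i => (a j i : ℝ) with hA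
  have hAval : ∀ x j, A x j = ∑ i, (a j i : ℝ) * x i := fun x j => rfl
  set E : (Fin n → ℝ) → Fin n → ℝ := fun x i => Real.exp (x i) with hE
  set Λ : (Fin n → ℝ) → Fin n → ℝ := fun x i => Real.log (x i) with hΛ
  have hΛE : ∀ x, Λ (E x) = x := fun x => by simp [hΛ, hE]
  have hEc : Continuous E := by fun_prop
  set Y := {x | ∑ j, c j * Real.exp (A x j) = 0} with hY
  have hprod : ∀ x j, ∏ i, (E x i) ^ (a j i) = Real.exp (A x j) := by
    intro x j
    rw [hAval, Real.exp_sum]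
    refine Finset.prod_congr rfl fun i _ => ?_
    rw [mul_comm, Real.exp_mul, Real.rpow_intCast]
  have hEY : E '' Y = Z := by
    rw [hZ]
    ext x
    constructor
    · rintro ⟨y, hy, rfl⟩
      refine ⟨fun i => Real.exp_pos _, ?_⟩
      simp_rw [hprod]
      exact hy
    · rintro ⟨hpos, hx⟩
      have hEx : E (Λ x) = x := funext fun i => Real.exp_log (hpos i)
      refine ⟨Λ x, ?_, hEx⟩
      simp only [hY, Set.mem_ofPred_eq]
      simp_rw [← hprod, hEx]
      exact hx
  have hdich : IsPreconnected Y ∨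
      ∀ x ∈ Y, ∃ T ⊆ Y, x ∈ T ∧ IsPreconnected T ∧ ¬ Bornology.IsBounded T := by
    by_cases hw : ∀ w, (∀ j k, A w j = A w k) → w = 0
    · refine isPreconnected_or_exists_unbounded hn hnm hm hw (fun p q hpq => ?_) hc
      obtain ⟨i, hi⟩ : ∃ i, a p i ≠ a q i := by
        by_contra! hcon
        exact hpq (hinj (funext hcon))
      refine ⟨Pi.single i ((a p i : ℝ) - a q i), ?_⟩
      have h : ((a p i : ℝ) - a q i) ≠ 0 := sub_ne_zero.2 (by exact_mod_cast hi)
      simp only [hAval, Pi.single_apply, mul_ite, mul_zero, Finset.sum_ite_eq', mem_univ, if_true]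
      nlinarith [sq_pos_of_ne_zero h]
    · push Not at hw
      obtain ⟨w, hw, hw0⟩ := hw
      exact Or.inr fun x hx => exists_unbounded_of_translation hw0 hw hx
  rcases hdich with hconn | hunb
  · have hZc : IsPreconnected Z := hEY ▸ hconn.image E hEc.continuousOn
    rintro C ⟨⟨x, hx, rfl⟩, -⟩ D ⟨⟨y, hy, rfl⟩, -⟩
    rw [hZc.connectedComponentIn hx, hZc.connectedComponentIn hy]
  · rintro C ⟨⟨x, hx, rfl⟩, hC⟩
    exfalso
    obtain ⟨y, hy, rfl⟩ := hEY.symm ▸ hx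
    obtain ⟨T, hTY, hyT, hTc, hTb⟩ := hunb y hy
    have hsub : E '' T ⊆ connectedComponentIn Z (E y) :=
      (hTc.image E hEc.continuousOn).subset_connectedComponentIn ⟨y, hyT, rfl⟩
        (hEY ▸ Set.image_mono hTY)
    have hΛc : ContinuousOn Λ (connectedComponentIn Z (E y)) := by
      refine continuousOn_pi.2 fun i => ContinuousOn.log (by fun_prop) fun x hx => ?_
      have hxZ := connectedComponentIn_subset _ _ hx
      rw [hZ] at hxZ
      exact (hxZ.1 i).ne'
    refine hTb ((hC.image_of_continuousOn hΛc).isBounded.subset fun z hz => ?_)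
    exact ⟨E z, hsub ⟨z, hz, rfl⟩, hΛE z⟩
end

section
/- Let n ≥ 2 and let f(x) = Σ_{j=1}^m c_j x^{a_j} be an n-variate m-nomial with nonzero real coefficients and distinct exponent vectors a_1, …, a_m ∈ ℤ^n, satisfying m ≤ 2 + dim Supp(f). If the zero set Z_+(f) in ℝ^n_+ has a compact connected component, then Z_+(f) is either a single point or is ambient isotopic in ℝ^n_+ to a round (n−1)-sphere contained in ℝ^n_+. -/
open Finset

/-- The open positive orthant of ℝ^n. -/
def PosOrthant (n : ℕ) : Set (Fin n → ℝ) := {x | ∀ i, 0 < x i}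

/-- `X` and `Y` are ambient isotopic inside `P`: there is a continuous family
`H` over `[0,1]` of self-homeomorphisms of `P`, starting at the identity and
carrying `X ∩ P` onto `Y`. -/
def AmbientIsotopicIn {E : Type*} [TopologicalSpace E] (P X Y : Set E) : Prop :=
  ∃ H : Set.Icc (0 : ℝ) 1 → (P ≃ₜ P),
    Continuous (fun q : Set.Icc (0 : ℝ) 1 × P => (H q.1 q.2 : P)) ∧
    H ⟨0, by norm_num⟩ = Homeomorph.refl P ∧
    Subtype.val '' ((⇑(H ⟨1, by norm_num⟩)) '' {x : P | (x : E) ∈ X}) = Y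

/-- A function implicitly defined by a sign change is continuous. -/
theorem continuousOn_of_sign_change_s3 {X : Type*} [TopologicalSpace X] {D : Set X}
    {φ : X → ℝ → ℝ} {T : X → ℝ} (hφ : ∀ a, 0 ≤ a → ContinuousOn (fun x => φ x a) D)
    (hT : ∀ x ∈ D, 0 ≤ T x) (hneg : ∀ x ∈ D, ∀ a, 0 ≤ a → a < T x → φ x a < 0)
    (hzero : ∀ x ∈ D, φ x (T x) = 0) (hpos : ∀ x ∈ D, ∀ a, T x < a → 0 < φ x a) :
    ContinuousOn T D := by
  intro x hx
  refine tendsto_order.2 ⟨fun a ha => ?_, fun a ha => ?_⟩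
  · rcases lt_or_ge a 0 with h0 | h0
    · filter_upwards [self_mem_nhdsWithin] with z hz
      exact h0.trans_le (hT z hz)
    · filter_upwards [self_mem_nhdsWithin,
        (hφ a h0 x hx).eventually (gt_mem_nhds (hneg x hx a h0 ha))] with z hz hza
      by_contra! hle
      rcases hle.eq_or_lt with h | h
      · exact hza.ne (h ▸ hzero z hz)
      · exact hza.not_gt (hpos z hz a h)
  · have h0 : 0 ≤ a := (hT x hx).trans ha.le
    filter_upwards [self_mem_nhdsWithin,
      (hφ a h0 x hx).eventually (lt_mem_nhds (hpos x hx a ha))] with z hz hza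
    by_contra! hle
    rcases hle.eq_or_lt with h | h
    · exact hza.ne' (h ▸ hzero z hz)
    · exact hza.not_gt (hneg z hz a h0 h)

/-- On every ray from the origin, `h` is negative, then vanishes once, then is positive. -/
def RadialSignChange {V : Type*} [AddCommGroup V] [Module ℝ V] (h : V → ℝ) : Prop :=
  ∀ y : V, y ≠ 0 → ∃ T : ℝ, 0 < T ∧ h (T • y) = 0 ∧
    (∀ t, 0 ≤ t → t < T → h (t • y) < 0) ∧ ∀ t, T < t → 0 < h (t • y)

/-- The zero set of a function with radial sign change is the unit level set of a positive
function that is homogeneous of degree `-1` and continuous away from the origin. -/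
theorem RadialSignChange.exists_radius {V : Type*} [NormedAddCommGroup V] [NormedSpace ℝ V]
    [Nontrivial V] {h : V → ℝ} (hs : RadialSignChange h) (hcont : Continuous h) :
    ∃ ρ : V → ℝ, (∀ y, 0 < ρ y) ∧ ContinuousOn ρ {0}ᶜ ∧
      (∀ y, y ≠ 0 → ∀ s : ℝ, 0 < s → ρ (s • y) = ρ y / s) ∧
      ∀ y, h y = 0 ↔ y ≠ 0 ∧ ρ y = 1 := by
  have hs' : ∀ y : V, ∃ T : ℝ, 0 < T ∧ (y ≠ 0 → h (T • y) = 0 ∧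
    (∀ t, 0 ≤ t → t < T → h (t • y) < 0) ∧ ∀ t, T < t → 0 < h (t • y)) := by
    intro y
    by_cases hy : y = 0
    · exact ⟨1, one_pos, fun h => (h hy).elim⟩
    · obtain ⟨T, h1, h2⟩ := hs y hy
      exact ⟨T, h1, fun _ => h2⟩
  choose ρ hρ hρs using hs'
  have huniq : ∀ y : V, y ≠ 0 → ∀ t : ℝ, 0 < t → h (t • y) = 0 → ρ y = t := by
    intro y hy t ht h0
    obtain ⟨-, h2, h3⟩ := hρs y hy
    rcases lt_trichotomy t (ρ y) with h | h | h
    · exact absurd h0 (h2 t ht.le h).ne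
    · exact h.symm
    · exact absurd h0 (h3 t h).ne'
  refine ⟨ρ, hρ, ?_, ?_, ?_⟩
  · exact continuousOn_of_sign_change_s3 (φ := fun y t => h (t • y))
      (fun a _ => by fun_prop) (fun x _ => (hρ x).le)
      (fun x hx => (hρs x hx).2.1) (fun x hx => (hρs x hx).1) (fun x hx => (hρs x hx).2.2)
  · intro y hy s hs
    refine huniq _ (smul_ne_zero hs.ne' hy) _ (div_pos (hρ y) hs) ?_
    rw [smul_smul, div_mul_cancel₀ _ hs.ne']
    exact (hρs y hy).1
  · intro y
    constructor
    · intro h0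
      have hy : y ≠ 0 := by
        rintro rfl
        obtain ⟨z, hz⟩ := exists_ne (0 : V)
        have := (hρs z hz).2.1 0 le_rfl (hρ z)
        rw [zero_smul, h0] at this
        exact this.false
      exact ⟨hy, huniq y hy 1 one_pos (by rwa [one_smul])⟩
    · rintro ⟨hy, h1⟩
      have := (hρs y hy).1
      rwa [h1, one_smul] at this

theorem exists_bound_of_homogeneous {V : Type*} [NormedAddCommGroup V] [NormedSpace ℝ V]
    [FiniteDimensional ℝ V] {q : V → ℝ} (hq : ContinuousOn q {0}ᶜ)
    (hhom : ∀ y, ∀ s : ℝ, 0 < s → q (s • y) = q y) : ∃ C, ∀ y, |q y| ≤ C := by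
  have : ProperSpace V := FiniteDimensional.proper ℝ V
  obtain ⟨C, hC⟩ := (isCompact_sphere (0 : V) 1).exists_bound_of_continuousOn
    (hq.mono fun y hy => by
      rintro rfl
      simp at hy)
  refine ⟨max C |q 0|, fun y => ?_⟩
  by_cases hy : y = 0
  · subst hy
    exact le_max_right _ _
  · rw [← hhom y ‖y‖⁻¹ (by positivity)]
    refine (hC _ ?_).trans (le_max_left _ _)
    simp [norm_smul, hy]

theorem continuous_smul_of_bounded {X V : Type*} [TopologicalSpace X] [NormedAddCommGroup V]
    [NormedSpace ℝ V] {f : X → ℝ} {g : X → V} (hg : Continuous g)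
    (hf : ∀ x, g x ≠ 0 → ContinuousAt f x) {C : ℝ} (hC : ∀ x, |f x| ≤ C) :
    Continuous fun x => f x • g x := by
  rw [continuous_iff_continuousAt]
  intro x
  by_cases hx : g x = 0
  · rw [ContinuousAt, hx, smul_zero]
    refine squeeze_zero_norm (a := fun z => C * ‖g z‖) (fun z => ?_) ?_
    · rw [norm_smul]
      exact mul_le_mul_of_nonneg_right (hC z) (norm_nonneg _)
    · have : Continuous fun z => C * ‖g z‖ := by fun_prop
      simpa [hx] using this.tendsto x
  · exact (hf x hx).smul hg.continuousAt

/-- Radial rescaling by a positive function homogeneous of degree zero. -/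
noncomputable def radialHomeomorph {V : Type*} [NormedAddCommGroup V] [NormedSpace ℝ V]
    [FiniteDimensional ℝ V] (q : V → ℝ) (hpos : ∀ y, 0 < q y) (hq : ContinuousOn q {0}ᶜ)
    (hhom : ∀ y, ∀ s : ℝ, 0 < s → q (s • y) = q y) : V ≃ₜ V where
  toFun y := q y • y
  invFun y := (q y)⁻¹ • y
  left_inv y := by
    simp only
    rw [hhom y _ (hpos y), smul_smul, inv_mul_cancel₀ (hpos y).ne', one_smul]
  right_inv y := by
    simp only
    rw [hhom y _ (inv_pos.2 (hpos y)), smul_smul, mul_inv_cancel₀ (hpos y).ne', one_smul]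
  continuous_toFun := by
    obtain ⟨C, hC⟩ := exists_bound_of_homogeneous hq hhom
    exact continuous_smul_of_bounded continuous_id
      (fun x hx => hq.continuousAt (isOpen_compl_singleton.mem_nhds hx)) hC
  continuous_invFun := by
    have hq' : ContinuousOn (fun y => (q y)⁻¹) {0}ᶜ := hq.inv₀ fun y _ => (hpos y).ne'
    obtain ⟨C, hC⟩ := exists_bound_of_homogeneous hq' fun y s hs => by rw [hhom y s hs]
    exact continuous_smul_of_bounded continuous_id
      (fun x hx => hq'.continuousAt (isOpen_compl_singleton.mem_nhds hx)) hC

theorem one_sub_add_mul_pos {t q : ℝ} (ht : t ∈ Set.Icc (0 : ℝ) 1) (hq : 0 < q) :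
    0 < 1 - t + t * q := by
  rcases ht.1.eq_or_lt with h | h
  · simp [← h]
  · have := mul_pos h hq
    linarith [ht.2]

/-- Zero sets of two functions with radial sign change (with respect to `y₀` and to the origin)
are ambient isotopic. -/
theorem ambientIsotopicIn_univ_of_radialSignChange {V : Type*} [NormedAddCommGroup V]
    [NormedSpace ℝ V] [FiniteDimensional ℝ V] [Nontrivial V] {h₁ h₂ : V → ℝ} {y₀ : V}
    (hc₁ : Continuous h₁) (hc₂ : Continuous h₂)
    (hs₁ : RadialSignChange fun y => h₁ (y₀ + y)) (hs₂ : RadialSignChange h₂) :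
    ∃ H : Set.Icc (0 : ℝ) 1 → (V ≃ₜ V),
      Continuous (fun q : Set.Icc (0 : ℝ) 1 × V => H q.1 q.2) ∧
      (∀ y, H ⟨0, by norm_num⟩ y = y) ∧
      ∀ y, h₂ (H ⟨1, by norm_num⟩ y) = 0 ↔ h₁ y = 0 := by
  obtain ⟨ρ₁, hp₁, hρ₁, hm₁, hz₁⟩ := hs₁.exists_radius (by fun_prop)
  obtain ⟨ρ₂, hp₂, hρ₂, hm₂, hz₂⟩ := hs₂.exists_radius hc₂
  classical
  set q : V → ℝ := fun y => if y = 0 then 1 else ρ₂ y / ρ₁ y with hqdef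
  have hqne : ∀ y, y ≠ 0 → q y = ρ₂ y / ρ₁ y := fun y hy => by simp [hqdef, hy]
  have hqpos : ∀ y, 0 < q y := by
    intro y
    by_cases hy : y = 0
    · simp [hqdef, hy]
    · rw [hqne y hy]
      exact div_pos (hp₂ y) (hp₁ y)
  have hqcont : ContinuousOn q {0}ᶜ :=
    (hρ₂.div hρ₁ fun y _ => (hp₁ y).ne').congr fun y hy => hqne y hy
  have hqhom : ∀ y, ∀ s : ℝ, 0 < s → q (s • y) = q y := by
    intro y s hs
    by_cases hy : y = 0
    · simp [hy]
    · rw [hqne y hy, hqne _ (smul_ne_zero hs.ne' hy), hm₁ y hy s hs, hm₂ y hy s hs]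
      have := (hp₁ y).ne'
      field_simp
  let R : Set.Icc (0 : ℝ) 1 → (V ≃ₜ V) := fun t =>
    radialHomeomorph (fun y => 1 - (t : ℝ) + t * q y) (fun y => one_sub_add_mul_pos t.2 (hqpos y))
      (by fun_prop) (fun y s hs => by simp only [hqhom y s hs])
  have hR : ∀ t y, R t y = (1 - (t : ℝ) + t * q y) • y := fun t y => rfl
  refine ⟨fun t => (Homeomorph.addRight (-((t : ℝ) • y₀))).trans (R t), ?_, ?_, ?_⟩
  · obtain ⟨C, hC⟩ := exists_bound_of_homogeneous hqcont hqhom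
    refine continuous_smul_of_bounded (C := 1 + C)
      (f := fun z : Set.Icc (0 : ℝ) 1 × V =>
        1 - (z.1 : ℝ) + z.1 * q (z.2 + -((z.1 : ℝ) • y₀)))
      (g := fun z => z.2 + -((z.1 : ℝ) • y₀)) (by fun_prop) ?_ ?_
    · intro z hz
      have h1 : ContinuousAt q (z.2 + -((z.1 : ℝ) • y₀)) :=
        hqcont.continuousAt (isOpen_compl_singleton.mem_nhds hz)
      have h2 : ContinuousAt (fun z : Set.Icc (0 : ℝ) 1 × V => z.2 + -((z.1 : ℝ) • y₀)) z := by
        fun_prop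
      have h3 := ContinuousAt.comp (f := fun z : Set.Icc (0 : ℝ) 1 × V =>
        z.2 + -((z.1 : ℝ) • y₀)) h1 h2
      have h4 : ContinuousAt (fun z : Set.Icc (0 : ℝ) 1 × V => (z.1 : ℝ)) z := by fun_prop
      exact (continuousAt_const.sub h4).add (h4.mul h3)
    · rintro ⟨⟨t, ht⟩, y⟩
      have hb := hC (y + -(t • y₀))
      have hp := hqpos (y + -(t • y₀))
      have := one_sub_add_mul_pos ht hp
      simp only
      rw [abs_of_pos this]
      rw [abs_of_pos hp] at hb
      nlinarith [ht.1, ht.2]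
  · intro y
    simp [hR]
  · intro y
    obtain ⟨z, rfl⟩ : ∃ z, y = y₀ + z := ⟨y - y₀, by simp⟩
    have hz : (Homeomorph.addRight (-((1 : ℝ) • y₀))) (y₀ + z) = z := by simp
    simp only [Homeomorph.trans_apply, hz, hR]
    rw [hz₁ z, hz₂]
    have hq0 := hqpos z
    have h1 : (1 - (1 : ℝ) + 1 * q z) = q z := by ring
    rw [h1]
    by_cases hz0 : z = 0
    · simp [hz0]
    · rw [hm₂ z hz0 _ hq0, hqne z hz0]
      have := (hp₁ z).ne'
      have := (hp₂ z).ne'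
      simp only [ne_eq, hz0, not_false_eq_true, true_and, smul_eq_zero, or_false]
      have : ρ₂ z / (ρ₂ z / ρ₁ z) = ρ₁ z := by field_simp
      rw [this]
      simp [*]

/-- The coordinatewise logarithm, as a homeomorphism from the orthant to `ℝ^n`. -/
noncomputable def logHomeomorph (n : ℕ) : PosOrthant n ≃ₜ (Fin n → ℝ) where
  toFun x i := Real.log (x.1 i)
  invFun y := ⟨fun i => Real.exp (y i), fun i => Real.exp_pos _⟩
  left_inv x := Subtype.ext (funext fun i => Real.exp_log (x.2 i))
  right_inv y := funext fun i => Real.log_exp _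
  continuous_toFun := continuous_pi fun i =>
    ((continuous_apply i).comp continuous_subtype_val).log fun x => (x.2 i).ne'
  continuous_invFun := by fun_prop

/-- In logarithmic coordinates, small round spheres are star-shaped. -/
theorem radialSignChange_sphere (n : ℕ) :
    RadialSignChange fun y : Fin n → ℝ => ∑ i, (Real.exp (y i) - 1) ^ 2 - (1 / 2) ^ 2 := by
  have hmono : ∀ x s t : ℝ, 0 ≤ s → s < t → x ≠ 0 →
      (Real.exp (s * x) - 1) ^ 2 < (Real.exp (t * x) - 1) ^ 2 := by
    intro x s t hs hst hx
    rw [sq_lt_sq]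
    rcases hx.lt_or_gt with h | h
    · have h1 : Real.exp (t * x) < Real.exp (s * x) :=
        Real.exp_lt_exp.2 (mul_lt_mul_of_neg_right hst h)
      have h2 : Real.exp (s * x) ≤ 1 :=
        Real.exp_le_one_iff.2 (mul_nonpos_of_nonneg_of_nonpos hs h.le)
      rw [abs_of_nonpos (by linarith), abs_of_nonpos (by linarith)]
      linarith
    · have h1 : Real.exp (s * x) < Real.exp (t * x) :=
        Real.exp_lt_exp.2 (mul_lt_mul_of_pos_right hst h)
      have h2 : 1 ≤ Real.exp (s * x) := Real.one_le_exp (mul_nonneg hs h.le)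
      rw [abs_of_nonneg (by linarith), abs_of_nonneg (by linarith)]
      linarith
  intro y hy
  obtain ⟨i, hi⟩ : ∃ i, y i ≠ 0 := by
    by_contra! h
    exact hy (funext h)
  set g : ℝ → ℝ := fun t => ∑ i, (Real.exp ((t • y) i) - 1) ^ 2 - (1 / 2) ^ 2 with hg
  have hgmono : ∀ s t, 0 ≤ s → s < t → g s < g t := by
    intro s t hs hst
    simp only [hg, Pi.smul_apply, smul_eq_mul]
    refine sub_lt_sub_right (Finset.sum_lt_sum (fun j _ => ?_) ⟨i, Finset.mem_univ i,
      hmono _ s t hs hst hi⟩) _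
    by_cases hj : y j = 0
    · simp [hj]
    · exact (hmono _ s t hs hst hj).le
  have hgcont : Continuous g := by
    simp only [hg, Pi.smul_apply, smul_eq_mul]
    fun_prop
  have hg0 : g 0 < 0 := by simp [hg]
  have hg1 : 0 < g (2 / |y i|) := by
    have h1 : (1 / 2) ^ 2 < (Real.exp ((2 / |y i|) * y i) - 1) ^ 2 := by
      rw [sq_lt_sq, abs_of_pos (by norm_num : (0 : ℝ) < 1 / 2)]
      rcases hi.lt_or_gt with h | h
      · rw [abs_of_neg h, show 2 / -y i * y i = -2 by field_simp]
        have h2 : Real.exp (-2) < 1 / 2 := by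
          rw [Real.exp_neg, inv_lt_comm₀ (Real.exp_pos _) (by norm_num)]
          have := Real.add_one_lt_exp (x := 2) (by norm_num)
          linarith
        rw [abs_of_nonpos (by linarith)]
        linarith
      · rw [abs_of_pos h, div_mul_cancel₀ _ hi]
        have := Real.add_one_lt_exp (x := 2) (by norm_num)
        rw [abs_of_nonneg (by linarith)]
        linarith
    have h2 : (Real.exp ((2 / |y i|) * y i) - 1) ^ 2 ≤
        ∑ j, (Real.exp ((2 / |y i|) * y j) - 1) ^ 2 :=
      Finset.single_le_sum (f := fun j => (Real.exp ((2 / |y i|) * y j) - 1) ^ 2)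
        (fun j _ => sq_nonneg _) (Finset.mem_univ i)
    simp only [hg, Pi.smul_apply, smul_eq_mul]
    linarith
  obtain ⟨T, ⟨hT0, -⟩, hT⟩ := intermediate_value_Icc (a := 0) (b := 2 / |y i|) (by positivity)
    hgcont.continuousOn ⟨hg0.le, hg1.le⟩
  have hTpos : 0 < T := by
    rcases hT0.eq_or_lt with h | h
    · rw [← h] at hT
      exact absurd hT hg0.ne
    · exact h
  refine ⟨T, hTpos, hT, fun t ht htT => ?_, fun t ht => ?_⟩
  · exact (hgmono t T ht htT).trans_eq hT
  · exact hT.symm.trans_lt (hgmono T t hTpos.le ht)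

/-- A hypersurface of the orthant that is star-shaped in logarithmic coordinates is ambient
isotopic to the sphere of radius `1 / 2` around `(1, …, 1)`. -/
theorem ambientIsotopicIn_sphere {n : ℕ} (hn : 1 ≤ n) {h : (Fin n → ℝ) → ℝ} (hcont : Continuous h)
    {y₀ : Fin n → ℝ} (hs : RadialSignChange fun y => h (y₀ + y)) {Z : Set (Fin n → ℝ)}
    (hZ : ∀ x : PosOrthant n, x.1 ∈ Z ↔ h (logHomeomorph n x) = 0) :
    ∃ (p : Fin n → ℝ) (r : ℝ), 0 < r ∧
      {x : Fin n → ℝ | ∑ i, (x i - p i) ^ 2 = r ^ 2} ⊆ PosOrthant n ∧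
      AmbientIsotopicIn (PosOrthant n) Z {x : Fin n → ℝ | ∑ i, (x i - p i) ^ 2 = r ^ 2} := by
  have : NeZero n := ⟨by omega⟩
  obtain ⟨H, hH, hH0, hH1⟩ := ambientIsotopicIn_univ_of_radialSignChange
    hcont (by fun_prop) hs (radialSignChange_sphere n)
  have hsub : {x : Fin n → ℝ | ∑ i, (x i - 1) ^ 2 = (1 / 2) ^ 2} ⊆ PosOrthant n := by
    intro x hx i
    have h2 : (x i - 1) ^ 2 ≤ ∑ j, (x j - 1) ^ 2 :=
      Finset.single_le_sum (f := fun j => (x j - 1) ^ 2)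
        (fun j _ => sq_nonneg _) (Finset.mem_univ i)
    rw [Set.mem_ofPred_eq] at hx
    rw [hx] at h2
    nlinarith
  refine ⟨fun _ => 1, 1 / 2, by norm_num, hsub,
    fun t => ((logHomeomorph n).trans (H t)).trans (logHomeomorph n).symm, ?_, ?_, ?_⟩
  · have := hH.comp (continuous_id.prodMap (logHomeomorph n).continuous)
    exact (logHomeomorph n).symm.continuous.comp this
  · ext1 x
    change (logHomeomorph n).symm (H _ (logHomeomorph n x)) = x
    rw [hH0, Homeomorph.symm_apply_apply]
  · have key : ∀ x : PosOrthant n, ∑ i, (x.1 i - 1) ^ 2 = (1 / 2) ^ 2 ↔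
        ∑ i, (Real.exp (logHomeomorph n x i) - 1) ^ 2 - (1 / 2) ^ 2 = 0 := by
      intro x
      have : ∀ i, Real.exp (logHomeomorph n x i) = x.1 i := fun i => Real.exp_log (x.2 i)
      simp only [this, sub_eq_zero]
    ext x
    constructor
    · rintro ⟨-, ⟨w, hw, rfl⟩, rfl⟩
      rw [Set.mem_ofPred_eq, key]
      simp only [Homeomorph.trans_apply, Homeomorph.apply_symm_apply]
      rw [hH1]
      exact (hZ w).1 hw
    · intro hx
      let x' : PosOrthant n := ⟨x, hsub hx⟩
      refine ⟨x', ⟨(((logHomeomorph n).trans (H ⟨1, by norm_num⟩)).trans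
        (logHomeomorph n).symm).symm x', ?_, Homeomorph.apply_symm_apply _ _⟩, rfl⟩
      rw [Set.mem_ofPred_eq, hZ, ← hH1]
      simp only [Homeomorph.symm_trans_apply, Homeomorph.symm_symm, Homeomorph.apply_symm_apply]
      exact (key x').1 hx

/-- A positive combination of exponentials whose derivative at zero is nonnegative is strictly
increasing and unbounded on the positive half-line. -/
theorem sum_exp_strictMonoOn_and_unbounded {ι : Type*} (s : Finset ι) (k x : ι → ℝ) (hk : ∀ j ∈ s, 0 < k j)
    (hder : 0 ≤ ∑ j ∈ s, k j * x j) (hx : ∃ j ∈ s, x j ≠ 0) :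
    StrictMonoOn (fun t => ∑ j ∈ s, k j * Real.exp (t * x j)) (Set.Ici 0) ∧
      ∀ M, ∃ t, 0 ≤ t ∧ M ≤ ∑ j ∈ s, k j * Real.exp (t * x j) := by
  constructor
  · intro t ht t' _ htt
    have hpos : 0 < t' - t := sub_pos.2 htt
    have hle : ∀ y : ℝ, (t' - t) * y ≤ Real.exp (t' * y) - Real.exp (t * y) ∧
        (y ≠ 0 → (t' - t) * y < Real.exp (t' * y) - Real.exp (t * y)) := by
      intro y
      have h1 : Real.exp (t' * y) - Real.exp (t * y) =
          Real.exp (t * y) * (Real.exp ((t' - t) * y) - 1) := by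
        rw [mul_sub, ← Real.exp_add]
        ring_nf
      have h2 : y ≤ Real.exp (t * y) * y := by
        rcases le_total 0 y with h | h
        · exact le_mul_of_one_le_left h (Real.one_le_exp (mul_nonneg ht h))
        · nlinarith [Real.exp_le_one_iff.2 (mul_nonpos_of_nonneg_of_nonpos ht h)]
      have h3 : (t' - t) * y ≤ Real.exp (t * y) * ((t' - t) * y) := by nlinarith
      rw [h1]
      refine ⟨h3.trans (mul_le_mul_of_nonneg_left ?_ (Real.exp_nonneg _)),
        fun hy => h3.trans_lt (mul_lt_mul_of_pos_left ?_ (Real.exp_pos _))⟩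
      · linarith [Real.add_one_le_exp ((t' - t) * y)]
      · linarith [Real.add_one_lt_exp (mul_ne_zero hpos.ne' hy)]
    obtain ⟨i, hi, hxi⟩ := hx
    have h4 : ∑ j ∈ s, (k j * Real.exp (t * x j) + (t' - t) * (k j * x j)) <
        ∑ j ∈ s, k j * Real.exp (t' * x j) := by
      refine Finset.sum_lt_sum (fun j hj => ?_) ⟨i, hi, ?_⟩
      · nlinarith [mul_le_mul_of_nonneg_left (hle (x j)).1 (hk j hj).le]
      · nlinarith [mul_lt_mul_of_pos_left ((hle (x i)).2 hxi) (hk i hi)]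
    rw [Finset.sum_add_distrib, ← Finset.mul_sum] at h4
    simp only
    nlinarith [mul_nonneg hpos.le hder]
  · intro M
    obtain ⟨i, hi, hxi⟩ : ∃ i ∈ s, 0 < x i := by
      by_contra! h
      obtain ⟨i, hi, hxi⟩ := hx
      have : ∑ j ∈ s, k j * x j < ∑ j ∈ s, 0 := by
        refine Finset.sum_lt_sum (fun j hj => ?_) ⟨i, hi, ?_⟩
        · exact mul_nonpos_of_nonneg_of_nonpos (hk j hj).le (h j hj)
        · exact mul_neg_of_pos_of_neg (hk i hi) (lt_of_le_of_ne (h i hi) hxi)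
      rw [Finset.sum_const_zero] at this
      linarith
    have hki := hk i hi
    refine ⟨|M| / (k i * x i), by positivity, ?_⟩
    refine le_trans ?_ (Finset.single_le_sum (f := fun j =>
      k j * Real.exp (|M| / (k i * x i) * x j))
      (fun j hj => mul_nonneg (hk j hj).le (Real.exp_nonneg _)) hi)
    have h1 : |M| / (k i * x i) * x i = |M| / k i := by field_simp
    simp only [h1]
    have h2 := Real.add_one_le_exp (|M| / k i)
    have h3 : k i * (|M| / k i) = |M| := by field_simp
    nlinarith [le_abs_self M, mul_le_mul_of_nonneg_left h2 hki.le]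

theorem strictMono_sum_exp_of_separating {ι : Type*} [Fintype ι] {c x : ι → ℝ} {κ : ℝ}
    (hc : ∀ j, c j ≠ 0) (w : ι → ℝ) (hsep : ∀ j, 0 ≤ c j * (x j - κ)) (hne : ∃ i, x i ≠ κ) :
    StrictMono fun t => ∑ j, c j * Real.exp (w j + t * (x j - κ)) := by
  obtain ⟨i, hi⟩ := hne
  intro t t' htt
  have htt' : 0 < t' - t := sub_pos.2 htt
  have key : ∀ j, c j * Real.exp (w j + t' * (x j - κ)) - c j * Real.exp (w j + t * (x j - κ)) =
      Real.exp (w j + t * (x j - κ)) * (c j * (Real.exp ((t' - t) * (x j - κ)) - 1)) := by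
    intro j
    rw [show w j + t' * (x j - κ) = w j + t * (x j - κ) + (t' - t) * (x j - κ) by ring,
      Real.exp_add (w j + t * (x j - κ))]
    ring
  have hterm : ∀ j, 0 ≤ c j * (Real.exp ((t' - t) * (x j - κ)) - 1) := by
    intro j
    rcases (hc j).lt_or_gt with h | h
    · refine mul_nonneg_of_nonpos_of_nonpos h.le (sub_nonpos.2 (Real.exp_le_one_iff.2 ?_))
      exact mul_nonpos_of_nonneg_of_nonpos htt'.le (nonpos_of_mul_nonneg_right (hsep j) h)
    · refine mul_nonneg h.le (sub_nonneg.2 (Real.one_le_exp ?_))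
      exact mul_nonneg htt'.le (nonneg_of_mul_nonneg_right (hsep j) h)
  rw [← sub_pos]
  simp only
  rw [← Finset.sum_sub_distrib]
  simp only [key]
  refine Finset.sum_pos' (fun j _ => mul_nonneg (Real.exp_nonneg _) (hterm j))
    ⟨i, Finset.mem_univ i, mul_pos (Real.exp_pos _) (lt_of_le_of_ne (hterm i) ?_)⟩
  refine (mul_ne_zero (hc i) ?_).symm
  rw [sub_ne_zero, Ne, Real.exp_eq_one_iff]
  exact mul_ne_zero htt'.ne' (sub_ne_zero.2 hi)

section ExpSum

variable {V : Type*} [NormedAddCommGroup V] [NormedSpace ℝ V] {ι : Type*} [Fintype ι]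

/-- A real linear combination of exponentials of linear functionals. -/
noncomputable def expSum (c : ι → ℝ) (A : ι → V →L[ℝ] ℝ) (y : V) : ℝ :=
  ∑ j, c j * Real.exp (A j y)

theorem continuous_expSum (c : ι → ℝ) (A : ι → V →L[ℝ] ℝ) : Continuous (expSum c A) := by
  unfold expSum
  fun_prop

/-- Factoring out a monomial. -/
theorem expSum_eq_exp_mul (c : ι → ℝ) (A : ι → V →L[ℝ] ℝ) (y : V) (s : ℝ) :
    expSum c A y = Real.exp s * ∑ j, c j * Real.exp (A j y - s) := by
  rw [expSum, Finset.mul_sum]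
  refine Finset.sum_congr rfl fun j _ => ?_
  rw [Real.exp_sub]
  field_simp

theorem expSum_eq_zero_iff (c : ι → ℝ) (A : ι → V →L[ℝ] ℝ) (y : V) (s : ℝ) :
    expSum c A y = 0 ↔ ∑ j, c j * Real.exp (A j y - s) = 0 := by
  rw [expSum_eq_exp_mul c A y s]
  simp [Real.exp_ne_zero]

theorem mem_connectedComponentIn_of_path {X : Type*} [TopologicalSpace X] {Z : Set X} {γ : ℝ → X}
    {δ : ℝ} (hδ : 0 ≤ δ) (hγ : ContinuousOn γ (Set.Icc 0 δ)) (hZ : ∀ t ∈ Set.Icc 0 δ, γ t ∈ Z) :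
    γ δ ∈ connectedComponentIn Z (γ 0) :=
  (isPreconnected_Icc.image γ hγ).subset_connectedComponentIn
    (Set.mem_image_of_mem γ (Set.left_mem_Icc.2 hδ)) (Set.image_subset_iff.2 hZ)
    (Set.mem_image_of_mem γ (Set.right_mem_Icc.2 hδ))

/-- A component containing a path along which a linear functional is unbounded is not compact. -/
theorem not_isCompact_of_unbounded_path {Z : Set V} {p : V} {γ : ℝ → V} (ℓ : V →L[ℝ] ℝ)
    (hγ : ContinuousOn γ (Set.Ici 0)) (h0 : γ 0 = p) (hZ : ∀ t, 0 ≤ t → γ t ∈ Z) {k : ℝ}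
    (hk : k ≠ 0) (hℓ : ∀ t, 0 ≤ t → ℓ (γ t) = ℓ p + t * k) :
    ¬ IsCompact (connectedComponentIn Z p) := by
  intro hC
  obtain ⟨M, hM⟩ := hC.exists_bound_of_continuousOn ℓ.continuous.continuousOn
  have hk' : 0 < |k| := abs_pos.2 hk
  have hM0 : 0 ≤ M := by
    refine (norm_nonneg _).trans (hM p (mem_connectedComponentIn ?_))
    exact h0 ▸ hZ 0 le_rfl
  set t : ℝ := (M + |ℓ p| + 1) / |k| with ht
  have ht0 : 0 ≤ t := by positivity
  have h1 := mem_connectedComponentIn_of_path ht0 (hγ.mono Set.Icc_subset_Ici_self)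
    fun s hs => hZ s hs.1
  rw [h0] at h1
  have h2 := hM _ h1
  rw [hℓ t ht0, Real.norm_eq_abs] at h2
  have h3 : |t * k| = M + |ℓ p| + 1 := by
    rw [abs_mul, abs_of_nonneg ht0, ht, div_mul_cancel₀ _ hk'.ne']
  have h4 := abs_sub (ℓ p + t * k) (ℓ p)
  rw [add_sub_cancel_left] at h4
  linarith

/-- If a direction weakly separates the exponents of positive terms from those of negative terms,
then no component of the zero set is compact. -/
theorem not_isCompact_of_separating [FiniteDimensional ℝ V] (hV : 2 ≤ Module.finrank ℝ V)
    (c : ι → ℝ) (hc : ∀ j, c j ≠ 0) (A : ι → V →L[ℝ] ℝ) {v : V} (hv : v ≠ 0) {κ : ℝ}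
    (hsep : ∀ j, 0 ≤ c j * (A j v - κ)) {p : V} (hp : expSum c A p = 0) :
    ¬ IsCompact (connectedComponentIn {y | expSum c A y = 0} p) := by
  by_cases hall : ∀ j, A j v = κ
  · obtain ⟨ℓ, hℓ⟩ := SeparatingDual.exists_eq_one (R := ℝ) hv
    refine not_isCompact_of_unbounded_path (γ := fun t => p + t • v) ℓ (by fun_prop) (by simp)
      (fun t _ => ?_) one_ne_zero (fun t _ => by simp [hℓ])
    rw [Set.mem_ofPred_eq, expSum_eq_zero_iff c A _ (t * κ)]
    simpa [hall, expSum] using hp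
  push Not at hall
  obtain ⟨i, hi⟩ := hall
  intro hC
  obtain ⟨u, hu⟩ : ∃ u : V, u ∉ Submodule.span ℝ {v} := by
    by_contra! h
    have h1 : Submodule.span ℝ {v} = ⊤ := Submodule.eq_top_iff'.2 h
    have h2 := finrank_span_singleton (K := ℝ) hv
    rw [h1, finrank_top] at h2
    omega
  obtain ⟨ℓ₀, hu₀, hv₀⟩ := Submodule.exists_le_ker_of_notMem hu
  set ℓ : V →L[ℝ] ℝ := LinearMap.toContinuousLinearMap ℓ₀ with hℓ
  have hℓv : ℓ v = 0 := by
    have := hv₀ (Submodule.mem_span_singleton_self v)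
    simpa [hℓ] using this
  have hℓu : ℓ u ≠ 0 := hu₀
  clear_value ℓ
  clear hu₀ hv₀ hℓ
  wlog hpos : 0 < ℓ u generalizing u
  · refine this (-u) (by simpa using hu) (by simpa using hℓu) ?_
    rw [map_neg]
    exact neg_pos.2 (lt_of_le_of_ne (not_lt.1 hpos) hℓu)
  obtain ⟨q, hq, hmax⟩ := hC.exists_isMaxOn ⟨p, mem_connectedComponentIn hp⟩
    ℓ.continuous.continuousOn
  have hqZ : q ∈ {y | expSum c A y = 0} := connectedComponentIn_subset _ _ hq
  rw [Set.mem_ofPred_eq] at hqZ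
  rw [connectedComponentIn_eq hq] at hmax
  set φ : ℝ → ℝ → ℝ := fun s t =>
    ∑ j, c j * Real.exp (A j (q + s • u + (t - 1) • v) - (t - 1) * κ) with hφ
  have hmono : ∀ s, StrictMono (φ s) := fun s => by
    have h := strictMono_sum_exp_of_separating hc (fun j => A j (q + s • u)) hsep ⟨i, hi⟩
    convert h.comp (strictMono_id.add_const (-1)) using 1
    ext t
    simp only [hφ, Function.comp_apply, id, map_add, map_smul, smul_eq_mul]
    refine Finset.sum_congr rfl fun j _ => ?_
    congr 2
    ring
  have hφt : ∀ t, Continuous fun s => φ s t := fun t => by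
    simp only [hφ]
    fun_prop
  have hφs : ∀ s, Continuous (φ s) := fun s => by
    simp only [hφ]
    fun_prop
  have hφ01 : φ 0 1 = 0 := by simpa [hφ, expSum] using hqZ
  have hev : ∀ᶠ s in nhds (0 : ℝ), φ s 0 < 0 ∧ 0 < φ s 2 :=
    ((hφt 0).tendsto 0 |>.eventually (gt_mem_nhds ((hmono 0 zero_lt_one).trans_eq hφ01))).and
      ((hφt 2).tendsto 0 |>.eventually (lt_mem_nhds (hφ01.symm.trans_lt (hmono 0 one_lt_two))))
  obtain ⟨ε, hε, hball⟩ := Metric.eventually_nhds_iff.1 hev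
  set δ := ε / 2 with hδ
  have hδ0 : 0 < δ := half_pos hε
  have hex : ∀ s, ∃ t, s ∈ Set.Icc 0 δ → 0 ≤ t ∧ φ s t = 0 := by
    intro s
    by_cases hs : s ∈ Set.Icc 0 δ
    · obtain ⟨h1, h2⟩ := hball (y := s) (by
        rw [Real.dist_eq, sub_zero, abs_of_nonneg hs.1]
        linarith [hs.2])
      obtain ⟨t, ht, ht0⟩ := intermediate_value_Icc (a := (0 : ℝ)) (b := 2) (by norm_num)
        (hφs s).continuousOn ⟨h1.le, h2.le⟩
      exact ⟨t, fun _ => ⟨ht.1, ht0⟩⟩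
    · exact ⟨0, fun h => (hs h).elim⟩
  choose T hT using hex
  have hTcont : ContinuousOn T (Set.Icc 0 δ) :=
    continuousOn_of_sign_change_s3 (φ := φ) (fun a _ => (hφt a).continuousOn)
      (fun s hs => (hT s hs).1)
      (fun s hs a _ ha => (hmono s ha).trans_eq (hT s hs).2) (fun s hs => (hT s hs).2)
      (fun s hs a ha => (hT s hs).2.symm.trans_lt (hmono s ha))
  have hT0 : T 0 = 1 := (hmono 0).injective
    ((hT 0 (Set.left_mem_Icc.2 hδ0.le)).2.trans hφ01.symm)
  have hmem := mem_connectedComponentIn_of_path (Z := {y | expSum c A y = 0})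
    (γ := fun s => q + s • u + (T s - 1) • v) hδ0.le (by fun_prop) fun s hs => by
      rw [Set.mem_ofPred_eq, expSum_eq_zero_iff c A _ ((T s - 1) * κ)]
      exact (hT s hs).2
  simp only [hT0, sub_self, zero_smul, add_zero] at hmem
  have h1 := hmax hmem
  simp only [Set.mem_ofPred_eq, map_add, map_smul, hℓv, smul_eq_mul, mul_zero, add_zero] at h1
  have := mul_pos hδ0 hpos
  linarith

/-- With at most `dim V + 2` exponents, either some direction separates the exponents, or the signs
of the coefficients agree with those of an affine dependence that spans all of them. -/
theorem exists_affine_dependence [FiniteDimensional ℝ V] (hV : 2 ≤ Module.finrank ℝ V)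
    (hι : Fintype.card ι ≤ 2 + Module.finrank ℝ V) [Nonempty ι]
    (c : ι → ℝ) (hc : ∀ j, c j ≠ 0) (A : ι → V →L[ℝ] ℝ)
    (hsep : ∀ v κ, (∀ j, 0 ≤ c j * (A j v - κ)) → v = 0) :
    ∃ b : ι → ℝ, (∀ j, 0 < b j * c j) ∧ (∀ v κ, ∑ j, b j * (A j v - κ) = 0) ∧
      ∀ x : ι → ℝ, ∑ j, b j * x j = 0 → ∃ v κ, ∀ j, A j v - κ = x j := by
  classical
  let L : V × ℝ →ₗ[ℝ] (ι → ℝ) := LinearMap.pi fun j =>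
    (A j).toLinearMap ∘ₗ LinearMap.fst ℝ V ℝ - LinearMap.snd ℝ V ℝ
  have hL : ∀ v κ j, L (v, κ) j = A j v - κ := fun v κ j => by simp [L]
  have hinj : Function.Injective L := by
    rw [← LinearMap.ker_eq_bot, LinearMap.ker_eq_bot']
    rintro ⟨v, κ⟩ h
    have h' : ∀ j, A j v - κ = 0 := fun j => by rw [← hL, h, Pi.zero_apply]
    have hv : v = 0 := hsep v κ fun j => by simp [h' j]
    obtain ⟨j⟩ := ‹Nonempty ι›
    have := h' j
    simp only [hv, map_zero, zero_sub, neg_eq_zero] at this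
    simp [hv, this]
  have hrank : Module.finrank ℝ (LinearMap.range L) = Module.finrank ℝ V + 1 := by
    rw [LinearMap.finrank_range_of_inj hinj, Module.finrank_prod, Module.finrank_self]
  have hcard : Module.finrank ℝ V + 1 ≤ Fintype.card ι := by
    rw [← hrank, ← Module.finrank_fintype_fun_eq_card ℝ]
    exact Submodule.finrank_le _
  obtain ⟨b, hb⟩ : ∃ b : ι → ℝ, ∀ x : ι → ℝ, x ∈ LinearMap.range L ↔ ∑ j, b j * x j = 0 := by
    by_cases htop : LinearMap.range L = ⊤
    · exact ⟨0, fun x => by simp [htop]⟩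
    obtain ⟨f, hf, hker⟩ := Submodule.exists_le_ker_of_lt_top _ (lt_top_iff_ne_top.2 htop)
    have hfsum : ∀ x, f x = ∑ j, f (Pi.single j 1) * x j := fun x => by
      rw [LinearMap.pi_apply_eq_sum_univ f x]
      refine Finset.sum_congr rfl fun j _ => ?_
      rw [smul_eq_mul, mul_comm]
      congr 2
      ext k
      simp [Pi.single_apply, eq_comm]
    refine ⟨fun j => f (Pi.single j 1), fun x => ?_⟩
    rw [← hfsum, ← LinearMap.mem_ker]
    have hlt : LinearMap.ker f < ⊤ := by
      rw [lt_top_iff_ne_top, Ne, LinearMap.ker_eq_top]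
      exact hf
    have := Submodule.finrank_lt hlt.ne
    rw [Module.finrank_fintype_fun_eq_card] at this
    rw [Submodule.eq_of_le_of_finrank_le hker (by omega)]
  have hreal : ∀ x : ι → ℝ, ∑ j, b j * x j = 0 → ∃ v κ, ∀ j, A j v - κ = x j := by
    intro x hx
    obtain ⟨⟨v, κ⟩, rfl⟩ := (hb x).2 hx
    exact ⟨v, κ, fun j => (hL v κ j).symm⟩
  have hzero : ∀ v κ, ∑ j, b j * (A j v - κ) = 0 := by
    intro v κ
    simpa only [hL] using (hb _).1 (LinearMap.mem_range_self L (v, κ))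
  have hpair : ∀ i i', i ≠ i' → 0 < (b i * c i) * (b i' * c i') := by
    intro i i' hii
    by_contra! hle
    obtain ⟨α, β, hα, hβ, hne, hαβ⟩ : ∃ α β : ℝ, 0 ≤ α ∧ 0 ≤ β ∧ (α ≠ 0 ∨ β ≠ 0) ∧
        α * (b i * c i) + β * (b i' * c i') = 0 := by
      generalize b i * c i = P at hle
      generalize b i' * c i' = Q at hle
      by_cases hP : P = 0
      · exact ⟨1, 0, by simp, by simp, by simp, by simp [hP]⟩
      · refine ⟨|Q|, |P|, abs_nonneg _, abs_nonneg _, Or.inr (abs_ne_zero.2 hP), ?_⟩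
        rcases lt_or_gt_of_ne hP with h | h
        · rw [abs_of_neg h, abs_of_nonneg (nonneg_of_mul_nonpos_right hle h)]
          ring
        · rw [abs_of_pos h, abs_of_nonpos (nonpos_of_mul_nonpos_right hle h)]
          ring
    obtain ⟨v, κ, hx⟩ := hreal (Pi.single i (α * c i) + Pi.single i' (β * c i')) (by
      simp only [Pi.add_apply, mul_add, Finset.sum_add_distrib, Pi.single_apply, mul_ite, mul_zero,
        Finset.sum_ite_eq', Finset.mem_univ, if_true]
      linarith)
    have hv : v = 0 := by
      refine hsep v κ fun j => ?_
      rw [hx]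
      simp only [Pi.add_apply, Pi.single_apply]
      rw [mul_add]
      refine add_nonneg ?_ ?_
      · split_ifs with h
        · subst h
          nlinarith [mul_nonneg hα (mul_self_nonneg (c j))]
        · simp
      · split_ifs with h
        · subst h
          nlinarith [mul_nonneg hβ (mul_self_nonneg (c j))]
        · simp
    obtain ⟨k, hk⟩ : ∃ k, k ∉ ({i, i'} : Finset ι) := by
      by_contra! h
      have h1 : Fintype.card ι ≤ ({i, i'} : Finset ι).card :=
        Finset.card_le_card fun x _ => h x
      have h2 := Finset.card_le_two (a := i) (b := i')
      omega
    simp only [Finset.mem_insert, Finset.mem_singleton, not_or] at hk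
    have e1 := hx k
    have e2 := hx i
    have e3 := hx i'
    simp only [hv, map_zero, Pi.add_apply, Pi.single_apply, hk.1, hk.2, hii, hii.symm, if_true,
      if_false, add_zero, zero_add] at e1 e2 e3
    rw [e1] at e2 e3
    rcases hne with h | h
    · exact mul_ne_zero h (hc i) e2.symm
    · exact mul_ne_zero h (hc i') e3.symm
  obtain ⟨i₀⟩ := ‹Nonempty ι›
  obtain ⟨i₁, hi₁⟩ : ∃ i₁, i₁ ≠ i₀ := by
    have : Nontrivial ι := Fintype.one_lt_card_iff_nontrivial.1 (by omega)
    exact exists_ne i₀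
  have hall : ∀ j, 0 < (b i₀ * c i₀) * (b j * c j) := by
    intro j
    by_cases hj : i₀ = j
    · subst hj
      have := hpair i₁ i₀ hi₁
      exact mul_self_pos.2 (right_ne_zero_of_mul this.ne')
    · exact hpair _ _ hj
  refine ⟨fun j => (b i₀ * c i₀) * b j, fun j => by nlinarith [hall j], fun v κ => ?_,
    fun x hx => hreal x ?_⟩
  · simp only [mul_assoc]
    rw [← Finset.mul_sum, ← Finset.mul_sum, hzero, mul_zero, mul_zero]
  · have h1 : (b i₀ * c i₀) * ∑ j, b j * x j = 0 := by
      rw [← hx, Finset.mul_sum]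
      exact Finset.sum_congr rfl fun j _ => by ring
    exact (mul_eq_zero.1 h1).resolve_left (left_ne_zero_of_mul (hall i₀).ne')

/-- A direction moving only the exponents `i` and `i'`, and increasing the terms indexed by `s`. -/
theorem exists_direction {b : ι → ℝ} {A : ι → V →L[ℝ] ℝ}
    (hreal : ∀ x : ι → ℝ, ∑ j, b j * x j = 0 → ∃ v κ, ∀ j, A j v - κ = x j)
    {s : Finset ι} {i i' : ι} (hi : i ∈ s) (hi' : i' ∈ s) (hii : i ≠ i') (hb : 0 < b i * b i')
    (k : ι → ℝ) :
    ∃ (x : ι → ℝ) (v : V) (κ : ℝ), (∀ j, A j v = x j + κ) ∧ (∀ j, j ∉ s → x j = 0) ∧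
      x i ≠ x i' ∧ 0 ≤ ∑ j ∈ s, k j * x j := by
  classical
  set x : ι → ℝ := Pi.single i (b i') - Pi.single i' (b i) with hxdef
  have hxi : x i = b i' := by simp [hxdef, hii]
  have hxi' : x i' = -b i := by simp [hxdef, hii.symm]
  have hsupp : ∀ j, j ∉ s → x j = 0 := by
    intro j hj
    have h1 : j ≠ i := fun h => hj (h ▸ hi)
    have h2 : j ≠ i' := fun h => hj (h ▸ hi')
    simp [hxdef, h1, h2]
  have hsum : ∑ j, b j * x j = 0 := by
    simp only [hxdef, Pi.sub_apply, mul_sub, Finset.sum_sub_distrib, Pi.single_apply, mul_ite,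
      mul_zero, Finset.sum_ite_eq', Finset.mem_univ, if_true]
    ring
  have hne : x i ≠ x i' := by
    rw [hxi, hxi']
    intro h
    rw [h] at hb
    nlinarith [mul_self_nonneg (b i)]
  obtain ⟨v, κ, hv⟩ := hreal x hsum
  have hv' : ∀ j, A j v = x j + κ := fun j => by rw [← hv]; ring
  rcases le_total 0 (∑ j ∈ s, k j * x j) with h | h
  · exact ⟨x, v, κ, hv', hsupp, hne, h⟩
  · refine ⟨-x, -v, -κ, fun j => ?_, fun j hj => ?_, ?_, ?_⟩
    · simp [hv' j]
      ring
    · simp [hsupp j hj]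
    · simpa using hne
    · simpa using h

/-- If the signs agree with those of an affine dependence, and there are at least two positive
and two negative terms, then no component of the zero set is compact. -/
theorem not_isCompact_of_two_pos_two_neg {b c : ι → ℝ} {A : ι → V →L[ℝ] ℝ} (hc : ∀ j, c j ≠ 0)
    (hbc : ∀ j, 0 < b j * c j)
    (hreal : ∀ x : ι → ℝ, ∑ j, b j * x j = 0 → ∃ v κ, ∀ j, A j v - κ = x j)
    {i i' l l' : ι} (hii : i ≠ i') (hi : 0 < c i) (hi' : 0 < c i')
    (hll : l ≠ l') (hl : c l < 0) (hl' : c l' < 0) {p : V} (hp : expSum c A p = 0) :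
    ¬ IsCompact (connectedComponentIn {y | expSum c A y = 0} p) := by
  classical
  have hbpos : ∀ j, 0 < c j → 0 < b j := fun j hj => pos_of_mul_pos_left (hbc j) hj.le
  have hbneg : ∀ j, c j < 0 → b j < 0 := fun j hj => by
    by_contra! h
    exact (hbc j).not_ge (mul_nonpos_of_nonneg_of_nonpos h hj.le)
  set S : Finset ι := {j | 0 < c j} with hS
  have hmemS : ∀ j, j ∈ S ↔ 0 < c j := fun j => by simp [hS]
  have hmemSc : ∀ j, j ∈ Sᶜ ↔ c j < 0 := fun j => by
    rw [Finset.mem_compl, hmemS, not_lt]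
    exact ⟨fun h => lt_of_le_of_ne h (hc j), le_of_lt⟩
  set k : ι → ℝ := fun j => |c j| * Real.exp (A j p) with hk
  have hkpos : ∀ j, 0 < k j := fun j => mul_pos (abs_pos.2 (hc j)) (Real.exp_pos _)
  obtain ⟨x, v, κ, hv, hxs, hxne, hxd⟩ := exists_direction hreal ((hmemS i).2 hi)
    ((hmemS i').2 hi') hii (mul_pos (hbpos i hi) (hbpos i' hi')) k
  obtain ⟨x', v', κ', hv', hxs', hxne', hxd'⟩ := exists_direction hreal ((hmemSc l).2 hl)
    ((hmemSc l').2 hl') hll (mul_pos_of_neg_of_neg (hbneg l hl) (hbneg l' hl')) k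
  have hnz : ∀ {y : ι → ℝ} {s : Finset ι} {a a' : ι}, a ∈ s → a' ∈ s → y a ≠ y a' →
      ∃ j ∈ s, y j ≠ 0 := by
    intro y s a a' ha ha' hne
    by_contra! h
    exact hne ((h a ha).trans (h a' ha').symm)
  obtain ⟨hPmono, -⟩ := sum_exp_strictMonoOn_and_unbounded S k x (fun j _ => hkpos j) hxd
    (hnz ((hmemS i).2 hi) ((hmemS i').2 hi') hxne)
  obtain ⟨hNmono, hNunb⟩ := sum_exp_strictMonoOn_and_unbounded Sᶜ k x' (fun j _ => hkpos j) hxd'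
    (hnz ((hmemSc l).2 hl) ((hmemSc l').2 hl') hxne')
  set P : ℝ → ℝ := fun t => ∑ j ∈ S, k j * Real.exp (t * x j) with hP
  set N : ℝ → ℝ := fun t => ∑ j ∈ Sᶜ, k j * Real.exp (t * x' j) with hN
  have hPcont : Continuous P := by fun_prop
  have hNcont : Continuous N := by fun_prop
  have hF : ∀ t r, expSum c A (p + t • v + r • v') = 0 ↔ P t = N r := by
    intro t r
    rw [expSum_eq_zero_iff c A _ (t * κ + r * κ'), ← Finset.sum_add_sum_compl S, ← sub_eq_zero
      (a := P t), sub_eq_add_neg, hP, hN, ← Finset.sum_neg_distrib]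
    refine Iff.of_eq (congrArg (· = 0) (congrArg₂ _ ?_ ?_)) <;>
      refine Finset.sum_congr rfl fun j hj => ?_
    · have h1 : A j (p + t • v + r • v') - (t * κ + r * κ') = A j p + t * x j := by
        simp only [map_add, map_smul, smul_eq_mul, hv, hv',
          hxs' j (fun h => Finset.mem_compl.1 h hj)]
        ring
      rw [h1, Real.exp_add, hk]
      simp only
      rw [abs_of_pos ((hmemS j).1 hj), mul_assoc]
    · have h1 : A j (p + t • v + r • v') - (t * κ + r * κ') = A j p + r * x' j := by
        simp only [map_add, map_smul, smul_eq_mul, hv, hv', hxs j (Finset.mem_compl.1 hj)]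
        ring
      rw [h1, Real.exp_add, hk]
      simp only
      rw [abs_of_neg ((hmemSc j).1 hj)]
      ring
  have h00 : P 0 = N 0 := (hF 0 0).1 (by simpa using hp)
  have hex : ∀ t, ∃ r, 0 ≤ t → 0 ≤ r ∧ N r = P t := by
    intro t
    by_cases ht : 0 ≤ t
    · obtain ⟨R, hR0, hR⟩ := hNunb (P t)
      obtain ⟨r, hr, hrt⟩ := intermediate_value_Icc hR0 hNcont.continuousOn
        ⟨h00 ▸ hPmono.monotoneOn (Set.mem_Ici.2 le_rfl) (Set.mem_Ici.2 ht) ht, hR⟩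
      exact ⟨r, fun _ => ⟨hr.1, hrt⟩⟩
    · exact ⟨0, fun h => (ht h).elim⟩
  choose T hT using hex
  have hTcont : ContinuousOn T (Set.Ici 0) := by
    refine continuousOn_of_sign_change_s3 (φ := fun t r => N r - P t)
      (fun a _ => by fun_prop) (fun t ht => (hT t ht).1) (fun t ht a ha hat => ?_)
      (fun t ht => sub_eq_zero.2 (hT t ht).2) (fun t ht a hat => ?_)
    · rw [sub_neg, ← (hT t ht).2]
      exact hNmono ha (hT t ht).1 hat
    · rw [sub_pos, ← (hT t ht).2]
      exact hNmono (hT t ht).1 ((hT t ht).1.trans hat.le) hat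
  have hT0 : T 0 = 0 := hNmono.injOn (hT 0 le_rfl).1 (Set.mem_Ici.2 le_rfl)
    ((hT 0 le_rfl).2.trans h00)
  refine not_isCompact_of_unbounded_path (A i - A i') (γ := fun t => p + t • v + T t • v')
    (k := x i - x i') (by fun_prop) (by simp [hT0])
    (fun t ht => (hF t (T t)).2 (hT t ht).2.symm) (sub_ne_zero.2 hxne) fun t _ => ?_
  have e1 : x' i = 0 := hxs' i fun h => ((hmemSc i).1 h).not_gt hi
  have e2 : x' i' = 0 := hxs' i' fun h => ((hmemSc i').1 h).not_gt hi'
  simp only [sub_apply, map_add, map_smul, smul_eq_mul, hv, hv', e1, e2]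
  ring

/-- If all coefficients but one are positive and the exponents are affinely spanned by a positive
dependence, the zero set is empty, a point, or a hypersurface that is star-shaped around a
point. -/
theorem subsingleton_or_radialSignChange {b c : ι → ℝ} {A : ι → V →L[ℝ] ℝ} {o : ι}
    (ho : c o < 0) (hpos : ∀ j, j ≠ o → 0 < c j) (hb : ∀ j, j ≠ o → 0 < b j)
    (hsep : ∀ v κ, (∀ j, 0 ≤ c j * (A j v - κ)) → v = 0)
    (hzero : ∀ v κ, ∑ j, b j * (A j v - κ) = 0) :
    {y | expSum c A y = 0}.Subsingleton ∨
      ∃ (h : V → ℝ) (y₀ : V), Continuous h ∧ RadialSignChange (fun y => h (y₀ + y)) ∧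
        ∀ y, expSum c A y = 0 ↔ h y = 0 := by
  classical
  set h : V → ℝ := fun y => ∑ j, c j * Real.exp (A j y - A o y) with hh
  have hcont : Continuous h := by fun_prop
  have hzeroset : ∀ y, expSum c A y = 0 ↔ h y = 0 := fun y => expSum_eq_zero_iff c A y _
  have hsplit : ∀ y, h y = ∑ j ∈ {o}ᶜ, c j * Real.exp (A j y - A o y) + c o := by
    intro y
    rw [hh, add_comm]
    simp only
    rw [← Finset.sum_add_sum_compl {o}]
    simp
  have hne : ∀ y : V, y ≠ 0 → ∃ j, j ≠ o ∧ A j y ≠ A o y := by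
    intro y hy
    by_contra! hall
    refine hy (hsep y (A o y) fun j => ?_)
    by_cases hj : j = o
    · simp [hj]
    · simp [hall j hj]
  have hup : ∀ y : V, y ≠ 0 → ∃ j, j ≠ o ∧ 0 < A j y - A o y := by
    intro y hy
    by_contra! hall
    obtain ⟨i, hio, hi⟩ := hne y hy
    have h1 := hzero y (A o y)
    have h2 : ∑ j, b j * (A j y - A o y) < ∑ j : ι, 0 := by
      refine Finset.sum_lt_sum (fun j _ => ?_) ⟨i, Finset.mem_univ i, ?_⟩
      · by_cases hj : j = o
        · simp [hj]
        · exact mul_nonpos_of_nonneg_of_nonpos (hb j hj).le (hall j hj)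
      · exact mul_neg_of_pos_of_neg (hb i hio) (lt_of_le_of_ne (hall i hio) (sub_ne_zero.2 hi))
    rw [h1, Finset.sum_const_zero] at h2
    exact h2.false
  have hconv : StrictConvexOn ℝ Set.univ h := by
    refine ⟨convex_univ, fun y _ z _ hyz α β hα hβ hαβ => ?_⟩
    obtain ⟨i, hio, hi⟩ := hne (y - z) (sub_ne_zero.2 hyz)
    have hlin : ∀ j, A j (α • y + β • z) - A o (α • y + β • z) =
        α • (A j y - A o y) + β • (A j z - A o z) := by
      intro j
      simp only [map_add, map_smul, smul_eq_mul]
      ring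
    rw [hsplit, hsplit, hsplit]
    simp only [hlin]
    have key : ∑ j ∈ {o}ᶜ, c j * Real.exp (α • (A j y - A o y) + β • (A j z - A o z)) <
        ∑ j ∈ {o}ᶜ, (α * (c j * Real.exp (A j y - A o y)) +
          β * (c j * Real.exp (A j z - A o z))) := by
      refine Finset.sum_lt_sum (fun j hj => ?_) ⟨i, by simpa using hio, ?_⟩
      · have h1 := convexOn_exp.2 (Set.mem_univ (A j y - A o y)) (Set.mem_univ (A j z - A o z))
          hα.le hβ.le hαβ
        simp only [smul_eq_mul] at h1 ⊢
        nlinarith [mul_le_mul_of_nonneg_left h1 (hpos j (by simpa using hj)).le]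
      · have h1 := strictConvexOn_exp.2 (Set.mem_univ (A i y - A o y))
          (Set.mem_univ (A i z - A o z)) (fun h => hi (by
            simp only [map_sub]
            linarith)) hα hβ hαβ
        simp only [smul_eq_mul] at h1 ⊢
        nlinarith [mul_lt_mul_of_pos_left h1 (hpos i hio)]
    rw [Finset.sum_add_distrib, ← Finset.mul_sum, ← Finset.mul_sum] at key
    simp only [smul_eq_mul] at key ⊢
    have : c o = α * c o + β * c o := by rw [← add_mul, hαβ, one_mul]
    linarith
  by_cases hneg : ∃ y₀, h y₀ < 0
  swap
  · push Not at hneg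
    left
    intro y hy z hz
    by_contra hyz
    have h1 := hconv.2 (Set.mem_univ y) (Set.mem_univ z) hyz
      (by norm_num : (0 : ℝ) < 1 / 2) (by norm_num : (0 : ℝ) < 1 / 2) (by norm_num)
    rw [(hzeroset y).1 hy, (hzeroset z).1 hz] at h1
    have := hneg ((1 / 2 : ℝ) • y + (1 / 2 : ℝ) • z)
    simp only [smul_zero, add_zero] at h1
    linarith
  right
  obtain ⟨y₀, hy₀⟩ := hneg
  refine ⟨h, y₀, hcont, fun y hy => ?_, hzeroset⟩
  -- a chord from `y₀` to a point where `h ≤ 0` lies in the region `h < 0`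
  have hchord : ∀ s t : ℝ, 0 ≤ s → s < t → h (y₀ + t • y) ≤ 0 → h (y₀ + s • y) < 0 := by
    intro s t hs hst ht
    have ht0 : 0 < t := hs.trans_lt hst
    have hr : s / t < 1 := (div_lt_one ht0).2 hst
    have h1 := hconv.convexOn.2 (Set.mem_univ y₀) (Set.mem_univ (y₀ + t • y))
      (by linarith : 0 ≤ 1 - s / t) (by positivity : 0 ≤ s / t) (by ring)
    have h2 : (1 - s / t) • y₀ + (s / t) • (y₀ + t • y) = y₀ + s • y := by
      rw [smul_add, smul_smul, div_mul_cancel₀ _ ht0.ne', ← add_assoc, ← add_smul]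
      simp
    rw [h2] at h1
    simp only [smul_eq_mul] at h1
    have h3 : s / t * h (y₀ + t • y) ≤ 0 := mul_nonpos_of_nonneg_of_nonpos (by positivity) ht
    nlinarith
  obtain ⟨R, hR0, hR⟩ : ∃ R : ℝ, 0 ≤ R ∧ 0 ≤ h (y₀ + R • y) := by
    obtain ⟨i, hio, hi⟩ := hup y hy
    have hci := hpos i hio
    set k := c i * Real.exp (A i y₀ - A o y₀) with hk
    have hk0 : 0 < k := mul_pos hci (Real.exp_pos _)
    refine ⟨-c o / (k * (A i y - A o y)), div_nonneg (neg_nonneg.2 ho.le) (by positivity), ?_⟩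
    set R := -c o / (k * (A i y - A o y)) with hRdef
    have h1 : c i * Real.exp (A i (y₀ + R • y) - A o (y₀ + R • y)) ≤
        ∑ j ∈ {o}ᶜ, c j * Real.exp (A j (y₀ + R • y) - A o (y₀ + R • y)) :=
      Finset.single_le_sum (f := fun j => c j * Real.exp (A j (y₀ + R • y) - A o (y₀ + R • y)))
        (fun j hj => mul_nonneg (hpos j (by simpa using hj)).le (Real.exp_nonneg _))
        (by simpa using hio)
    have h2 : A i (y₀ + R • y) - A o (y₀ + R • y) =
        (A i y₀ - A o y₀) + R * (A i y - A o y) := by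
      simp only [map_add, map_smul, smul_eq_mul]
      ring
    rw [h2, Real.exp_add, ← mul_assoc, ← hk] at h1
    have h3 := mul_le_mul_of_nonneg_left (Real.add_one_le_exp (R * (A i y - A o y))) hk0.le
    have h4 : k * (R * (A i y - A o y)) = -c o := by
      rw [hRdef]
      field_simp
    rw [hsplit]
    nlinarith
  obtain ⟨T, ⟨hT0, -⟩, hT⟩ := intermediate_value_Icc hR0
    (f := fun t => h (y₀ + t • y)) (by fun_prop) (by
      rw [zero_smul, add_zero]
      exact ⟨hy₀.le, hR⟩)
  simp only at hT
  have hTpos : 0 < T := by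
    refine lt_of_le_of_ne hT0 fun h0 => ?_
    rw [← h0, zero_smul, add_zero] at hT
    exact hy₀.ne hT
  refine ⟨T, hTpos, hT, fun t ht htT => hchord t T ht htT hT.le, fun t ht => ?_⟩
  by_contra! hle
  exact (hchord T t hT0 ht hle).ne hT

/-- A zero set with a compact component, defined by at most `dim V + 2` exponentials, is a point
or a hypersurface that is star-shaped around a point. -/
theorem subsingleton_or_radialSignChange_of_isCompact [FiniteDimensional ℝ V] [Nonempty ι]
    (hV : 2 ≤ Module.finrank ℝ V) (hι : Fintype.card ι ≤ 2 + Module.finrank ℝ V) {c : ι → ℝ}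
    (hc : ∀ j, c j ≠ 0) {A : ι → V →L[ℝ] ℝ} {p : V} (hp : expSum c A p = 0)
    (hcomp : IsCompact (connectedComponentIn {y | expSum c A y = 0} p)) :
    {y | expSum c A y = 0}.Subsingleton ∨
      ∃ (h : V → ℝ) (y₀ : V), Continuous h ∧ RadialSignChange (fun y => h (y₀ + y)) ∧
        ∀ y, expSum c A y = 0 ↔ h y = 0 := by
  have hsep : ∀ v κ, (∀ j, 0 ≤ c j * (A j v - κ)) → v = 0 := by
    intro v κ h
    by_contra hv
    exact not_isCompact_of_separating hV c hc A hv h hp hcomp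
  obtain ⟨b, hbc, hzero, hreal⟩ := exists_affine_dependence hV hι c hc A hsep
  have hsum : ∑ j, b j = 0 := by simpa using hzero 0 (-1)
  have hbpos : ∀ j, 0 < c j → 0 < b j := fun j hj => pos_of_mul_pos_left (hbc j) hj.le
  have hbneg : ∀ j, c j < 0 → b j < 0 := fun j hj => by
    by_contra! h
    exact (hbc j).not_ge (mul_nonpos_of_nonneg_of_nonpos h hj.le)
  obtain ⟨i, hi⟩ : ∃ i, 0 < c i := by
    by_contra! h
    exact (Finset.sum_neg (fun j _ => hbneg j (lt_of_le_of_ne (h j) (hc j)))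
      Finset.univ_nonempty).ne hsum
  obtain ⟨l, hl⟩ : ∃ l, c l < 0 := by
    by_contra! h
    exact (Finset.sum_pos (fun j _ => hbpos j (lt_of_le_of_ne (h j) (hc j).symm))
      Finset.univ_nonempty).ne' hsum
  by_cases hneg : ∃ l', l ≠ l' ∧ c l' < 0
  · by_cases hpos : ∃ i', i ≠ i' ∧ 0 < c i'
    · obtain ⟨l', hll, hl'⟩ := hneg
      obtain ⟨i', hii, hi'⟩ := hpos
      exact absurd hcomp
        (not_isCompact_of_two_pos_two_neg hc hbc hreal hii hi hi' hll hl hl' hp)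
    · push Not at hpos
      have hlt : ∀ j, j ≠ i → c j < 0 := fun j hj => lt_of_le_of_ne (hpos j hj.symm) (hc j)
      have hexp : ∀ y, expSum (-c) A y = 0 ↔ expSum c A y = 0 := fun y => by simp [expSum]
      simp only [← hexp]
      refine subsingleton_or_radialSignChange (b := -b) (o := i) (neg_lt_zero.2 hi)
        (fun j hj => neg_pos.2 (hlt j hj)) (fun j hj => neg_pos.2 (hbneg j (hlt j hj)))
        (fun v κ h => neg_eq_zero.1 (hsep (-v) (-κ) fun j => ?_)) fun v κ => ?_
      · refine (h j).trans_eq ?_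
        simp only [Pi.neg_apply, map_neg]
        ring
      · simpa using hzero v κ
  · push Not at hneg
    have hgt : ∀ j, j ≠ l → 0 < c j := fun j hj =>
      lt_of_le_of_ne (hneg j hj.symm) (hc j).symm
    exact subsingleton_or_radialSignChange hl hgt (fun j hj => hbpos j (hgt j hj)) hsep hzero

end ExpSum

/-- The exponent vector `a`, as a linear functional of the logarithmic coordinates. -/
noncomputable def exponentFunctional {n : ℕ} (a : Fin n → ℤ) : (Fin n → ℝ) →L[ℝ] ℝ :=
  ∑ i, (a i : ℝ) • ContinuousLinearMap.proj i

theorem exp_exponentFunctional_log {n : ℕ} (a : Fin n → ℤ) (x : PosOrthant n) :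
    Real.exp (exponentFunctional a (logHomeomorph n x)) = ∏ i, (x.1 i) ^ (a i) := by
  have h : exponentFunctional a (logHomeomorph n x) = ∑ i, (a i : ℝ) * Real.log (x.1 i) := by
    simp [exponentFunctional, logHomeomorph]
  rw [h, Real.exp_sum]
  refine Finset.prod_congr rfl fun i _ => ?_
  rw [mul_comm, ← Real.rpow_def_of_pos (x.2 i), Real.rpow_intCast]

/-- Passing to logarithmic coordinates preserves compactness of components. -/
theorem isCompact_connectedComponentIn_log {n : ℕ} {Z W : Set (Fin n → ℝ)}
    (hZpos : Z ⊆ PosOrthant n) (hZW : ∀ x : PosOrthant n, x.1 ∈ Z ↔ logHomeomorph n x ∈ W)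
    {x₀ : PosOrthant n} (hx₀ : x₀.1 ∈ Z) (hC : IsCompact (connectedComponentIn Z x₀.1)) :
    IsCompact (connectedComponentIn W (logHomeomorph n x₀)) := by
  have hlog : ContinuousOn (fun (x : Fin n → ℝ) i => Real.log (x i)) (PosOrthant n) :=
    continuousOn_pi.2 fun i =>
      (continuous_apply i).continuousOn.log fun x hx => (ne_of_gt (hx i) : x i ≠ 0)
  have hCpos := (connectedComponentIn_subset Z x₀.1).trans hZpos
  have hsub : connectedComponentIn W (logHomeomorph n x₀) =
      (fun (x : Fin n → ℝ) i => Real.log (x i)) '' connectedComponentIn Z x₀.1 := by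
    have hy₀ : logHomeomorph n x₀ ∈ W := (hZW x₀).1 hx₀
    refine Set.Subset.antisymm (fun y hy => ?_) ?_
    · have hexp : Continuous fun y : Fin n → ℝ => ((logHomeomorph n).symm y).1 :=
        continuous_subtype_val.comp (logHomeomorph n).symm.continuous
      refine ⟨((logHomeomorph n).symm y).1, ?_, (logHomeomorph n).apply_symm_apply y⟩
      refine (isPreconnected_connectedComponentIn.image _
        hexp.continuousOn).subset_connectedComponentIn
        ⟨_, mem_connectedComponentIn hy₀, by simp only [Homeomorph.symm_apply_apply]⟩ ?_ ⟨y, hy, rfl⟩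
      rintro _ ⟨z, hz, rfl⟩
      rw [hZW, Homeomorph.apply_symm_apply]
      exact connectedComponentIn_subset _ _ hz
    · refine (isPreconnected_connectedComponentIn.image _
        (hlog.mono hCpos)).subset_connectedComponentIn
        ⟨_, mem_connectedComponentIn hx₀, rfl⟩ ?_
      rintro _ ⟨z, hz, rfl⟩
      exact (hZW ⟨z, hCpos hz⟩).1 (connectedComponentIn_subset _ _ hz)
  rw [hsub]
  exact hC.image_of_continuousOn (hlog.mono hCpos)

/-- If the positive zero set of an n-variate m-nomial (n ≥ 2) with
m ≤ 2 + dim Supp(f) has a compact connected component, then it is a single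
point or ambient isotopic in ℝ^n_+ to a round (n−1)-sphere contained in
ℝ^n_+. -/
theorem compact_component_point_or_sphere
    (n m : ℕ) (hn : 2 ≤ n) (hm : 1 ≤ m)
    (a : Fin m → Fin n → ℤ) (hinj : Function.Injective a)
    (c : Fin m → ℝ) (hc : ∀ j, c j ≠ 0)
    (hdim : m ≤ 2 + Module.finrank ℝ (Submodule.span ℝ
      {v : Fin n → ℝ | ∃ j k : Fin m,
        v = (fun i => (a j i : ℝ)) - fun i => (a k i : ℝ)})) :
    ∀ Z : Set (Fin n → ℝ),
      Z = {x | (∀ i, 0 < x i) ∧ ∑ j, c j * ∏ i, (x i) ^ (a j i) = 0} →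
      (∃ x ∈ Z, IsCompact (connectedComponentIn Z x)) →
      ((∃ p : Fin n → ℝ, Z = {p}) ∨
        ∃ (p : Fin n → ℝ) (r : ℝ), 0 < r ∧
          {x : Fin n → ℝ | ∑ i, (x i - p i) ^ 2 = r ^ 2} ⊆ PosOrthant n ∧
          AmbientIsotopicIn (PosOrthant n) Z
            {x : Fin n → ℝ | ∑ i, (x i - p i) ^ 2 = r ^ 2}) := by
  rintro Z hZdef ⟨x, hxZ, hC⟩
  have hZpos : Z ⊆ PosOrthant n := fun z hz => by
    rw [hZdef, Set.mem_ofPred_eq] at hz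
    exact hz.1
  set A : Fin m → (Fin n → ℝ) →L[ℝ] ℝ := fun j => exponentFunctional (a j) with hA
  have hZlog : ∀ z : PosOrthant n, z.1 ∈ Z ↔ expSum c A (logHomeomorph n z) = 0 := by
    intro z
    rw [hZdef, Set.mem_ofPred_eq]
    simp only [expSum, hA, exp_exponentFunctional_log]
    exact and_iff_right z.2
  have hrank : Module.finrank ℝ (Fin n → ℝ) = n := Module.finrank_fin_fun ℝ
  have hcard : Fintype.card (Fin m) ≤ 2 + Module.finrank ℝ (Fin n → ℝ) := by
    rw [Fintype.card_fin]
    exact hdim.trans (Nat.add_le_add_left (Submodule.finrank_le _) 2)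
  have : Nonempty (Fin m) := ⟨⟨0, hm⟩⟩
  rcases subsingleton_or_radialSignChange_of_isCompact (hrank.symm ▸ hn) hcard hc
    ((hZlog ⟨x, hZpos hxZ⟩).1 hxZ) (isCompact_connectedComponentIn_log hZpos
      (W := {y | expSum c A y = 0}) hZlog (x₀ := ⟨x, hZpos hxZ⟩) hxZ hC) with
    h | ⟨h, y₀, hcont, hs, hzero⟩
  · refine Or.inl ⟨x, Set.eq_singleton_iff_unique_mem.2 ⟨hxZ, fun z hz => ?_⟩⟩
    exact congrArg Subtype.val ((logHomeomorph n).injective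
      (h ((hZlog ⟨z, hZpos hz⟩).1 hz) ((hZlog ⟨x, hZpos hxZ⟩).1 hxZ)))
  · exact Or.inr (ambientIsotopicIn_sphere (by omega) hcont hs
      fun z => (hZlog z).trans (hzero _))
end

section
/- Let f(x) = Σ_{j=1}^m c_j x^{a_j} be an n-variate m-nomial with nonzero real coefficients and distinct exponent vectors a_1, …, a_m ∈ ℤ^n, satisfying m ≤ 2 + dim Supp(f). Let N_non(f) denote the number of non-compact connected components of the zero set Z_+(f) of f in ℝ^n_+. Then N_non(f) ≤ 0 if n = 1, N_non(f) ≤ 2 if n = 2, N_non(f) ≤ 6 if n = 3, N_non(f) ≤ 9 if n = 4, and N_non(f) ≤ 2n + 2 if n ≥ 5. -/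
open Finset

/-- A set is covered by two preconnected pieces. -/
def IsUnionOfTwoPreconnected {X : Type*} [TopologicalSpace X] (S : Set X) : Prop :=
  ∃ A B : Set X, IsPreconnected A ∧ IsPreconnected B ∧ S = A ∪ B

namespace IsUnionOfTwoPreconnected

variable {X Y : Type*} [TopologicalSpace X] [TopologicalSpace Y]

theorem of_isPreconnected {S : Set X} (h : IsPreconnected S) : IsUnionOfTwoPreconnected S :=
  ⟨S, S, h, h, (Set.union_self S).symm⟩

theorem image {S : Set X} (h : IsUnionOfTwoPreconnected S) {f : X → Y} (hf : ContinuousOn f S) :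
    IsUnionOfTwoPreconnected (f '' S) := by
  obtain ⟨A, B, hA, hB, rfl⟩ := h
  exact ⟨f '' A, f '' B, hA.image f (hf.mono Set.subset_union_left),
    hB.image f (hf.mono Set.subset_union_right), Set.image_union f A B⟩

theorem prod {S : Set X} (h : IsUnionOfTwoPreconnected S) {K : Set Y} (hK : IsPreconnected K) :
    IsUnionOfTwoPreconnected (S ×ˢ K) := by
  obtain ⟨A, B, hA, hB, rfl⟩ := h
  exact ⟨A ×ˢ K, B ×ˢ K, hA.prod hK, hB.prod hK, Set.union_prod⟩

theorem exists_components_subset_pair {S : Set X} (h : IsUnionOfTwoPreconnected S) :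
    ∃ D E : Set X, {C | ∃ x ∈ S, C = connectedComponentIn S x} ⊆ {D, E} := by
  classical
  obtain ⟨A, B, hA, hB, rfl⟩ := h
  have key : ∀ A' : Set X, IsPreconnected A' → A' ⊆ A ∪ B →
      ∃ D : Set X, ∀ x ∈ A', connectedComponentIn (A ∪ B) x = D := by
    intro A' hA' hsub
    rcases A'.eq_empty_or_nonempty with rfl | ⟨y, hy⟩
    · exact ⟨∅, by simp⟩
    · exact ⟨connectedComponentIn (A ∪ B) y, fun x hx =>
        (connectedComponentIn_eq (hA'.subset_connectedComponentIn hy hsub hx)).symm⟩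
  obtain ⟨D, hD⟩ := key A hA Set.subset_union_left
  obtain ⟨E, hE⟩ := key B hB Set.subset_union_right
  refine ⟨D, E, ?_⟩
  rintro C ⟨x, hx | hx, rfl⟩
  · exact Or.inl (hD x hx)
  · exact Or.inr (hE x hx)

end IsUnionOfTwoPreconnected

/-- Roots of a family of strictly increasing functions depend continuously on the parameter. -/
theorem continuousOn_root_of_strictMono {X : Type*} [TopologicalSpace X] {S : Set X}
    {F : X → ℝ → ℝ} {τ : X → ℝ} (hmono : ∀ x ∈ S, StrictMono (F x))
    (hcont : ∀ t, ContinuousOn (fun x => F x t) S) (hroot : ∀ x ∈ S, F x (τ x) = 0) :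
    ContinuousOn τ S := by
  intro x hx
  refine tendsto_order.2 ⟨fun t ht => ?_, fun t ht => ?_⟩
  · have h : F x t < 0 := by rw [← hroot x hx]; exact hmono x hx ht
    filter_upwards [(hcont t x hx).eventually_lt_const h, self_mem_nhdsWithin] with y hy hyS
    rw [← hroot y hyS] at hy
    exact (hmono y hyS).lt_iff_lt.1 hy
  · have h : 0 < F x t := by rw [← hroot x hx]; exact hmono x hx ht
    filter_upwards [(hcont t x hx).eventually_const_lt h, self_mem_nhdsWithin] with y hy hyS
    rw [← hroot y hyS] at hy
    exact (hmono y hyS).lt_iff_lt.1 hy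

/-- Lexicographic positivity of the coordinates indexed by `N`. -/
def LexPos {m : ℕ} (N : Finset (Fin m)) (w : Fin m → ℝ) : Prop :=
  ∃ i ∈ N, (∀ j ∈ N, j < i → w j = 0) ∧ 0 < w i

theorem convex_setOf_lexPos {m : ℕ} (N : Finset (Fin m)) : Convex ℝ {w | LexPos N w} := by
  rw [convex_iff_forall_pos]
  rintro u ⟨i, hi, hi0, hui⟩ v ⟨k, hk, hk0, hvk⟩ p q hp hq -
  rcases lt_trichotomy i k with h | h | h
  · refine ⟨i, hi, fun j hj hji => ?_, ?_⟩
    · simp [hi0 j hj hji, hk0 j hj (hji.trans h)]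
    · simp [hk0 i hi h]; positivity
  · subst h
    refine ⟨i, hi, fun j hj hji => ?_, ?_⟩
    · simp [hi0 j hj hji, hk0 j hj hji]
    · simp; positivity
  · refine ⟨k, hk, fun j hj hji => ?_, ?_⟩
    · simp [hi0 j hj (hji.trans h), hk0 j hj hji]
    · simp [hi0 k hk h]; positivity

theorem lexPos_or_lexPos_neg {m : ℕ} {N : Finset (Fin m)} {w : Fin m → ℝ}
    (h : ∃ j ∈ N, w j ≠ 0) : LexPos N w ∨ LexPos N (-w) := by
  have hne : (N.filter fun j => w j ≠ 0).Nonempty := by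
    obtain ⟨j, hj, hw⟩ := h
    exact ⟨j, by simp [hj, hw]⟩
  have hmem := Finset.min'_mem _ hne
  set i := (N.filter fun j => w j ≠ 0).min' hne
  rw [Finset.mem_filter] at hmem
  have hmin : ∀ j ∈ N, j < i → w j = 0 := by
    intro j hj hji
    by_contra hw
    exact absurd (Finset.min'_le _ j (by simp [hj, hw])) (not_le.2 hji)
  rcases lt_or_gt_of_ne hmem.2 with hlt | hgt
  · exact Or.inr ⟨i, hmem.1, fun j hj hji => by simp [hmin j hj hji], by simpa using hlt⟩
  · exact Or.inl ⟨i, hmem.1, hmin, hgt⟩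

theorem LexPos.exists_ne_zero {m : ℕ} {N : Finset (Fin m)} {w : Fin m → ℝ}
    (h : LexPos N w) : ∃ j ∈ N, w j ≠ 0 := by
  obtain ⟨i, hi, -, h⟩ := h
  exact ⟨i, hi, h.ne'⟩

/-- The exponential term `g * exp x`, replaced by the identity when the weight vanishes. -/
noncomputable def weightedTerm (g x : ℝ) : ℝ := if g = 0 then x else g * Real.exp x

theorem continuous_weightedTerm (g : ℝ) : Continuous (weightedTerm g) := by
  unfold weightedTerm
  split_ifs
  · exact continuous_id
  · fun_prop

theorem weightedTerm_zero_right (g : ℝ) : weightedTerm g 0 = g := by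
  unfold weightedTerm
  split_ifs with h <;> simp [h]

theorem weightedTerm_pos {g x : ℝ} (hg : 0 ≤ g) (hx : g = 0 → 0 < x) : 0 < weightedTerm g x := by
  unfold weightedTerm
  split_ifs with h
  · exact hx h
  · have := lt_of_le_of_ne hg (Ne.symm h)
    positivity

theorem lt_exp_mul_sub_exp_mul {s t x : ℝ} (hs : 0 ≤ s) (hst : s < t) (hx : x ≠ 0) :
    (t - s) * x < Real.exp (t * x) - Real.exp (s * x) := by
  have hd : (t - s) * x ≠ 0 := mul_ne_zero (sub_pos.2 hst).ne' hx
  have h1 := Real.add_one_lt_exp hd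
  have h2 : Real.exp (t * x) = Real.exp (s * x) * Real.exp ((t - s) * x) := by
    rw [← Real.exp_add]; congr 1; ring
  have h3 : 0 ≤ (Real.exp (s * x) - 1) * ((t - s) * x) := by
    rcases lt_or_gt_of_ne hx with h | h
    · apply mul_nonneg_of_nonpos_of_nonpos
      · have : Real.exp (s * x) ≤ 1 := Real.exp_le_one_iff.2 (by nlinarith)
        linarith
      · nlinarith
    · apply mul_nonneg
      · have : 1 ≤ Real.exp (s * x) := Real.one_le_exp (by positivity)
        linarith
      · nlinarith
  rw [h2]
  nlinarith [Real.exp_pos (s * x)]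

theorem lt_weightedTerm_sub_weightedTerm {g s t x : ℝ} (hg : 0 ≤ g) (hx : g = 0 → 0 < x)
    (hs : 0 ≤ s) (hst : s < t) (hx0 : x ≠ 0) :
    (t - s) * (g * x) < weightedTerm g (t * x) - weightedTerm g (s * x) := by
  unfold weightedTerm
  split_ifs with h
  · have := hx h
    subst h
    nlinarith
  · have hg' := lt_of_le_of_ne hg (Ne.symm h)
    nlinarith [lt_exp_mul_sub_exp_mul hs hst hx0]

theorem le_weightedTerm_sub_weightedTerm {g s t x : ℝ} (hg : 0 ≤ g) (hx : g = 0 → 0 < x)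
    (hs : 0 ≤ s) (hst : s < t) :
    (t - s) * (g * x) ≤ weightedTerm g (t * x) - weightedTerm g (s * x) := by
  rcases eq_or_ne x 0 with rfl | h
  · simp
  · exact (lt_weightedTerm_sub_weightedTerm hg hx hs hst h).le

section Sums

variable {ι : Type*} {N : Finset ι} {g w : ι → ℝ}

theorem sum_weightedTerm_lt (hg : ∀ j, 0 ≤ g j) (hN : ∑ j ∈ N, g j * w j = 0)
    (hw : ∀ j, g j = 0 → 0 < w j) (hne : ∃ j ∈ N, w j ≠ 0) {s t : ℝ} (hs : 0 ≤ s) (hst : s < t) :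
    ∑ j ∈ N, weightedTerm (g j) (s * w j) < ∑ j ∈ N, weightedTerm (g j) (t * w j) := by
  obtain ⟨i, hi, hwi⟩ := hne
  have := Finset.sum_lt_sum
    (fun j _ => le_weightedTerm_sub_weightedTerm (hg j) (hw j) hs hst)
    ⟨i, hi, lt_weightedTerm_sub_weightedTerm (hg i) (hw i) hs hst hwi⟩
  rw [← Finset.mul_sum, hN, Finset.sum_sub_distrib] at this
  linarith

theorem sum_lt_sum_weightedTerm (hg : ∀ j, 0 ≤ g j) (hN : ∑ j ∈ N, g j * w j = 0)
    (hw : ∀ j, g j = 0 → 0 < w j) (hne : ∃ j ∈ N, w j ≠ 0) :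
    ∑ j ∈ N, g j < ∑ j ∈ N, weightedTerm (g j) (w j) := by
  simpa [weightedTerm_zero_right] using sum_weightedTerm_lt hg hN hw hne le_rfl zero_lt_one

theorem sum_le_sum_weightedTerm (hg : ∀ j, 0 ≤ g j) (hN : ∑ j ∈ N, g j * w j = 0)
    (hw : ∀ j, g j = 0 → 0 < w j) :
    ∑ j ∈ N, g j ≤ ∑ j ∈ N, weightedTerm (g j) (w j) := by
  by_cases hne : ∃ j ∈ N, w j ≠ 0
  · exact (sum_lt_sum_weightedTerm hg hN hw hne).le
  · push Not at hne
    refine (Finset.sum_congr rfl fun j hj => ?_).le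
    rw [hne j hj, weightedTerm_zero_right]

theorem exists_pos_of_sum_mul_eq_zero (hg : ∀ j, 0 ≤ g j) (hN : ∑ j ∈ N, g j * w j = 0)
    (hw : ∀ j, g j = 0 → 0 < w j) (hne : ∃ j ∈ N, w j ≠ 0) : ∃ j ∈ N, 0 < w j := by
  by_contra! hcon
  obtain ⟨i, hi, hwi⟩ := hne
  have h0 := (Finset.sum_eq_zero_iff_of_nonpos
    (fun j hj => mul_nonpos_of_nonneg_of_nonpos (hg j) (hcon j hj))).1 hN i hi
  rcases mul_eq_zero.1 h0 with h | h
  · exact absurd (hw i h) (not_lt.2 (hcon i hi))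
  · exact hwi h

theorem exists_sum_weightedTerm_eq (hg : ∀ j, 0 ≤ g j) (hN : ∑ j ∈ N, g j * w j = 0)
    (hw : ∀ j, g j = 0 → 0 < w j) (hne : ∃ j ∈ N, w j ≠ 0) {r : ℝ} (hr : ∑ j ∈ N, g j ≤ r) :
    ∃ t, 0 ≤ t ∧ ∑ j ∈ N, weightedTerm (g j) (t * w j) = r := by
  obtain ⟨i, hi, hwi⟩ := exists_pos_of_sum_mul_eq_zero hg hN hw hne
  set k : ℝ := (if g i = 0 then 1 else g i) * w i with hk
  have hkpos : 0 < k := by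
    rw [hk]
    split_ifs with h
    · simpa using hwi
    · exact mul_pos (lt_of_le_of_ne (hg i) (Ne.symm h)) hwi
  have hr0 : 0 ≤ r := (Finset.sum_nonneg fun j _ => hg j).trans hr
  have hR : 0 ≤ r / k := by positivity
  have hterm : ∀ j, 0 ≤ weightedTerm (g j) (r / k * w j) := by
    intro j
    unfold weightedTerm
    split_ifs with h
    · have := hw j h
      positivity
    · have := hg j
      positivity
  have hbig : r ≤ ∑ j ∈ N, weightedTerm (g j) (r / k * w j) := by
    refine le_trans ?_ (Finset.single_le_sum (fun j _ => hterm j) hi)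
    have hrk : r = r / k * k := by field_simp
    unfold weightedTerm
    split_ifs with h
    · rw [if_pos h] at hk
      nth_rewrite 1 [hrk]
      rw [hk]; simp
    · rw [if_neg h] at hk
      nth_rewrite 1 [hrk]
      have := Real.add_one_le_exp (r / k * w i)
      have hgi := hg i
      calc r / k * k = g i * (r / k * w i) := by rw [hk]; ring
        _ ≤ _ := by gcongr; linarith
  have hcont : ContinuousOn (fun t : ℝ => ∑ j ∈ N, weightedTerm (g j) (t * w j))
      (Set.Icc 0 (r / k)) := by
    refine Continuous.continuousOn (continuous_finsetSum _ fun j _ => ?_)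
    exact (continuous_weightedTerm (g j)).comp (by fun_prop)
  obtain ⟨t, ht, hteq⟩ := intermediate_value_Icc hR hcont
    (show r ∈ Set.Icc _ _ from ⟨by simpa [weightedTerm_zero_right] using hr, hbig⟩)
  exact ⟨t, ht.1, hteq⟩

end Sums

/-- Coordinates for which the `P`-part and the `N`-part are separately balanced and the
coordinates of zero weight are positive. -/
def balancedCone {m : ℕ} (P N : Finset (Fin m)) (g : Fin m → ℝ) : Set (Fin m → ℝ) :=
  {w | ∑ j ∈ P, g j * w j = 0 ∧ ∑ j ∈ N, g j * w j = 0 ∧ ∀ j, g j = 0 → 0 < w j}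

theorem convex_balancedCone {m : ℕ} (P N : Finset (Fin m)) (g : Fin m → ℝ) :
    Convex ℝ (balancedCone P N g) := by
  have hlin : ∀ Q : Finset (Fin m), ∀ u v : Fin m → ℝ, ∀ p q : ℝ,
      ∑ j ∈ Q, g j * (p • u + q • v) j =
        p * ∑ j ∈ Q, g j * u j + q * ∑ j ∈ Q, g j * v j := by
    intro Q u v p q
    rw [Finset.mul_sum, Finset.mul_sum, ← Finset.sum_add_distrib]
    refine Finset.sum_congr rfl fun j _ => ?_
    simp; ring
  rw [convex_iff_forall_pos]
  rintro u ⟨hu1, hu2, hu3⟩ v ⟨hv1, hv2, hv3⟩ p q hp hq -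
  refine ⟨by rw [hlin, hu1, hv1]; simp, by rw [hlin, hu2, hv2]; simp, fun j hj => ?_⟩
  have := hu3 j hj
  have := hv3 j hj
  simp
  positivity

/-- The part of the balanced cone on which the two sums of weighted terms agree. -/
def balancedLevelSet {m : ℕ} (P N : Finset (Fin m)) (g : Fin m → ℝ) : Set (Fin m → ℝ) :=
  {w ∈ balancedCone P N g |
    ∑ j ∈ P, weightedTerm (g j) (w j) = ∑ j ∈ N, weightedTerm (g j) (w j)}

theorem balancedLevelSet_comm {m : ℕ} (P N : Finset (Fin m)) (g : Fin m → ℝ) :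
    balancedLevelSet P N g = balancedLevelSet N P g := by
  ext w
  simp only [balancedLevelSet, balancedCone, Set.mem_ofPred_eq]
  constructor <;> rintro ⟨⟨h1, h2, h3⟩, h4⟩ <;> exact ⟨⟨h2, h1, h3⟩, h4.symm⟩

/-- Multiply the coordinates in `N` by `t`. -/
def scaleOn {m : ℕ} (N : Finset (Fin m)) (t : ℝ) (w : Fin m → ℝ) : Fin m → ℝ :=
  fun j => if j ∈ N then t * w j else w j

theorem isUnionOfTwoPreconnected_balancedLevelSet_of_le {m : ℕ} {P N : Finset (Fin m)}
    {g : Fin m → ℝ} (hdisj : Disjoint P N) (hcover : ∀ j, j ∈ P ∨ j ∈ N) (hg : ∀ j, 0 ≤ g j)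
    (hle : ∑ j ∈ N, g j ≤ ∑ j ∈ P, g j)
    (hlt : ∑ j ∈ N, g j < ∑ j ∈ P, g j ∨ (∃ j ∈ P, g j = 0) ∨ ∀ j ∈ N, g j ≠ 0) :
    IsUnionOfTwoPreconnected (balancedLevelSet P N g) := by
  classical
  have hnotP : ∀ j ∈ P, j ∉ N := fun j hj => Finset.disjoint_left.1 hdisj hj
  by_cases hex : ∃ u ∈ balancedCone P N g, ∃ j ∈ N, u j ≠ 0
  swap
  · push Not at hex
    refine .of_isPreconnected (Set.Subsingleton.isPreconnected ?_)
    suffices h : ∀ w ∈ balancedLevelSet P N g, w = 0 from fun u hu v hv => by rw [h u hu, h v hv]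
    rintro w ⟨hw, heq⟩
    have hwN := hex w hw
    have hsumN : ∑ j ∈ N, weightedTerm (g j) (w j) = ∑ j ∈ N, g j :=
      Finset.sum_congr rfl fun j hj => by rw [hwN j hj, weightedTerm_zero_right]
    ext j
    rcases hcover j with hj | hj
    · by_contra hne
      have := sum_lt_sum_weightedTerm hg hw.1 hw.2.2 ⟨j, hj, hne⟩
      linarith
    · exact hwN j hj
  set C₀ : Set (Fin m → ℝ) := {w ∈ balancedCone P N g | ∃ j ∈ N, w j ≠ 0} with hC₀
  have hroot : ∀ w ∈ C₀, ∃ t, 0 ≤ t ∧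
      ∑ j ∈ N, weightedTerm (g j) (t * w j) = ∑ j ∈ P, weightedTerm (g j) (w j) := by
    rintro w ⟨hw, hne⟩
    exact exists_sum_weightedTerm_eq hg hw.2.1 hw.2.2 hne
      (hle.trans (sum_le_sum_weightedTerm hg hw.1 hw.2.2))
  choose! τ hτ0 hτ using hroot
  set F : (Fin m → ℝ) → ℝ → ℝ := fun w t =>
    ∑ j ∈ N, weightedTerm (g j) (max t 0 * w j) + min t 0 - ∑ j ∈ P, weightedTerm (g j) (w j)
    with hF
  have hmono : ∀ w ∈ C₀, StrictMono (F w) := by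
    rintro w ⟨hw, hne⟩ s t hst
    have key := fun {s t : ℝ} => @sum_weightedTerm_lt _ N g w hg hw.2.1 hw.2.2 hne s t
    simp only [hF]
    rcases le_or_gt 0 s with hs | hs
    · rw [max_eq_left hs, max_eq_left (hs.trans hst.le), min_eq_right hs,
        min_eq_right (hs.trans hst.le)]
      linarith [key hs hst]
    · rw [max_eq_right hs.le, min_eq_left hs.le]
      rcases le_or_gt t 0 with ht | ht
      · rw [max_eq_right ht, min_eq_left ht]
        linarith
      · rw [max_eq_left ht.le, min_eq_right ht.le]
        linarith [key le_rfl ht]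
  have hτcont : ContinuousOn τ C₀ := by
    refine continuousOn_root_of_strictMono hmono (fun t => Continuous.continuousOn ?_) ?_
    · refine ((continuous_finsetSum _ fun j _ => ?_).add continuous_const).sub
        (continuous_finsetSum _ fun j _ => ?_)
      · exact (continuous_weightedTerm (g j)).comp (by fun_prop)
      · exact (continuous_weightedTerm (g j)).comp (by fun_prop)
    · intro w hw
      simp only [hF]
      rw [max_eq_left (hτ0 w hw), min_eq_right (hτ0 w hw), hτ w hw]
      ring
  have hscaleP : ∀ t w, ∀ j ∈ P, scaleOn N t w j = w j := fun t w j hj => if_neg (hnotP j hj)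
  have hscaleN : ∀ t w, ∀ j ∈ N, scaleOn N t w j = t * w j := fun t w j hj => if_pos hj
  have himage : balancedLevelSet P N g = (fun w => scaleOn N (τ w) w) '' C₀ := by
    ext w
    constructor
    · rintro ⟨hw, heq⟩
      by_cases hne : ∃ j ∈ N, w j ≠ 0
      · have hwC : w ∈ C₀ := ⟨hw, hne⟩
        refine ⟨w, hwC, ?_⟩
        have h1 : τ w = 1 := by
          apply (hmono w hwC).injective
          simp only [hF]
          rw [max_eq_left (hτ0 w hwC), min_eq_right (hτ0 w hwC), hτ w hwC]
          simp [heq]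
        ext j
        simp [scaleOn, h1]
      · push Not at hne
        obtain ⟨u, hu, hune⟩ := hex
        set v : Fin m → ℝ := fun j => if j ∈ N then u j else w j with hv
        have hvN : ∀ j ∈ N, v j = u j := fun j hj => if_pos hj
        have hvP : ∀ j ∈ P, v j = w j := fun j hj => if_neg (hnotP j hj)
        have hvC : v ∈ C₀ := by
          refine ⟨⟨?_, ?_, fun j hj => ?_⟩, ?_⟩
          · rw [← hw.1]
            exact Finset.sum_congr rfl fun j hj => by rw [hvP j hj]
          · rw [← hu.2.1]
            exact Finset.sum_congr rfl fun j hj => by rw [hvN j hj]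
          · rcases hcover j with h | h
            · rw [hvP j h]; exact hw.2.2 j hj
            · rw [hvN j h]; exact hu.2.2 j hj
          · obtain ⟨j, hj, hju⟩ := hune
            exact ⟨j, hj, by rwa [hvN j hj]⟩
        refine ⟨v, hvC, ?_⟩
        have h0 : τ v = 0 := by
          apply (hmono v hvC).injective
          simp only [hF]
          rw [max_eq_left (hτ0 v hvC), min_eq_right (hτ0 v hvC), hτ v hvC]
          have e1 : ∑ j ∈ P, weightedTerm (g j) (v j) = ∑ j ∈ P, weightedTerm (g j) (w j) :=
            Finset.sum_congr rfl fun j hj => by rw [hvP j hj]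
          have e2 : ∑ j ∈ N, weightedTerm (g j) (max 0 0 * v j) =
              ∑ j ∈ N, weightedTerm (g j) (w j) :=
            Finset.sum_congr rfl fun j hj => by rw [hne j hj]; simp
          rw [e1, e2, heq]
          simp
        ext j
        rcases hcover j with hj | hj
        · change scaleOn N (τ v) v j = w j
          rw [hscaleP _ _ j hj, hvP j hj]
        · change scaleOn N (τ v) v j = w j
          rw [hscaleN _ _ j hj, h0, hne j hj, zero_mul]
    · rintro ⟨u, hu, rfl⟩
      obtain ⟨huC, hune⟩ := hu
      have hu : u ∈ C₀ := ⟨huC, hune⟩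
      change scaleOn N (τ u) u ∈ balancedLevelSet P N g
      refine ⟨⟨?_, ?_, fun j hj => ?_⟩, ?_⟩
      · rw [← huC.1]
        exact Finset.sum_congr rfl fun j hj => by rw [hscaleP _ _ j hj]
      · rw [← mul_zero (τ u), ← huC.2.1, Finset.mul_sum]
        refine Finset.sum_congr rfl fun j hj => ?_
        rw [hscaleN _ _ j hj]; ring
      · rcases hcover j with h | h
        · rw [hscaleP _ _ j h]; exact huC.2.2 j hj
        · rw [hscaleN _ _ j h]
          refine mul_pos (lt_of_le_of_ne (hτ0 u hu) fun hz => ?_) (huC.2.2 j hj)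
          have hroot := hτ u hu
          rw [← hz] at hroot
          simp only [zero_mul, weightedTerm_zero_right] at hroot
          have hPle := sum_le_sum_weightedTerm hg huC.1 huC.2.2
          rcases hlt with hlt | ⟨i, hi, hgi⟩ | hlt
          · linarith
          · have := sum_lt_sum_weightedTerm hg huC.1 huC.2.2 ⟨i, hi, (huC.2.2 i hgi).ne'⟩
            linarith
          · exact hlt j h hj
      · rw [Finset.sum_congr rfl fun j hj => by rw [hscaleP (τ u) u j hj], ← hτ u hu]
        exact Finset.sum_congr rfl fun j hj => by rw [hscaleN _ _ j hj]
  have hC₀two : IsUnionOfTwoPreconnected C₀ := by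
    have hconv := convex_balancedCone P N g
    refine ⟨balancedCone P N g ∩ {w | LexPos N w}, balancedCone P N g ∩ {w | LexPos N (-w)},
      (hconv.inter (convex_setOf_lexPos N)).isPreconnected,
      (hconv.inter ((convex_setOf_lexPos N).linear_preimage (-LinearMap.id))).isPreconnected, ?_⟩
    ext w
    constructor
    · rintro ⟨hw, hne⟩
      exact (lexPos_or_lexPos_neg hne).imp (⟨hw, ·⟩) (⟨hw, ·⟩)
    · rintro (⟨hw, h⟩ | ⟨hw, h⟩)
      · exact ⟨hw, h.exists_ne_zero⟩
      · exact ⟨hw, by simpa using LexPos.exists_ne_zero h⟩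
  rw [himage]
  refine hC₀two.image (continuousOn_pi.2 fun j => ?_)
  unfold scaleOn
  split_ifs
  · exact hτcont.mul (by fun_prop)
  · fun_prop

theorem isUnionOfTwoPreconnected_balancedLevelSet {m : ℕ} {P N : Finset (Fin m)}
    {g : Fin m → ℝ} (hdisj : Disjoint P N) (hcover : ∀ j, j ∈ P ∨ j ∈ N) (hg : ∀ j, 0 ≤ g j) :
    IsUnionOfTwoPreconnected (balancedLevelSet P N g) := by
  rcases lt_trichotomy (∑ j ∈ N, g j) (∑ j ∈ P, g j) with h | h | h
  · exact isUnionOfTwoPreconnected_balancedLevelSet_of_le hdisj hcover hg h.le (Or.inl h)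
  · by_cases hP : ∃ j ∈ P, g j = 0
    · exact isUnionOfTwoPreconnected_balancedLevelSet_of_le hdisj hcover hg h.le
        (Or.inr (Or.inl hP))
    · push Not at hP
      rw [balancedLevelSet_comm]
      exact isUnionOfTwoPreconnected_balancedLevelSet_of_le hdisj.symm
        (fun j => (hcover j).symm) hg h.ge (Or.inr (Or.inr hP))
  · rw [balancedLevelSet_comm]
    exact isUnionOfTwoPreconnected_balancedLevelSet_of_le hdisj.symm
      (fun j => (hcover j).symm) hg h.le (Or.inl h)

/-- If two coefficients of equal sign carry weights of opposite sign, the corresponding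
exponential hypersurface is connected. -/
theorem isPreconnected_of_opposite_weights {m : ℕ} {b c : Fin m → ℝ} {i k : Fin m}
    (hbi : 0 < b i) (hbk : b k < 0) (hci : 0 < c i) (hck : 0 < c k) :
    IsPreconnected {z : Fin m → ℝ | ∑ j, b j * z j = 0 ∧ ∑ j, c j * Real.exp (z j) = 0} := by
  classical
  have hik : i ≠ k := by rintro rfl; linarith
  set O : Finset (Fin m) := (univ.erase i).erase k with hO
  have hsplit : ∀ f : Fin m → ℝ, ∑ j, f j = f i + f k + ∑ j ∈ O, f j := by
    intro f
    rw [← Finset.add_sum_erase univ f (mem_univ i),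
      ← Finset.add_sum_erase (univ.erase i) f (mem_erase.2 ⟨hik.symm, mem_univ k⟩), add_assoc]
  have hOi : ∀ j ∈ O, j ≠ i := fun j hj => (mem_erase.1 (mem_erase.1 hj).2).1
  have hOk : ∀ j ∈ O, j ≠ k := fun j hj => (mem_erase.1 hj).1
  set Q : Set (Fin m → ℝ) := {s | (∀ j, 0 < s j) ∧ ∑ j ∈ O, c j * s j < 0} with hQ
  have hQconv : Convex ℝ Q := by
    rw [convex_iff_forall_pos]
    rintro u ⟨hu1, hu2⟩ v ⟨hv1, hv2⟩ p q hp hq -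
    refine ⟨fun j => ?_, ?_⟩
    · have := hu1 j
      have := hv1 j
      simp only [Pi.add_apply, Pi.smul_apply, smul_eq_mul]
      positivity
    · have : ∑ j ∈ O, c j * (p • u + q • v) j =
          p * ∑ j ∈ O, c j * u j + q * ∑ j ∈ O, c j * v j := by
        rw [Finset.mul_sum, Finset.mul_sum, ← Finset.sum_add_distrib]
        refine Finset.sum_congr rfl fun j _ => ?_
        simp only [Pi.add_apply, Pi.smul_apply, smul_eq_mul]
        ring
      rw [this]
      nlinarith
  set α : (Fin m → ℝ) → ℝ := fun s => -(∑ j ∈ O, b j * Real.log (s j)) / b i with hα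
  set F : (Fin m → ℝ) → ℝ → ℝ := fun s t =>
    c i * Real.exp (α s - b k * t) + c k * Real.exp (b i * t) + ∑ j ∈ O, c j * s j with hF
  have hmono : ∀ s, StrictMono (F s) := by
    intro s t t' htt
    have h1 : Real.exp (α s - b k * t) < Real.exp (α s - b k * t') :=
      Real.exp_lt_exp.2 (by nlinarith)
    have h2 : Real.exp (b i * t) < Real.exp (b i * t') := Real.exp_lt_exp.2 (by nlinarith)
    simp only [hF]
    nlinarith
  have hroot : ∀ s ∈ Q, ∃ t, F s t = 0 := by
    rintro s ⟨-, hs⟩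
    have hcont : Continuous (F s) := by simp only [hF]; fun_prop
    have hbot : Filter.Tendsto (F s) Filter.atBot (nhds (c i * 0 + c k * 0 + ∑ j ∈ O, c j * s j)) := by
      refine Filter.Tendsto.add_const _ (Filter.Tendsto.add (Filter.Tendsto.const_mul _ ?_)
        (Filter.Tendsto.const_mul _ ?_))
      · refine Real.tendsto_exp_atBot.comp ?_
        simp only [sub_eq_add_neg, ← neg_mul]
        exact Filter.tendsto_atBot_add_const_left _ _
          (Filter.tendsto_id.const_mul_atBot (neg_pos.2 hbk))
      · exact Real.tendsto_exp_atBot.comp (Filter.tendsto_id.const_mul_atBot hbi)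
    have htop : Filter.Tendsto (F s) Filter.atTop Filter.atTop := by
      refine Filter.tendsto_atTop_add_const_right _ _
        (Filter.tendsto_atTop_mono (fun t => le_add_of_nonneg_left (by positivity))
          ((Real.tendsto_exp_atTop.comp (Filter.tendsto_id.const_mul_atTop hbi)).const_mul_atTop
            hck))
    have h1 : ∃ t, F s t ≤ 0 :=
      (hbot.eventually_lt_const (by simpa using hs)).exists.imp fun _ h => h.le
    have h2 : ∃ t, 0 ≤ F s t := (htop.eventually_ge_atTop 0).exists
    exact mem_range_of_exists_le_of_exists_ge hcont h1 h2
  choose! τ hτ using hroot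
  have hlog : ∀ j, ContinuousOn (fun s : Fin m → ℝ => Real.log (s j)) Q := fun j =>
    ContinuousOn.log (by fun_prop) fun s hs => (hs.1 j).ne'
  have hαcont : ContinuousOn α Q := by
    simp only [hα]
    exact ((continuousOn_finsetSum _ fun j _ => continuousOn_const.mul (hlog j)).neg).div_const _
  have hτcont : ContinuousOn τ Q := by
    refine continuousOn_root_of_strictMono (fun s _ => hmono s) (fun t => ?_) hτ
    simp only [hF]
    refine ((continuousOn_const.mul ?_).add continuousOn_const).add ?_
    · exact Real.continuous_exp.comp_continuousOn (hαcont.sub continuousOn_const)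
    · fun_prop
  set Z : (Fin m → ℝ) → Fin m → ℝ := fun s j =>
    if j = i then α s - b k * τ s else if j = k then b i * τ s else Real.log (s j) with hZ
  have hZi : ∀ s, Z s i = α s - b k * τ s := fun s => by simp [hZ]
  have hZk : ∀ s, Z s k = b i * τ s := fun s => by simp [hZ, hik.symm]
  have hZO : ∀ s, ∀ j ∈ O, Z s j = Real.log (s j) := fun s j hj => by
    simp [hZ, hOi j hj, hOk j hj]
  have hZcont : ContinuousOn Z Q := by
    refine continuousOn_pi.2 fun j => ?_
    simp only [hZ]
    split_ifs
    · exact hαcont.sub (continuousOn_const.mul hτcont)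
    · exact continuousOn_const.mul hτcont
    · exact hlog j
  have himage : {z : Fin m → ℝ | ∑ j, b j * z j = 0 ∧ ∑ j, c j * Real.exp (z j) = 0} = Z '' Q := by
    ext z
    constructor
    · rintro ⟨h1, h2⟩
      rw [hsplit] at h1 h2
      set s : Fin m → ℝ := fun j => Real.exp (z j) with hs
      have hsQ : s ∈ Q := by
        refine ⟨fun j => Real.exp_pos _, ?_⟩
        have := mul_pos hci (Real.exp_pos (z i))
        have := mul_pos hck (Real.exp_pos (z k))
        simp only [hs]
        linarith
      have hαs : α s = z i + b k / b i * z k := by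
        simp only [hα, hs, Real.log_exp]
        field_simp
        linarith
      have hτs : τ s = z k / b i := by
        apply (hmono s).injective
        rw [hτ s hsQ]
        simp only [hF]
        rw [hαs, ← h2]
        simp only [hs]
        congr 3 <;> congr 1 <;> field_simp
        ring
      refine ⟨s, hsQ, ?_⟩
      ext j
      by_cases hji : j = i
      · subst hji
        rw [hZi, hαs, hτs]
        field_simp
        ring
      by_cases hjk : j = k
      · subst hjk
        rw [hZk, hτs]
        field_simp
      · rw [hZO s j (by simp [hO, hji, hjk])]
        simp [hs]
    · rintro ⟨s, hs, rfl⟩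
      refine ⟨?_, ?_⟩
      · rw [hsplit, hZi, hZk, Finset.sum_congr rfl fun j hj => by rw [hZO s j hj]]
        simp only [hα]
        field_simp
        ring
      · rw [hsplit, hZi, hZk, ← hτ s hs]
        simp only [hF]
        congr 1
        exact Finset.sum_congr rfl fun j hj => by rw [hZO s j hj, Real.exp_log (hs.1 j)]
  rw [himage]
  exact hQconv.isPreconnected.image Z hZcont

theorem isUnionOfTwoPreconnected_of_mul_nonneg {m : ℕ} {b c : Fin m → ℝ} (hb : ∑ j, b j = 0)
    (hc : ∀ j, c j ≠ 0) (hbc : ∀ j, 0 ≤ c j * b j) :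
    IsUnionOfTwoPreconnected
      {z : Fin m → ℝ | ∑ j, b j * z j = 0 ∧ ∑ j, c j * Real.exp (z j) = 0} := by
  classical
  set P : Finset (Fin m) := univ.filter fun j => 0 < c j with hP
  set N : Finset (Fin m) := univ.filter fun j => ¬ 0 < c j with hN
  have hsplit : ∀ f : Fin m → ℝ, ∑ j, f j = ∑ j ∈ P, f j + ∑ j ∈ N, f j := fun f =>
    (Finset.sum_filter_add_sum_filter_not univ (fun j => 0 < c j) f).symm
  have hcP : ∀ j ∈ P, 0 < c j := fun j hj => (mem_filter.1 hj).2
  have hcN : ∀ j ∈ N, c j < 0 := fun j hj =>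
    lt_of_le_of_ne (not_lt.1 (mem_filter.1 hj).2) (hc j)
  have hbP : ∀ j ∈ P, 0 ≤ b j := fun j hj => nonneg_of_mul_nonneg_right (hbc j) (hcP j hj)
  have hbN : ∀ j ∈ N, b j ≤ 0 := fun j hj => by
    by_contra! h
    nlinarith [hbc j, hcN j hj]
  set B : ℝ := ∑ j ∈ P, b j with hB
  have hBN : ∑ j ∈ N, b j = -B := by
    have := hsplit b
    rw [hb] at this
    linarith
  have hB0 : B = 0 → ∀ j, b j = 0 := by
    intro h j
    by_cases hj : 0 < c j
    · exact (Finset.sum_eq_zero_iff_of_nonneg hbP).1 h j (by simp [hP, hj])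
    · exact (Finset.sum_eq_zero_iff_of_nonpos hbN).1 (by rw [hBN, h, neg_zero]) j
        (by simp [hN] at hj ⊢; exact hj)
  set p : ℝ := Real.exp (-(∑ j, b j * Real.log (|b j| / |c j|)) / B) with hp
  have hppos : 0 < p := Real.exp_pos _
  set g : Fin m → ℝ := fun j => if 0 < c j then p * |b j| else |b j| with hg
  have hgP : ∀ j ∈ P, g j = p * b j := fun j hj => by
    simp [hg, hcP j hj, abs_of_nonneg (hbP j hj)]
  have hgN : ∀ j ∈ N, g j = -b j := fun j hj => by
    simp [hg, not_lt.2 (hcN j hj).le, abs_of_nonpos (hbN j hj)]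
  have hg0 : ∀ j, 0 ≤ g j := fun j => by simp only [hg]; split_ifs <;> positivity
  have hgb : ∀ j, g j = 0 ↔ b j = 0 := fun j => by
    simp only [hg]; split_ifs <;> simp [hppos.ne']
  have hsum : ∑ j, b j * Real.log (g j / |c j|) = 0 := by
    by_cases hBz : B = 0
    · exact Finset.sum_eq_zero fun j _ => by rw [hB0 hBz j, zero_mul]
    have h1 : ∀ j, b j * Real.log (g j / |c j|) =
        b j * Real.log (|b j| / |c j|) + if 0 < c j then b j * Real.log p else 0 := by
      intro j
      by_cases hbj : b j = 0
      · simp [hbj]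
      simp only [hg]
      split_ifs with h
      · rw [mul_div_assoc, Real.log_mul hppos.ne'
          (div_ne_zero (abs_ne_zero.2 hbj) (abs_ne_zero.2 (hc j)))]
        ring
      · ring
    rw [Finset.sum_congr rfl fun j _ => h1 j, Finset.sum_add_distrib, ← Finset.sum_filter,
      ← Finset.sum_mul, hp, Real.log_exp]
    change _ + B * _ = 0
    field_simp
    ring
  set e : Fin m → ℝ → ℝ := fun j x => Real.log (weightedTerm (g j) x / |c j|) with he
  have hbe : ∀ j x, b j * e j x = b j * Real.log (g j / |c j|) + b j * x := by
    intro j x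
    by_cases hbj : b j = 0
    · simp [hbj]
    have hgj : g j ≠ 0 := fun h => hbj ((hgb j).1 h)
    simp only [he, weightedTerm, if_neg hgj]
    rw [mul_div_right_comm, Real.log_mul (div_ne_zero hgj (abs_ne_zero.2 (hc j)))
      (Real.exp_ne_zero x), Real.log_exp]
    ring
  have hexp : ∀ j x, 0 < weightedTerm (g j) x →
      |c j| * Real.exp (e j x) = weightedTerm (g j) x := by
    intro j x hx
    have hcj := abs_pos.2 (hc j)
    simp only [he]
    rw [Real.exp_log (by positivity)]
    field_simp
  have hpos : ∀ w ∈ balancedCone P N g, ∀ j, 0 < weightedTerm (g j) (w j) := fun w hw j =>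
    weightedTerm_pos (hg0 j) (hw.2.2 j)
  set Φ : (Fin m → ℝ) × ℝ → Fin m → ℝ := fun q j => q.2 + e j (q.1 j) with hΦ
  have hcΦ : ∀ w ∈ balancedCone P N g, ∀ μ, ∑ j, c j * Real.exp (Φ (w, μ) j) =
      Real.exp μ * (∑ j ∈ P, weightedTerm (g j) (w j) - ∑ j ∈ N, weightedTerm (g j) (w j)) := by
    intro w hw μ
    rw [hsplit, mul_sub, Finset.mul_sum, Finset.mul_sum, sub_eq_add_neg, ← Finset.sum_neg_distrib]
    congr 1 <;> refine Finset.sum_congr rfl fun j hj => ?_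
    · rw [← hexp j _ (hpos w hw j), abs_of_pos (hcP j hj), Real.exp_add]
      ring
    · rw [← hexp j _ (hpos w hw j), abs_of_neg (hcN j hj), Real.exp_add]
      ring
  have hbΦ : ∀ w μ, ∑ j, b j * Φ (w, μ) j = ∑ j ∈ P, b j * w j + ∑ j ∈ N, b j * w j := by
    intro w μ
    rw [← hsplit]
    simp only [hΦ, mul_add, Finset.sum_add_distrib, ← Finset.sum_mul, hb, hbe, hsum]
    ring
  have hgPsum : ∀ w : Fin m → ℝ, ∑ j ∈ P, g j * w j = p * ∑ j ∈ P, b j * w j := fun w => by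
    rw [Finset.mul_sum]
    exact Finset.sum_congr rfl fun j hj => by rw [hgP j hj]; ring
  have hgNsum : ∀ w : Fin m → ℝ, ∑ j ∈ N, g j * w j = -∑ j ∈ N, b j * w j := fun w => by
    rw [← Finset.sum_neg_distrib]
    exact Finset.sum_congr rfl fun j hj => by rw [hgN j hj]; ring
  have himage : {z : Fin m → ℝ | ∑ j, b j * z j = 0 ∧ ∑ j, c j * Real.exp (z j) = 0} =
      Φ '' (balancedLevelSet P N g ×ˢ Set.univ) := by
    ext z
    constructor
    · rintro ⟨h1, h2⟩
      set μ : ℝ := (∑ j ∈ P, b j * (z j - Real.log (g j / |c j|))) / B with hμ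
      set w : Fin m → ℝ := fun j =>
        if b j = 0 then |c j| * Real.exp (z j - μ) else z j - μ - Real.log (g j / |c j|) with hw
      have hez : ∀ j, μ + e j (w j) = z j := by
        intro j
        have hcj := abs_pos.2 (hc j)
        by_cases hbj : b j = 0
        · simp only [he, hw, weightedTerm, (hgb j).2 hbj, hbj, if_true]
          rw [mul_div_cancel_left₀ _ hcj.ne', Real.log_exp]
          ring
        · have hgj : g j ≠ 0 := fun h => hbj ((hgb j).1 h)
          have := hbe j (w j)
          rw [← mul_add] at this
          rw [mul_left_cancel₀ hbj this]
          simp only [hw, if_neg hbj]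
          ring
      have hΦw : Φ (w, μ) = z := funext hez
      have hwP : ∑ j ∈ P, b j * w j = 0 := by
        by_cases hBz : B = 0
        · exact Finset.sum_eq_zero fun j _ => by rw [hB0 hBz j, zero_mul]
        have : ∀ j, b j * w j = b j * (z j - Real.log (g j / |c j|)) - b j * μ := by
          intro j
          by_cases hbj : b j = 0
          · simp [hbj]
          · simp only [hw, if_neg hbj]
            ring
        rw [Finset.sum_congr rfl fun j _ => this j, Finset.sum_sub_distrib, ← Finset.sum_mul, hμ]
        change _ - B * _ = 0
        field_simp
        ring
      have hwN : ∑ j ∈ N, b j * w j = 0 := by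
        have := hbΦ w μ
        rw [hΦw, h1, hwP] at this
        linarith
      have hwC : w ∈ balancedCone P N g := by
        refine ⟨by rw [hgPsum, hwP, mul_zero], by rw [hgNsum, hwN, neg_zero], fun j hj => ?_⟩
        have hcj := abs_pos.2 (hc j)
        simp only [hw, if_pos ((hgb j).1 hj)]
        positivity
      refine ⟨(w, μ), ⟨⟨hwC, ?_⟩, Set.mem_univ _⟩, hΦw⟩
      have := hcΦ w hwC μ
      rw [hΦw, h2] at this
      have := (mul_eq_zero.1 this.symm).resolve_left (Real.exp_ne_zero μ)
      linarith
    · rintro ⟨⟨w, μ⟩, ⟨⟨hwC, heq⟩, -⟩, rfl⟩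
      refine ⟨?_, ?_⟩
      · have h1 := hwC.1
        have h2 := hwC.2.1
        rw [hgPsum] at h1
        rw [hgNsum] at h2
        rw [hbΦ, (mul_eq_zero.1 h1).resolve_left hppos.ne', neg_eq_zero.1 h2, add_zero]
      · rw [hcΦ w hwC, heq, sub_self, mul_zero]
  rw [himage]
  have hdisj : Disjoint P N := Finset.disjoint_filter_filter_not _ _ _
  have hcover : ∀ j, j ∈ P ∨ j ∈ N := fun j => by
    simp only [hP, hN, mem_filter, mem_univ, true_and]
    exact em _
  refine ((isUnionOfTwoPreconnected_balancedLevelSet hdisj hcover hg0).prod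
    isPreconnected_univ).image (continuousOn_pi.2 fun j => ?_)
  refine continuousOn_snd.add (ContinuousOn.log ?_ ?_)
  · exact (((continuous_weightedTerm (g j)).comp (by fun_prop)).div_const _).continuousOn
  · rintro ⟨w, μ⟩ ⟨hw, -⟩
    exact (div_pos (hpos w hw.1 j) (abs_pos.2 (hc j))).ne'

/-- The exponential hypersurface of a signed circuit is covered by two preconnected pieces. -/
theorem isUnionOfTwoPreconnected_circuit {m : ℕ} {b c : Fin m → ℝ} (hb : ∑ j, b j = 0)
    (hc : ∀ j, c j ≠ 0) :
    IsUnionOfTwoPreconnected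
      {z : Fin m → ℝ | ∑ j, b j * z j = 0 ∧ ∑ j, c j * Real.exp (z j) = 0} := by
  have hneg : {z : Fin m → ℝ | ∑ j, b j * z j = 0 ∧ ∑ j, c j * Real.exp (z j) = 0} =
      {z : Fin m → ℝ | ∑ j, b j * z j = 0 ∧ ∑ j, (-c) j * Real.exp (z j) = 0} := by
    ext z
    simp
  have hnegc : ∀ j, (-c) j ≠ 0 := fun j => neg_ne_zero.2 (hc j)
  by_cases hmix : ∃ i k, 0 < b i ∧ b k < 0 ∧ 0 < c i * c k
  · obtain ⟨i, k, hbi, hbk, hik⟩ := hmix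
    refine .of_isPreconnected ?_
    rcases lt_or_gt_of_ne (hc i) with hci | hci
    · rw [hneg]
      exact isPreconnected_of_opposite_weights hbi hbk (neg_pos.2 hci)
        (neg_pos.2 (neg_of_mul_pos_right hik hci.le))
    · exact isPreconnected_of_opposite_weights hbi hbk hci (pos_of_mul_pos_right hik hci.le)
  push Not at hmix
  by_cases hb0 : ∀ j, b j = 0
  · exact isUnionOfTwoPreconnected_of_mul_nonneg hb hc fun j => by simp [hb0 j]
  push Not at hb0
  obtain ⟨j₀, hj₀⟩ := hb0
  obtain ⟨i, -, hi⟩ := Finset.exists_pos_of_sum_zero_of_exists_nonzero b hb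
    ⟨j₀, mem_univ _, hj₀⟩
  obtain ⟨k, -, hk⟩ := Finset.exists_pos_of_sum_zero_of_exists_nonzero (fun j => -b j)
    (by simp [hb]) ⟨j₀, mem_univ _, neg_ne_zero.2 hj₀⟩
  rw [neg_pos] at hk
  have hik := hmix i k hi hk
  rcases lt_or_gt_of_ne (hc i) with hci | hci
  · have hck : 0 < c k := lt_of_le_of_ne (nonneg_of_mul_nonpos_right hik hci) (hc k).symm
    rw [hneg]
    refine isUnionOfTwoPreconnected_of_mul_nonneg hb hnegc fun j => ?_
    simp only [Pi.neg_apply]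
    rcases lt_trichotomy (b j) 0 with h | h | h
    · nlinarith [nonneg_of_mul_nonpos_right (hmix i j hi h) hci]
    · simp [h]
    · have : c j ≤ 0 := by
        by_contra! hcj
        nlinarith [hmix j k h hk, mul_pos hcj hck]
      nlinarith
  · have hck : c k < 0 := by
      refine lt_of_le_of_ne ?_ (hc k)
      by_contra! h
      nlinarith [mul_pos hci h]
    refine isUnionOfTwoPreconnected_of_mul_nonneg hb hc fun j => ?_
    rcases lt_trichotomy (b j) 0 with h | h | h
    · have : c j ≤ 0 := by
        by_contra! hcj
        nlinarith [hmix i j hi h, mul_pos hci hcj]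
      nlinarith
    · simp [h]
    · have : 0 ≤ c j := by
        by_contra! hcj
        nlinarith [hmix j k h hk, mul_pos_of_neg_of_neg hcj hck]
      nlinarith

theorem LinearMap.exists_quasiInverse {K E F : Type*} [Field K] [AddCommGroup E] [Module K E]
    [AddCommGroup F] [Module K F] (L : E →ₗ[K] F) :
    ∃ σ : F →ₗ[K] E, ∀ x, L (σ (L x)) = L x := by
  obtain ⟨s, hs⟩ := L.rangeRestrict.exists_rightInverse_of_surjective L.range_rangeRestrict
  obtain ⟨σ, hσ⟩ := LinearMap.exists_extend s
  refine ⟨σ, fun x => ?_⟩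
  have h1 : σ (L x) = s (L.rangeRestrict x) := LinearMap.congr_fun hσ (L.rangeRestrict x)
  have h2 := LinearMap.congr_fun hs (L.rangeRestrict x)
  rw [h1]
  exact congrArg Subtype.val h2

/-- A configuration of at most two more points than its dimension has at most one affine
relation, and that relation cuts out the values of affine functions on the configuration. -/
theorem exists_affine_relation_s4 {n m : ℕ} (hm : 1 ≤ m) (A : Fin m → Fin n → ℝ)
    (hdim : m ≤ 2 + Module.finrank ℝ
      (Submodule.span ℝ {v : Fin n → ℝ | ∃ j k : Fin m, v = A j - A k})) :
    ∃ b : Fin m → ℝ, ∑ j, b j = 0 ∧ (∀ i, ∑ j, b j * A j i = 0) ∧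
      ∀ z : Fin m → ℝ, ∑ j, b j * z j = 0 →
        ∃ (y : Fin n → ℝ) (μ : ℝ), ∀ j, ∑ i, A j i * y i + μ = z j := by
  classical
  set D := Submodule.span ℝ {v : Fin n → ℝ | ∃ j k : Fin m, v = A j - A k} with hD
  set T : (Fin m → ℝ) →ₗ[ℝ] (Fin n → ℝ) × ℝ :=
    Fintype.linearCombination ℝ (fun j => (A j, (1 : ℝ))) with hT
  have hTapply : ∀ b, T b = ∑ j, b j • (A j, (1 : ℝ)) := fun b => by
    simp [hT, Fintype.linearCombination_apply]
  have hTsingle : ∀ j, T (Pi.single j 1) = (A j, 1) := fun j => by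
    simp [hT, Fintype.linearCombination_apply_single]
  have hker : ∀ b ∈ LinearMap.ker T, ∑ j, b j = 0 ∧ ∀ i, ∑ j, b j * A j i = 0 := by
    intro b hb
    rw [LinearMap.mem_ker, hTapply] at hb
    refine ⟨?_, fun i => ?_⟩
    · simpa [Prod.snd_sum] using congrArg Prod.snd hb
    · simpa [Prod.fst_sum] using congrFun (congrArg Prod.fst hb) i
  have hlt : D.map (LinearMap.inl ℝ (Fin n → ℝ) ℝ) < LinearMap.range T := by
    refine lt_of_le_of_ne ?_ fun heq => ?_
    · rw [Submodule.map_le_iff_le_comap, hD, Submodule.span_le]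
      rintro v ⟨j, k, rfl⟩
      refine ⟨Pi.single j 1 - Pi.single k 1, ?_⟩
      rw [map_sub, hTsingle, hTsingle]
      simp
    · have : T (Pi.single ⟨0, hm⟩ 1) ∈ D.map (LinearMap.inl ℝ (Fin n → ℝ) ℝ) := by
        rw [heq]; exact LinearMap.mem_range_self _ _
      rw [hTsingle] at this
      obtain ⟨v, -, hv⟩ := this
      simpa using congrArg Prod.snd hv
  have hrank := Submodule.finrank_lt_finrank_of_lt hlt
  rw [← (D.equivMapOfInjective _ LinearMap.inl_injective).finrank_eq] at hrank
  have hrn := T.finrank_range_add_finrank_ker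
  rw [Module.finrank_fin_fun] at hrn
  obtain ⟨b, hb⟩ := (finrank_le_one_iff (K := ℝ) (V := LinearMap.ker T)).1 (by lia)
  refine ⟨b, (hker b b.2).1, (hker b b.2).2, fun z hz => ?_⟩
  set ζ : Module.Dual ℝ (Fin m → ℝ) := Fintype.linearCombination ℝ z with hζ
  have hζapply : ∀ v, ζ v = ∑ j, v j * z j := fun v => by
    simp [hζ, Fintype.linearCombination_apply]
  have hmem : ζ ∈ LinearMap.range T.dualMap := by
    rw [LinearMap.range_dualMap_eq_dualAnnihilator_ker, Submodule.mem_dualAnnihilator]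
    intro v hv
    obtain ⟨r, hr⟩ := hb ⟨v, hv⟩
    have hv' : v = r • (b : Fin m → ℝ) := (congrArg Subtype.val hr).symm
    rw [hv', map_smul, hζapply, hz, smul_zero]
  obtain ⟨ℓ, hℓ⟩ := hmem
  refine ⟨fun i => ℓ (Pi.single i 1, 0), ℓ (0, 1), fun j => ?_⟩
  have h1 : ζ (Pi.single j 1) = z j := by
    simp [hζ, Fintype.linearCombination_apply_single]
  rw [← h1, ← hℓ, LinearMap.dualMap_apply, hTsingle]
  have h2 : (A j, (1 : ℝ)) =
      ∑ i, A j i • ((Pi.single i 1 : Fin n → ℝ), (0 : ℝ)) + ((0 : Fin n → ℝ), (1 : ℝ)) := by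
    refine Prod.ext ?_ ?_
    · ext k
      simp [Prod.fst_sum, Pi.single_apply]
    · simp [Prod.snd_sum]
  rw [h2, map_add, map_sum]
  simp only [map_smul, smul_eq_mul]

/-- In logarithmic coordinates, the zero set of an exponential sum whose exponents satisfy at
most one affine relation is covered by two preconnected pieces. -/
theorem isUnionOfTwoPreconnected_exponential_sum {n m : ℕ} (hm : 1 ≤ m) (A : Fin m → Fin n → ℝ)
    {c : Fin m → ℝ} (hc : ∀ j, c j ≠ 0)
    (hdim : m ≤ 2 + Module.finrank ℝ
      (Submodule.span ℝ {v : Fin n → ℝ | ∃ j k : Fin m, v = A j - A k})) :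
    IsUnionOfTwoPreconnected {y : Fin n → ℝ | ∑ j, c j * Real.exp (∑ i, A j i * y i) = 0} := by
  obtain ⟨b, hb, hbA, hsolve⟩ := exists_affine_relation_s4 hm A hdim
  set L : (Fin n → ℝ) × ℝ →ₗ[ℝ] (Fin m → ℝ) :=
    { toFun := fun q j => ∑ i, A j i * q.1 i + q.2
      map_add' := fun q r => by
        ext j
        simp [mul_add, Finset.sum_add_distrib]
        ring
      map_smul' := fun t q => by
        ext j
        simp [mul_add, Finset.mul_sum, mul_left_comm] } with hL
  have hLapply : ∀ q j, L q j = ∑ i, A j i * q.1 i + q.2 := fun q j => rfl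
  obtain ⟨σ, hσ⟩ := L.exists_quasiInverse
  have hbL : ∀ y, ∑ j, b j * L (y, 0) j = 0 := by
    intro y
    simp only [hLapply, add_zero, Finset.mul_sum]
    rw [Finset.sum_comm]
    refine Finset.sum_eq_zero fun i _ => ?_
    rw [← zero_mul (y i), ← hbA i, Finset.sum_mul]
    exact Finset.sum_congr rfl fun j _ => by ring
  set S : Set (Fin m → ℝ) := {z | ∑ j, b j * z j = 0 ∧ ∑ j, c j * Real.exp (z j) = 0} with hS
  have himage : {y : Fin n → ℝ | ∑ j, c j * Real.exp (∑ i, A j i * y i) = 0} =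
      (fun q : (Fin m → ℝ) × ((Fin n → ℝ) × ℝ) => (σ q.1 + q.2).1) ''
        (S ×ˢ (LinearMap.ker L : Set ((Fin n → ℝ) × ℝ))) := by
    ext y
    constructor
    · intro hy
      refine ⟨(L (y, 0), (y, 0) - σ (L (y, 0))), ⟨⟨hbL y, ?_⟩, ?_⟩, by simp⟩
      · simpa [hLapply] using hy
      · simp [hσ]
    · rintro ⟨⟨z, q⟩, ⟨⟨hz1, hz2⟩, hq⟩, rfl⟩
      obtain ⟨y, μ, hyμ⟩ := hsolve z hz1
      have hzL : z = L (y, μ) := funext fun j => (hyμ j).symm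
      have h : L (σ z + q) = z := by
        rw [map_add, LinearMap.mem_ker.1 hq, add_zero, hzL, hσ]
      set r := σ z + q with hr
      change ∑ j, c j * Real.exp (∑ i, A j i * r.1 i) = 0
      have hj : ∀ j, c j * Real.exp (∑ i, A j i * r.1 i) =
          c j * Real.exp (z j) * Real.exp (-r.2) := by
        intro j
        rw [mul_assoc, ← Real.exp_add, ← congrFun h j, hLapply]
        congr 2
        ring
      rw [Finset.sum_congr rfl fun j _ => hj j, ← Finset.sum_mul, hz2, zero_mul]
  rw [himage]
  refine ((isUnionOfTwoPreconnected_circuit hb hc).prod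
    (LinearMap.ker L).convex.isPreconnected).image (Continuous.continuousOn ?_)
  have hσc : Continuous σ := σ.continuous_of_finiteDimensional
  fun_prop

theorem isUnionOfTwoPreconnected_positive_zero_set {n m : ℕ} (hm : 1 ≤ m) (a : Fin m → Fin n → ℤ)
    {c : Fin m → ℝ} (hc : ∀ j, c j ≠ 0)
    (hdim : m ≤ 2 + Module.finrank ℝ (Submodule.span ℝ
      {v : Fin n → ℝ | ∃ j k : Fin m,
        v = (fun i => (a j i : ℝ)) - fun i => (a k i : ℝ)})) :
    IsUnionOfTwoPreconnected
      {x : Fin n → ℝ | (∀ i, 0 < x i) ∧ ∑ j, c j * ∏ i, (x i) ^ (a j i) = 0} := by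
  have hmon : ∀ (y : Fin n → ℝ) j, ∏ i, (Real.exp (y i)) ^ (a j i) =
      Real.exp (∑ i, (a j i : ℝ) * y i) := by
    intro y j
    rw [Real.exp_sum]
    exact Finset.prod_congr rfl fun i _ => by
      rw [mul_comm, Real.exp_mul, Real.rpow_intCast]
  have himage : {x : Fin n → ℝ | (∀ i, 0 < x i) ∧ ∑ j, c j * ∏ i, (x i) ^ (a j i) = 0} =
      (fun (y : Fin n → ℝ) i => Real.exp (y i)) ''
        {y : Fin n → ℝ | ∑ j, c j * Real.exp (∑ i, (a j i : ℝ) * y i) = 0} := by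
    ext x
    constructor
    · rintro ⟨hx, hf⟩
      have hxe : (fun i => Real.exp (Real.log (x i))) = x := funext fun i => Real.exp_log (hx i)
      refine ⟨fun i => Real.log (x i), ?_, hxe⟩
      simp only [Set.mem_ofPred_eq, ← hmon]
      rw [← hf]
      simp only [Real.exp_log (hx _)]
    · rintro ⟨y, hy, rfl⟩
      refine ⟨fun i => Real.exp_pos _, ?_⟩
      simp only [hmon]
      exact hy
  rw [himage]
  exact (isUnionOfTwoPreconnected_exponential_sum hm (fun j i => (a j i : ℝ)) hc hdim).image
    (Continuous.continuousOn (by fun_prop))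

theorem finite_positive_zero_set_univariate {m : ℕ} (hm : 1 ≤ m) {a : Fin m → Fin 1 → ℤ}
    (hinj : Function.Injective a) {c : Fin m → ℝ} (hc : ∀ j, c j ≠ 0) :
    {x : Fin 1 → ℝ | (∀ i, 0 < x i) ∧ ∑ j, c j * ∏ i, (x i) ^ (a j i) = 0}.Finite := by
  classical
  set K : ℤ := ∑ j, |a j 0| with hK
  have hKnonneg : ∀ j, 0 ≤ a j 0 + K := by
    intro j
    have h1 : |a j 0| ≤ K :=
      Finset.single_le_sum (f := fun j => |a j 0|) (fun j _ => abs_nonneg _) (mem_univ j)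
    have h2 := neg_abs_le (a j 0)
    linarith
  have hexp_inj : ∀ j k, (a j 0 + K).toNat = (a k 0 + K).toNat → j = k := by
    intro j k h
    apply hinj
    ext i
    rw [Subsingleton.elim i 0]
    have := hKnonneg j
    have := hKnonneg k
    lia
  set p : Polynomial ℝ := ∑ j, Polynomial.C (c j) * Polynomial.X ^ (a j 0 + K).toNat with hp
  have hp0 : p ≠ 0 := by
    intro h
    set j₀ : Fin m := ⟨0, hm⟩
    have hcoeff := congrArg (fun q => q.coeff (a j₀ 0 + K).toNat) h
    simp only [hp, Polynomial.finsetSum_coeff, Polynomial.coeff_C_mul_X_pow,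
      Polynomial.coeff_zero] at hcoeff
    rw [Finset.sum_eq_single j₀] at hcoeff
    · exact hc j₀ (by simpa using hcoeff)
    · intro k _ hk
      exact if_neg fun h => hk (hexp_inj _ _ h).symm
    · simp
  refine Set.Finite.of_finite_image (f := fun x : Fin 1 → ℝ => x 0)
    ((p.roots.toFinset.finite_toSet).subset ?_) ?_
  · rintro _ ⟨x, ⟨hx, hf⟩, rfl⟩
    rw [Finset.mem_coe, Multiset.mem_toFinset, Polynomial.mem_roots hp0]
    simp only [Polynomial.IsRoot.def, hp, Polynomial.eval_finsetSum, Polynomial.eval_mul,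
      Polynomial.eval_C, Polynomial.eval_pow, Polynomial.eval_X]
    rw [← zero_mul (x 0 ^ K), ← hf, Finset.sum_mul]
    refine Finset.sum_congr rfl fun j _ => ?_
    rw [Fin.prod_univ_one, mul_assoc, ← zpow_add₀ (hx 0).ne', ← zpow_natCast,
      Int.toNat_of_nonneg (hKnonneg j)]
  · intro x _ y _ h
    ext i
    rw [Subsingleton.elim i 0]
    exact h

/-- Bounds on the number of non-compact connected components of
the positive zero set of an n-variate m-nomial with m ≤ 2 + dim Supp(f). -/
theorem noncompact_component_bounds
    (n m : ℕ) (hn : 1 ≤ n) (hm : 1 ≤ m)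
    (a : Fin m → Fin n → ℤ) (hinj : Function.Injective a)
    (c : Fin m → ℝ) (hc : ∀ j, c j ≠ 0)
    (hdim : m ≤ 2 + Module.finrank ℝ (Submodule.span ℝ
      {v : Fin n → ℝ | ∃ j k : Fin m,
        v = (fun i => (a j i : ℝ)) - fun i => (a k i : ℝ)})) :
    ∀ Z : Set (Fin n → ℝ),
      Z = {x | (∀ i, 0 < x i) ∧ ∑ j, c j * ∏ i, (x i) ^ (a j i) = 0} →
      ∀ N : Set (Set (Fin n → ℝ)),
        N = {C | (∃ x ∈ Z, C = connectedComponentIn Z x) ∧ ¬ IsCompact C} →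
        N.Finite ∧
        (n = 1 → N.ncard ≤ 0) ∧
        (n = 2 → N.ncard ≤ 2) ∧
        (n = 3 → N.ncard ≤ 6) ∧
        (n = 4 → N.ncard ≤ 9) ∧
        (5 ≤ n → N.ncard ≤ 2 * n + 2) := by
  rintro Z hZ N hN
  have htwo := isUnionOfTwoPreconnected_positive_zero_set hm a hc hdim
  rw [← hZ] at htwo
  obtain ⟨D, E, hDE⟩ := htwo.exists_components_subset_pair
  have hsub : N ⊆ {D, E} := by
    rw [hN]
    exact fun C hC => hDE hC.1
  have hfin : ({D, E} : Set (Set (Fin n → ℝ))).Finite := Set.toFinite _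
  have hcard : N.ncard ≤ 2 := (Set.ncard_le_ncard hsub hfin).trans (by
    simpa using Set.ncard_insert_le D {E})
  refine ⟨hfin.subset hsub, ?_, by lia, by lia, by lia, by lia⟩
  rintro rfl
  have hZfin : Z.Finite := hZ ▸ finite_positive_zero_set_univariate hm hinj hc
  have hNempty : N = ∅ := by
    rw [hN, Set.eq_empty_iff_forall_notMem]
    rintro C ⟨⟨x, -, rfl⟩, hC⟩
    exact hC (hZfin.subset (connectedComponentIn_subset Z x)).isCompact
  simp [hNempty]
end
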